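/- arXiv:1706.06893 — 2 statements merged into one kernel-verified Lean document; each statement's English description precedes it below -/
import Mathlib

section
/- Let N ≥ 1, Ω ⊂ ℝ^N a nonempty bounded open set and p > 2. Let f : ℝ → ℝ be continuous with f(0) = 0 and f(u) > 0 for u > 0, and suppose there is a constant γ > 0 such that p F(u) ≤ u f(u) + γ for all u > 0 (condition (C_p)'). Let u₀ be a nonnegative, not identically zero, continuously differentiable function on the closure of Ω with u₀ = 0 on ∂Ω satisfying J_p(0) := −(1/p)∫_Ω ‖∇u₀(x)‖^p dx + ∫_Ω (F(u₀(x)) − γ) dx > 0. Set σ := √(p/2) − 1 (> 0 since p > 2) and M := (p/(p−2))·(1+√(p/2))·(∫_Ω u₀² dx)² / (2p J_p(0)). Then for every T > 0: if u is continuous on cl(Ω)×[0,T), sufficiently smooth on Ω×(0,T), nonnegative, satisfies ∂_t u(x,t) = div_x(‖∇_x u(x,t)‖^{p−2} ∇_x u(x,t)) + f(u(x,t)) pointwise on Ω×(0,T), u(x,t) = 0 for x ∈ ∂Ω and t ∈ [0,T), and u(x,0) = u₀(x), then T ≤ M/(σ ∫_Ω u₀² dx); i.e. the solution blows up in finite time.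 -/
open MeasureTheory Real Set

/-- The `p`-Laplacian `div(‖∇w‖^{p-2} ∇w)` of `w` at `x`, computed pointwise. -/
noncomputable def pLaplacian {N : ℕ} (p : ℝ) (w : EuclideanSpace ℝ (Fin N) → ℝ)
    (x : EuclideanSpace ℝ (Fin N)) : ℝ :=
  ∑ i, EuclideanSpace.proj i
    (fderiv ℝ (fun y => ‖gradient w y‖ ^ (p - 2) • gradient w y) x (EuclideanSpace.single i 1))

/-- The scalar nonlinearity `|s|^{p-2} s`. -/
noncomputable def signedPow (p s : ℝ) : ℝ := |s| ^ (p - 2) * s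

lemma signedPow_neg (p s : ℝ) : signedPow p (-s) = -signedPow p s := by
  simp [signedPow]

lemma signedPow_zero (p : ℝ) : signedPow p 0 = 0 := by simp [signedPow]

lemma signedPow_mul_self {p : ℝ} (hp : 2 < p) (s : ℝ) : signedPow p s * s = |s| ^ p := by
  rcases eq_or_ne s 0 with rfl | hs
  · simp [signedPow, Real.zero_rpow (by linarith : p ≠ 0)]
  · have h : 0 < |s| := abs_pos.2 hs
    have h2 : s * s = |s| ^ (2 : ℝ) := by
      rw [Real.rpow_two, sq_abs, sq]
    rw [signedPow, mul_assoc, h2, ← Real.rpow_add h]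
    congr 1; ring

lemma signedPow_div {p r : ℝ} (hr : 0 < r) (s : ℝ) :
    signedPow p (s / r) = r ^ (1 - p) * signedPow p s := by
  rw [signedPow, signedPow, abs_div, abs_of_pos hr, Real.div_rpow (abs_nonneg _) hr.le]
  have : r ^ (1 - p) = (r ^ (p - 2))⁻¹ * r⁻¹ := by
    rw [← Real.rpow_neg hr.le, ← Real.rpow_neg_one r, ← Real.rpow_add hr]
    congr 1; ring
  rw [this]; ring

lemma continuous_abs_rpow_sub_two {p : ℝ} (hp : 2 < p) :
    Continuous fun s : ℝ => |s| ^ (p - 2) :=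
  continuous_abs.rpow_const fun _ => Or.inr (by linarith)

lemma hasDerivAt_signedPow {p : ℝ} (hp : 2 < p) (s : ℝ) :
    HasDerivAt (signedPow p) ((p - 1) * |s| ^ (p - 2)) s := by
  have key : ∀ s : ℝ, 0 < s → HasDerivAt (signedPow p) ((p - 1) * |s| ^ (p - 2)) s := by
    intro s hs
    have h1 := Real.hasDerivAt_rpow_const (x := s) (p := p - 1) (Or.inl hs.ne')
    rw [abs_of_pos hs]
    have e : p - 1 - 1 = p - 2 := by ring
    rw [e] at h1
    refine h1.congr_of_eventuallyEq ?_
    filter_upwards [lt_mem_nhds hs] with y hy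
    rw [signedPow, abs_of_pos hy, ← Real.rpow_add_one hy.ne']
    congr 1; ring
  rcases lt_trichotomy s 0 with hs | rfl | hs
  · have h1 := (key (-s) (by linarith)).comp s (hasDerivAt_neg s)
    have h2 := h1.neg
    simp only [abs_neg] at h2
    refine (h2.congr_deriv (by ring)).congr_of_eventuallyEq (Filter.Eventually.of_forall ?_)
    intro y
    simp [signedPow_neg]
  · rw [hasDerivAt_iff_tendsto_slope]
    have h0 : (p - 1) * |(0 : ℝ)| ^ (p - 2) = |(0 : ℝ)| ^ (p - 2) := by
      simp [Real.zero_rpow (by linarith : p - 2 ≠ 0)]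
    rw [h0]
    refine ((continuous_abs_rpow_sub_two hp).continuousAt.tendsto.mono_left
      nhdsWithin_le_nhds).congr' ?_
    filter_upwards [self_mem_nhdsWithin] with y hy
    have : y ≠ 0 := hy
    rw [slope_def_field, signedPow_zero, signedPow]
    field_simp
    simp
  · exact key s hs

lemma continuous_signedPow {p : ℝ} (hp : 2 < p) : Continuous (signedPow p) :=
  (continuous_abs_rpow_sub_two hp).mul continuous_id

lemma hasStrictDerivAt_signedPow {p : ℝ} (hp : 2 < p) (s : ℝ) :
    HasStrictDerivAt (signedPow p) ((p - 1) * |s| ^ (p - 2)) s :=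
  hasStrictDerivAt_of_hasDerivAt_of_continuousAt
    (Filter.Eventually.of_forall (hasDerivAt_signedPow hp))
    ((continuous_abs_rpow_sub_two hp).const_mul _ |>.continuousAt)

lemma monotone_signedPow {p : ℝ} (hp : 2 < p) : Monotone (signedPow p) :=
  monotone_of_deriv_nonneg (fun s => (hasDerivAt_signedPow hp s).differentiableAt) fun s => by
    rw [(hasDerivAt_signedPow hp s).deriv]
    have : 0 ≤ p - 1 := by linarith
    positivity

lemma abs_signedPow_sub_le {p : ℝ} (hp : 2 < p) {M a b : ℝ} (ha : |a| ≤ M) (hb : |b| ≤ M) :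
    |signedPow p a - signedPow p b| ≤ (p - 1) * M ^ (p - 2) * |a - b| := by
  have h := Convex.norm_image_sub_le_of_norm_hasDerivWithin_le
    (f := signedPow p) (f' := fun s => (p - 1) * |s| ^ (p - 2)) (s := Icc (-M) M)
    (C := (p - 1) * M ^ (p - 2)) (x := b) (y := a)
    (fun x _ => (hasDerivAt_signedPow hp x).hasDerivWithinAt) ?_ (convex_Icc _ _)
    (abs_le.1 hb) (abs_le.1 ha)
  · simpa [Real.norm_eq_abs] using h
  · intro x hx
    have hx' : |x| ≤ M := abs_le.2 hx
    have hp1 : 0 ≤ p - 1 := by linarith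
    rw [Real.norm_eq_abs, abs_of_nonneg (by positivity)]
    gcongr

lemma hasDerivAt_abs_rpow' {p : ℝ} (hp : 2 < p) (s : ℝ) :
    HasDerivAt (fun s : ℝ => |s| ^ p) (p * signedPow p s) s := by
  refine (hasDerivAt_abs_rpow s (by linarith)).congr_deriv ?_
  rw [signedPow]; ring

/-- The tent function `max 0 (1 - ‖z‖)`. -/
noncomputable def tent {N : ℕ} (z : EuclideanSpace ℝ (Fin N)) : ℝ := max 0 (1 - ‖z‖)

section Tent
variable {N : ℕ}
local notation "E" => EuclideanSpace ℝ (Fin N)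

lemma continuous_tent : Continuous (tent : E → ℝ) := by unfold tent; fun_prop

lemma tent_nonneg (z : E) : 0 ≤ tent z := le_max_left _ _

lemma tent_neg (z : E) : tent (-z) = tent z := by simp [tent]

lemma tent_eq_zero {z : E} (hz : 1 ≤ ‖z‖) : tent z = 0 := max_eq_left (by linarith)

lemma norm_lt_one_of_tent_ne_zero {z : E} (hz : tent z ≠ 0) : ‖z‖ < 1 := by
  by_contra h
  exact hz (tent_eq_zero (not_lt.1 h))

lemma tent_map (U : E ≃ₗᵢ[ℝ] E) (z : E) : tent (U z) = tent z := by simp [tent]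

lemma hasCompactSupport_tent : HasCompactSupport (tent : E → ℝ) :=
  HasCompactSupport.of_support_subset_isCompact (isCompact_closedBall (0 : E) 1) fun z hz => by
    simpa using (norm_lt_one_of_tent_ne_zero hz).le

lemma integrable_tent : Integrable (tent : E → ℝ) :=
  continuous_tent.integrable_of_hasCompactSupport hasCompactSupport_tent

lemma integrable_tent_mul {g : E → ℝ} (hg : Continuous g) : Integrable fun z => tent z * g z :=
  (continuous_tent.mul hg).integrable_of_hasCompactSupport hasCompactSupport_tent.mul_right

/-- The vector field `∫ tent z |⟪q, z⟫|^{p-2} ⟪q, z⟫ z dz`. -/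
noncomputable def flux (p : ℝ) (q : E) : E := ∫ z : E, (tent z * signedPow p (inner ℝ q z)) • z

lemma continuous_signedPow_inner {p : ℝ} (hp : 2 < p) (q : E) :
    Continuous fun z : E => signedPow p (inner ℝ q z) :=
  (continuous_signedPow hp).comp (by fun_prop)

lemma continuous_flux_integrand {p : ℝ} (hp : 2 < p) (q : E) :
    Continuous fun z : E => (tent z * signedPow p (inner ℝ q z)) • z :=
  (continuous_tent.mul (continuous_signedPow_inner hp q)).smul continuous_id

lemma integrable_flux_integrand {p : ℝ} (hp : 2 < p) (q : E) :
    Integrable fun z : E => (tent z * signedPow p (inner ℝ q z)) • z :=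
  (continuous_flux_integrand hp q).integrable_of_hasCompactSupport
    (hasCompactSupport_tent.mul_right.smul_right)

lemma inner_flux {p : ℝ} (hp : 2 < p) (q : E) :
    inner ℝ q (flux p q) = ∫ z : E, tent z * |inner ℝ q z| ^ p := by
  rw [flux, ← integral_inner (integrable_flux_integrand hp q)]
  congr 1; ext z
  rw [inner_smul_right, mul_assoc, signedPow_mul_self hp]

lemma flux_map (p : ℝ) (U : E ≃ₗᵢ[ℝ] E) (q : E) : flux p (U q) = U (flux p q) := by
  rw [flux, ← U.measurePreserving.integral_comp U.toHomeomorph.measurableEmbedding, flux]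
  simp only [tent_map, LinearIsometryEquiv.inner_map_map]
  rw [← LinearIsometryEquiv.coe_toContinuousLinearEquiv,
    ← ContinuousLinearEquiv.integral_comp_comm]
  simp

/-- By rotational symmetry, `flux p q` is a constant multiple of `‖q‖^{p-2} q`. -/
lemma exists_flux_eq {p : ℝ} (hp : 2 < p) (hN : 1 ≤ N) :
    ∃ κ : ℝ, 0 < κ ∧ ∀ q : E, flux p q = (κ * ‖q‖ ^ (p - 2)) • q := by
  set e₀ : E := EuclideanSpace.single ⟨0, hN⟩ 1 with he₀
  have hne : ‖e₀‖ = 1 := by simp [he₀]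
  set κ : ℝ := ∫ z : E, tent z * |inner ℝ e₀ z| ^ p with hκ
  have hp0 : 0 < p := by linarith
  have hnorm : ∀ q q' : E, ‖q‖ = ‖q'‖ → inner ℝ q (flux p q) = inner ℝ q' (flux p q') := by
    intro q q' h
    rw [← Submodule.reflection_sub h, flux_map, LinearIsometryEquiv.inner_map_map]
  have hval : ∀ q : E, inner ℝ q (flux p q) = κ * ‖q‖ ^ p := by
    intro q
    have h1 : ‖q‖ = ‖‖q‖ • e₀‖ := by simp [norm_smul, hne]
    rw [hnorm q _ h1, inner_flux hp, hκ, mul_comm, ← integral_const_mul]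
    congr 1; ext z
    rw [real_inner_smul_left, abs_mul, abs_norm, Real.mul_rpow (norm_nonneg _) (abs_nonneg _)]
    ring
  refine ⟨κ, ?_, ?_⟩
  · refine Continuous.integral_pos_of_hasCompactSupport_nonneg_nonzero
      (x := (1 / 2 : ℝ) • e₀) ?_ hasCompactSupport_tent.mul_right ?_ ?_
    · exact continuous_tent.mul ((by fun_prop : Continuous fun z : E => |inner ℝ e₀ z|).rpow_const
        fun _ => Or.inr hp0.le)
    · intro z; exact mul_nonneg (tent_nonneg z) (by positivity)
    · have : inner ℝ e₀ ((1 / 2 : ℝ) • e₀) = 1 / 2 := by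
        rw [inner_smul_right, real_inner_self_eq_norm_sq, hne]; norm_num
      rw [this, tent, norm_smul, hne]
      norm_num
      positivity
  · intro q
    rcases eq_or_ne q 0 with rfl | hq
    · simp [flux, signedPow_zero]
    have hfix : flux p q ∈ Submodule.span ℝ {q} := by
      rw [← Submodule.reflection_eq_self_iff, ← flux_map,
        Submodule.reflection_mem_subspace_eq_self (Submodule.mem_span_singleton_self q)]
    obtain ⟨c, hc⟩ := Submodule.mem_span_singleton.1 hfix
    have h2 := hval q
    have hq' : 0 < ‖q‖ := norm_pos_iff.2 hq
    rw [← hc, inner_smul_right, real_inner_self_eq_norm_sq] at h2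
    rw [← hc]
    congr 1
    have h3 : ‖q‖ ^ p = ‖q‖ ^ (p - 2) * ‖q‖ ^ 2 := by
      rw [← Real.rpow_two, ← Real.rpow_add hq']; congr 1; ring
    rw [h3, ← mul_assoc] at h2
    exact mul_right_cancel₀ (by positivity) h2

lemma integral_tent_mul_abs_inner_rpow {p κ : ℝ} (hp : 2 < p)
    (hflux : ∀ q : E, flux p q = (κ * ‖q‖ ^ (p - 2)) • q) (q : E) :
    ∫ z : E, tent z * |inner ℝ q z| ^ p = κ * ‖q‖ ^ p := by
  rw [← inner_flux hp, hflux, inner_smul_right, real_inner_self_eq_norm_sq]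
  rcases eq_or_ne q 0 with rfl | hq
  · simp [Real.zero_rpow (by linarith : p ≠ 0)]
  · have hq' : 0 < ‖q‖ := norm_pos_iff.2 hq
    rw [mul_assoc, ← Real.rpow_two, ← Real.rpow_add hq']; congr 2; ring

/-- The derivative of the integrand of `flux`. -/
noncomputable def fluxDeriv (p : ℝ) (q z : E) : E →L[ℝ] E :=
  (tent z * ((p - 1) * |inner ℝ q z| ^ (p - 2))) • (innerSL ℝ z).smulRight z

lemma continuous_fluxDeriv {p : ℝ} (hp : 2 < p) (q : E) : Continuous (fluxDeriv p q) := by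
  unfold fluxDeriv
  have h1 : Continuous fun z : E => |inner ℝ q z| ^ (p - 2) :=
    (continuous_abs_rpow_sub_two hp).comp (by fun_prop)
  have h2 : Continuous fun z : E => (innerSL ℝ z).smulRight z :=
    (ContinuousLinearMap.smulRightL ℝ E E).continuous₂.comp
      ((innerSL ℝ).continuous.prodMk continuous_id)
  exact (continuous_tent.mul (continuous_const.mul h1)).smul h2

lemma hasCompactSupport_fluxDeriv (p : ℝ) (q : E) : HasCompactSupport (fluxDeriv p q) := by
  refine HasCompactSupport.of_support_subset_isCompact (isCompact_closedBall (0 : E) 1) fun z hz => ?_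
  by_contra h
  refine hz ?_
  rw [fluxDeriv, tent_eq_zero (by simpa using (not_le.1 fun h' => h (by simpa using h')).le),
    zero_mul, zero_smul]

lemma integrable_fluxDeriv {p : ℝ} (hp : 2 < p) (q : E) : Integrable (fluxDeriv p q) :=
  (continuous_fluxDeriv hp q).integrable_of_hasCompactSupport (hasCompactSupport_fluxDeriv p q)

lemma norm_fluxDeriv {p : ℝ} (hp : 2 < p) (q z : E) :
    ‖fluxDeriv p q z‖ = tent z * ((p - 1) * |inner ℝ q z| ^ (p - 2)) * (‖z‖ * ‖z‖) := by
  have h : 0 ≤ tent z * ((p - 1) * |inner ℝ q z| ^ (p - 2)) :=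
    mul_nonneg (tent_nonneg z) (mul_nonneg (by linarith) (Real.rpow_nonneg (abs_nonneg _) _))
  unfold fluxDeriv
  rw [norm_smul, ContinuousLinearMap.norm_smulRight_apply, Real.norm_eq_abs, abs_of_nonneg h]
  congr 2
  exact innerSL_apply_norm ℝ z

lemma norm_fluxDeriv_le {p M : ℝ} (hp : 2 < p) {q : E} (hq : ‖q‖ ≤ M) (z : E) :
    ‖fluxDeriv p q z‖ ≤ tent z * ((p - 1) * M ^ (p - 2)) := by
  have hp1 : 0 ≤ p - 1 := by linarith
  have hM : 0 ≤ M := (norm_nonneg q).trans hq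
  rw [norm_fluxDeriv hp]
  rcases eq_or_ne (tent z) 0 with h0 | h0
  · rw [h0, zero_mul, zero_mul, zero_mul]
  have hz := (norm_lt_one_of_tent_ne_zero h0).le
  have h1 : |inner ℝ q z| ≤ M :=
    (abs_real_inner_le_norm q z).trans
      ((mul_le_mul hq hz (norm_nonneg z) hM).trans_eq (mul_one M))
  have h2 : |inner ℝ q z| ^ (p - 2) ≤ M ^ (p - 2) :=
    Real.rpow_le_rpow (abs_nonneg _) h1 (by linarith)
  have h3 : ‖z‖ * ‖z‖ ≤ 1 := mul_le_one₀ hz (norm_nonneg z) hz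
  have h4 := mul_le_mul_of_nonneg_left (mul_le_mul_of_nonneg_left h2 hp1) (tent_nonneg z)
  exact (mul_le_of_le_one_right (mul_nonneg (tent_nonneg z)
    (mul_nonneg hp1 (Real.rpow_nonneg (abs_nonneg _) _))) h3).trans h4

lemma hasFDerivAt_flux_integrand {p : ℝ} (hp : 2 < p) (z q : E) :
    HasFDerivAt (fun q : E => (tent z * signedPow p (inner ℝ q z)) • z) (fluxDeriv p q z) q := by
  have h1 : HasFDerivAt (fun x : E => inner ℝ x z) (innerSL ℝ z) q :=
    (innerSL ℝ z).hasFDerivAt.congr_of_eventuallyEq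
      (Filter.Eventually.of_forall fun x => real_inner_comm z x)
  have h2 := ((hasDerivAt_signedPow hp (inner ℝ q z)).comp_hasFDerivAt q h1).const_mul (tent z)
  refine (h2.smul_const z).congr_fderiv ?_
  ext1 v
  simp only [fluxDeriv, ContinuousLinearMap.smulRight_apply, smul_apply, smul_smul, smul_eq_mul,
    mul_assoc]

lemma hasFDerivAt_flux {p : ℝ} (hp : 2 < p) (q : E) :
    HasFDerivAt (flux p) (∫ z : E, fluxDeriv p q z) q := by
  have hflux : flux p = fun q : E => ∫ z : E, (tent z * signedPow p (inner ℝ q z)) • z := rfl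
  rw [hflux]
  refine hasFDerivAt_integral_of_dominated_of_fderiv_le (F' := fluxDeriv p)
    (bound := fun z => tent z * ((p - 1) * (‖q‖ + 1) ^ (p - 2)))
    (Metric.ball_mem_nhds q one_pos) ?_ (integrable_flux_integrand hp q)
    (continuous_fluxDeriv hp q).aestronglyMeasurable ?_ ?_ ?_
  · exact Filter.Eventually.of_forall fun q' =>
      (continuous_flux_integrand hp q').aestronglyMeasurable
  · refine Filter.Eventually.of_forall fun z q' hq' => norm_fluxDeriv_le hp ?_ z
    have := norm_le_norm_add_norm_sub' q' q
    rw [← dist_eq_norm] at this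
    linarith [Metric.mem_ball.1 hq']
  · exact integrable_tent_mul continuous_const
  · exact Filter.Eventually.of_forall fun z q' _ => hasFDerivAt_flux_integrand hp z q'

end Tent

section NonlocalOperator
open Filter Topology
variable {N : ℕ}
local notation "E" => EuclideanSpace ℝ (Fin N)

/-- The rescaled interaction kernel. -/
noncomputable def kern (p κ r : ℝ) (z : E) : ℝ :=
  2 / κ * (r ^ N)⁻¹ * r ^ (-p) * tent (r⁻¹ • z)

/-- The nonlocal approximation of the `p`-Laplacian with interaction range `r`. -/
noncomputable def nonlocal (p κ r : ℝ) (w : E → ℝ) (x : E) : ℝ :=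
  ∫ y, kern p κ r (y - x) * signedPow p (w y - w x)

lemma continuous_kern (p κ r : ℝ) : Continuous (kern p κ r : E → ℝ) :=
  continuous_const.mul (continuous_tent.comp (continuous_const_smul _))

lemma kern_nonneg {p κ r : ℝ} (hκ : 0 < κ) (hr : 0 < r) (z : E) : 0 ≤ kern p κ r z := by
  have := tent_nonneg (r⁻¹ • z)
  unfold kern; positivity

lemma kern_neg (p κ r : ℝ) (z : E) : kern p κ r (-z) = kern p κ r z := by
  rw [kern, smul_neg, tent_neg, kern]

lemma kern_eq_zero {p κ r : ℝ} (hr : 0 < r) {z : E} (hz : r ≤ ‖z‖) : kern p κ r z = 0 := by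
  rw [kern, tent_eq_zero, mul_zero]
  rw [norm_smul, Real.norm_eq_abs, abs_of_pos (inv_pos.2 hr), inv_mul_eq_div, le_div_iff₀ hr]
  linarith

lemma integral_kern_mul {p κ r : ℝ} (hr : 0 < r) (x : E) (g : E → ℝ) :
    ∫ y, kern p κ r (y - x) * g y = 2 / κ * r ^ (-p) * ∫ z, tent z * g (x + r • z) := by
  rw [← integral_add_left_eq_self _ x]
  have h := Measure.integral_comp_smul volume
    (fun y : E => tent (r⁻¹ • y) * g (x + y)) r
  simp only [smul_smul, inv_mul_cancel₀ hr.ne', one_smul, smul_eq_mul] at h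
  rw [h, finrank_euclideanSpace_fin, abs_of_pos (by positivity), ← integral_const_mul,
    ← integral_const_mul]
  congr 1; ext y
  simp only [kern, add_sub_cancel_left]
  ring

lemma nonlocal_eq {p κ r : ℝ} (hp : 2 < p) (hr : 0 < r) {w : E → ℝ} (hw : Continuous w) (x : E) :
    nonlocal p κ r w x = κ⁻¹ * ∫ z, tent z * ((signedPow p ((w (x + r • z) - w x) / r) -
      signedPow p ((w x - w (x - r • z)) / r)) / r) := by
  have hdiv : ∀ s, signedPow p (s / r) / r = r ^ (-p) * signedPow p s := by
    intro s
    rw [signedPow_div hr, div_eq_mul_inv, ← Real.rpow_neg_one r, mul_right_comm,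
      ← Real.rpow_add hr]
    congr 2; ring
  have hc : Continuous fun z : E => signedPow p (w (x + r • z) - w x) :=
    (continuous_signedPow hp).comp (by fun_prop)
  have hc' : Continuous fun z : E => signedPow p (w (x - r • z) - w x) :=
    (continuous_signedPow hp).comp (by fun_prop)
  have hI : ∫ z, tent z * signedPow p (w (x - r • z) - w x) =
      ∫ z, tent z * signedPow p (w (x + r • z) - w x) := by
    rw [← integral_neg_eq_self]
    simp [tent_neg]
  have hS : ∫ z, tent z * ((signedPow p ((w (x + r • z) - w x) / r) -
      signedPow p ((w x - w (x - r • z)) / r)) / r) =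
      ∫ z, r ^ (-p) * (tent z * signedPow p (w (x + r • z) - w x) +
        tent z * signedPow p (w (x - r • z) - w x)) := by
    congr 1; ext z
    have : w x - w (x - r • z) = -(w (x - r • z) - w x) := by ring
    rw [sub_div, hdiv, hdiv, this, signedPow_neg]
    ring
  rw [nonlocal, integral_kern_mul hr, hS, integral_const_mul,
    integral_add (integrable_tent_mul hc) (integrable_tent_mul hc'), hI]
  ring

lemma second_order_taylor {w : E → ℝ} {x₀ : E} (hw : ContDiffAt ℝ 2 w x₀) {ε : ℝ} (hε : 0 < ε) :
    ∃ ρ > 0, ∀ x h : E, x ∈ Metric.ball x₀ ρ → x + h ∈ Metric.ball x₀ ρ →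
      x - h ∈ Metric.ball x₀ ρ →
      |w (x + h) - w x - fderiv ℝ w x₀ h| ≤ ε * ‖h‖ ∧
      |w x - w (x - h) - fderiv ℝ w x₀ h| ≤ ε * ‖h‖ ∧
      |(w (x + h) - w x) - (w x - w (x - h)) - fderiv ℝ (fderiv ℝ w) x₀ h h| ≤ ε * ‖h‖ ^ 2 := by
  have h1 : ContDiffAt ℝ 1 (fderiv ℝ w) x₀ := hw.fderiv_right (by norm_num)
  have h2 : HasStrictFDerivAt (fderiv ℝ w) (fderiv ℝ (fderiv ℝ w) x₀) x₀ :=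
    h1.hasStrictFDerivAt (by norm_num)
  have h3 : HasStrictFDerivAt w (fderiv ℝ w x₀) x₀ := hw.hasStrictFDerivAt (by norm_num)
  have e1 : ∀ᶠ y in 𝓝 x₀, DifferentiableAt ℝ w y := by
    filter_upwards [hw.eventually (by simp)] with y hy
    exact hy.differentiableAt (by norm_num)
  have e2 := h2.isLittleO.def (half_pos hε)
  have e3 := h3.isLittleO.def hε
  rw [nhds_prod_eq] at e2 e3
  obtain ⟨ρ₁, hρ₁, H1⟩ := Metric.eventually_nhds_iff_ball.1 e1
  rw [Metric.nhds_basis_ball.prod_self.eventually_iff] at e2 e3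
  obtain ⟨ρ₂, hρ₂, H2⟩ := e2
  obtain ⟨ρ₃, hρ₃, H3⟩ := e3
  refine ⟨min ρ₁ (min ρ₂ ρ₃), by positivity, ?_⟩
  have b1 : Metric.ball x₀ (min ρ₁ (min ρ₂ ρ₃)) ⊆ Metric.ball x₀ ρ₁ :=
    Metric.ball_subset_ball (min_le_left _ _)
  have b2 : Metric.ball x₀ (min ρ₁ (min ρ₂ ρ₃)) ⊆ Metric.ball x₀ ρ₂ :=
    Metric.ball_subset_ball ((min_le_right _ _).trans (min_le_left _ _))
  have b3 : Metric.ball x₀ (min ρ₁ (min ρ₂ ρ₃)) ⊆ Metric.ball x₀ ρ₃ :=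
    Metric.ball_subset_ball ((min_le_right _ _).trans (min_le_right _ _))
  intro x h hx hxp hxm
  refine ⟨?_, ?_, ?_⟩
  · have := H3 (mk_mem_prod (b3 hxp) (b3 hx))
    simpa using this
  · have := H3 (mk_mem_prod (b3 hx) (b3 hxm))
    simpa using this
  · have seg : ∀ s ∈ Icc (0 : ℝ) 1, x + s • h ∈ Metric.ball x₀ (min ρ₁ (min ρ₂ ρ₃)) ∧
        x - s • h ∈ Metric.ball x₀ (min ρ₁ (min ρ₂ ρ₃)) := by
      intro s hs
      constructor
      · exact (convex_ball _ _).add_smul_mem hx hxp hs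
      · have := (convex_ball _ _).add_smul_mem hx (y := -h) (by rwa [← sub_eq_add_neg]) hs
        rwa [smul_neg, ← sub_eq_add_neg] at this
    have hd : ∀ s ∈ Icc (0 : ℝ) 1, HasDerivWithinAt
        (fun s : ℝ => w (x + s • h) + w (x - s • h) - s ^ 2 * fderiv ℝ (fderiv ℝ w) x₀ h h)
        (fderiv ℝ w (x + s • h) h - fderiv ℝ w (x - s • h) h
          - 2 * s * fderiv ℝ (fderiv ℝ w) x₀ h h) (Icc 0 1) s := by
      intro s hs
      have d1 := (H1 _ (b1 (seg s hs).1)).hasFDerivAt.comp_hasDerivAt s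
        (((hasDerivAt_id s).smul_const h).const_add x)
      have d2 := (H1 _ (b1 (seg s hs).2)).hasFDerivAt.comp_hasDerivAt s
        (((hasDerivAt_id s).smul_const h).const_sub x)
      have d3 := ((hasDerivAt_id s).pow 2).mul_const (fderiv ℝ (fderiv ℝ w) x₀ h h)
      refine ((d1.add d2).sub d3).hasDerivWithinAt.congr_deriv ?_
      simp
      ring
    have bd : ∀ s ∈ Ico (0 : ℝ) 1, ‖fderiv ℝ w (x + s • h) h - fderiv ℝ w (x - s • h) h
          - 2 * s * fderiv ℝ (fderiv ℝ w) x₀ h h‖ ≤ ε * ‖h‖ ^ 2 := by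
      intro s hs
      have hs' : s ∈ Icc (0 : ℝ) 1 := ⟨hs.1, hs.2.le⟩
      have h4 := H2 (mk_mem_prod (b2 (seg s hs').1) (b2 (seg s hs').2))
      have h5 : x + s • h - (x - s • h) = (2 * s) • h := by module
      simp only [h5, norm_smul, Real.norm_eq_abs, abs_of_nonneg (by linarith [hs.1] : 0 ≤ 2 * s)]
        at h4
      have h6 := ContinuousLinearMap.le_of_opNorm_le _ h4 h
      simp only [sub_apply, map_smul, smul_apply, smul_eq_mul] at h6
      refine h6.trans ?_
      have : 2 * s * ‖h‖ ≤ 2 * 1 * ‖h‖ := by gcongr; exact hs.2.le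
      calc ε / 2 * (2 * s * ‖h‖) * ‖h‖ ≤ ε / 2 * (2 * 1 * ‖h‖) * ‖h‖ := by gcongr
        _ = _ := by ring
    have := norm_image_sub_le_of_norm_deriv_le_segment_01' hd bd
    rw [Real.norm_eq_abs] at this
    refine le_trans (le_of_eq ?_) this
    congr 1
    simp
    ring

lemma eventually_difference_quotients {w : E → ℝ} {x₀ : E} (hw : ContDiffAt ℝ 2 w x₀) {ε : ℝ}
    (hε : 0 < ε) :
    ∀ᶠ q : ℝ × E in 𝓝[>] 0 ×ˢ 𝓝 x₀, 0 < q.1 ∧ ∀ z : E, ‖z‖ ≤ 1 →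
      |(w (q.2 + q.1 • z) - w q.2) / q.1 - fderiv ℝ w x₀ z| ≤ ε ∧
      |(w q.2 - w (q.2 - q.1 • z)) / q.1 - fderiv ℝ w x₀ z| ≤ ε ∧
      |((w (q.2 + q.1 • z) - w q.2) / q.1 - (w q.2 - w (q.2 - q.1 • z)) / q.1) / q.1
        - fderiv ℝ (fderiv ℝ w) x₀ z z| ≤ ε := by
  obtain ⟨ρ, hρ, H⟩ := second_order_taylor hw hε
  have hr : ∀ᶠ r : ℝ in 𝓝[>] 0, 0 < r ∧ r < ρ / 2 := by
    filter_upwards [Ioo_mem_nhdsGT (half_pos hρ)] with r hr using hr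
  filter_upwards [hr.prod_mk (Metric.ball_mem_nhds x₀ (half_pos hρ))] with q hq
  obtain ⟨⟨hr0, hrρ⟩, hx⟩ := hq
  refine ⟨hr0, fun z hz => ?_⟩
  have hn : ‖q.1 • z‖ ≤ q.1 := by
    rw [norm_smul, Real.norm_eq_abs, abs_of_pos hr0]
    exact mul_le_of_le_one_right hr0.le hz
  have hx' : dist q.2 x₀ < ρ / 2 := hx
  have m1 : q.2 + q.1 • z ∈ Metric.ball x₀ ρ := by
    rw [Metric.mem_ball]
    have := dist_triangle (q.2 + q.1 • z) q.2 x₀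
    rw [dist_self_add_left] at this
    linarith
  have m2 : q.2 - q.1 • z ∈ Metric.ball x₀ ρ := by
    rw [Metric.mem_ball]
    have := dist_triangle (q.2 - q.1 • z) q.2 x₀
    have e : dist (q.2 - q.1 • z) q.2 = ‖q.1 • z‖ := by simp
    linarith
  obtain ⟨h1, h2, h3⟩ := H q.2 (q.1 • z) (by rw [Metric.mem_ball]; linarith) m1 m2
  have g1 : ∀ a b : ℝ, |a - q.1 * b| ≤ ε * ‖q.1 • z‖ → |a / q.1 - b| ≤ ε := by
    intro a b hab
    have : a / q.1 - b = (a - q.1 * b) / q.1 := by field_simp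
    rw [this, abs_div, abs_of_pos hr0, div_le_iff₀ hr0]
    exact hab.trans (by gcongr)
  simp only [map_smul, smul_eq_mul] at h1 h2 h3
  refine ⟨g1 _ _ h1, g1 _ _ h2, ?_⟩
  have e : ((w (q.2 + q.1 • z) - w q.2) / q.1 - (w q.2 - w (q.2 - q.1 • z)) / q.1) / q.1
        - fderiv ℝ (fderiv ℝ w) x₀ z z
      = ((w (q.2 + q.1 • z) - w q.2) - (w q.2 - w (q.2 - q.1 • z))
        - q.1 * (q.1 * fderiv ℝ (fderiv ℝ w) x₀ z z)) / q.1 ^ 2 := by field_simp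
  rw [e, abs_div, abs_of_pos (by positivity : 0 < q.1 ^ 2), div_le_iff₀ (by positivity)]
  simp only [smul_apply, smul_eq_mul] at h3
  exact h3.trans (by gcongr)

/-- The limit of the nonlocal operators, for a twice differentiable function. -/
lemma tendsto_nonlocal_integral {p κ : ℝ} (hp : 2 < p) {w : E → ℝ} (hw : Continuous w) {x₀ : E}
    (hw2 : ContDiffAt ℝ 2 w x₀) :
    Tendsto (fun q : ℝ × E => nonlocal p κ q.1 w q.2) (𝓝[>] 0 ×ˢ 𝓝 x₀)
      (𝓝 (κ⁻¹ * ∫ z, tent z * ((p - 1) * |fderiv ℝ w x₀ z| ^ (p - 2) *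
        fderiv ℝ (fderiv ℝ w) x₀ z z))) := by
  set G := fderiv ℝ w x₀ with hG
  set X := fderiv ℝ (fderiv ℝ w) x₀ with hX
  have hpos : ∀ᶠ q : ℝ × E in 𝓝[>] 0 ×ˢ 𝓝 x₀, 0 < q.1 :=
    (eventually_difference_quotients hw2 one_pos).mono fun q hq => hq.1
  refine Tendsto.congr' (f₁ := fun q : ℝ × E => κ⁻¹ * ∫ z, tent z *
    ((signedPow p ((w (q.2 + q.1 • z) - w q.2) / q.1) -
      signedPow p ((w q.2 - w (q.2 - q.1 • z)) / q.1)) / q.1)) ?_ ?_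
  · filter_upwards [hpos] with q hq
    rw [nonlocal_eq hp hq hw]
  refine Tendsto.const_mul _ ?_
  refine tendsto_integral_filter_of_dominated_convergence
    (fun z => tent z * ((p - 1) * (‖G‖ + 1) ^ (p - 2) * (‖X‖ + 1))) ?_ ?_
    (integrable_tent_mul continuous_const) ?_
  · refine Eventually.of_forall fun q => Continuous.aestronglyMeasurable ?_
    refine continuous_tent.mul (Continuous.div_const (Continuous.sub ?_ ?_) _)
    · exact (continuous_signedPow hp).comp (by fun_prop)
    · exact (continuous_signedPow hp).comp (by fun_prop)
  · filter_upwards [eventually_difference_quotients hw2 one_pos] with q hq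
    refine Eventually.of_forall fun z => ?_
    rcases eq_or_ne (tent z) 0 with h0 | h0
    · simp [h0]
    have hz := (norm_lt_one_of_tent_ne_zero h0).le
    obtain ⟨h1, h2, h3⟩ := hq.2 z hz
    have hGz : |G z| ≤ ‖G‖ := by simpa using G.le_opNorm_of_le hz
    have hXz : |X z z| ≤ ‖X‖ := by
      have := (X z).le_opNorm_of_le hz
      have h' := X.le_opNorm_of_le hz
      simp only [mul_one, Real.norm_eq_abs] at this h'
      linarith
    have a1 := abs_le.1 h1
    have a2 := abs_le.1 h2
    have a3 := abs_le.1 h3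
    have b1 := abs_le.1 hGz
    have b2 := abs_le.1 hXz
    have hL := abs_signedPow_sub_le hp (M := ‖G‖ + 1)
      (a := (w (q.2 + q.1 • z) - w q.2) / q.1) (b := (w q.2 - w (q.2 - q.1 • z)) / q.1)
      (abs_le.2 ⟨by linarith, by linarith⟩) (abs_le.2 ⟨by linarith, by linarith⟩)
    rw [norm_mul, Real.norm_eq_abs, abs_of_nonneg (tent_nonneg z)]
    refine mul_le_mul_of_nonneg_left ?_ (tent_nonneg z)
    rw [Real.norm_eq_abs, abs_div, abs_of_pos hq.1, div_le_iff₀ hq.1]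
    refine hL.trans ?_
    have hp1 : 0 ≤ p - 1 := by linarith
    have hc : |((w (q.2 + q.1 • z) - w q.2) / q.1 - (w q.2 - w (q.2 - q.1 • z)) / q.1) / q.1|
        ≤ ‖X‖ + 1 := abs_le.2 ⟨by linarith, by linarith⟩
    rw [abs_div, abs_of_pos hq.1, div_le_iff₀ hq.1] at hc
    rw [mul_assoc ((p - 1) * _)]
    gcongr
  · refine Eventually.of_forall fun z => ?_
    rcases eq_or_ne (tent z) 0 with h0 | h0
    · simp [h0]
    have hz := (norm_lt_one_of_tent_ne_zero h0).le
    refine Tendsto.const_mul _ ?_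
    have t1 : Tendsto (fun q : ℝ × E => (w (q.2 + q.1 • z) - w q.2) / q.1) (𝓝[>] 0 ×ˢ 𝓝 x₀)
        (𝓝 (G z)) := by
      refine Metric.tendsto_nhds.2 fun ε hε => ?_
      filter_upwards [eventually_difference_quotients hw2 (half_pos hε)] with q hq
      exact (hq.2 z hz).1.trans_lt (half_lt_self hε)
    have t2 : Tendsto (fun q : ℝ × E => (w q.2 - w (q.2 - q.1 • z)) / q.1) (𝓝[>] 0 ×ˢ 𝓝 x₀)
        (𝓝 (G z)) := by
      refine Metric.tendsto_nhds.2 fun ε hε => ?_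
      filter_upwards [eventually_difference_quotients hw2 (half_pos hε)] with q hq
      exact (hq.2 z hz).2.1.trans_lt (half_lt_self hε)
    have t3 : Tendsto (fun q : ℝ × E => ((w (q.2 + q.1 • z) - w q.2) / q.1 -
        (w q.2 - w (q.2 - q.1 • z)) / q.1) / q.1) (𝓝[>] 0 ×ˢ 𝓝 x₀) (𝓝 (X z z)) := by
      refine Metric.tendsto_nhds.2 fun ε hε => ?_
      filter_upwards [eventually_difference_quotients hw2 (half_pos hε)] with q hq
      exact (hq.2 z hz).2.2.trans_lt (half_lt_self hε)
    have hs := (hasStrictDerivAt_signedPow hp (G z)).isLittleO.comp_tendsto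
      (t1.prodMk_nhds t2)
    have hb : (fun q : ℝ × E => (w (q.2 + q.1 • z) - w q.2) / q.1 -
        (w q.2 - w (q.2 - q.1 • z)) / q.1) =O[𝓝[>] 0 ×ˢ 𝓝 x₀] fun q => q.1 := by
      refine Asymptotics.isBigO_of_div_tendsto_nhds ?_ _ t3
      filter_upwards [hpos] with q hq h
      exact absurd h hq.ne'
    have ho := (hs.trans_isBigO hb).tendsto_div_nhds_zero
    have := ho.add (t3.const_mul ((p - 1) * |G z| ^ (p - 2)))
    rw [zero_add] at this
    refine this.congr' ?_
    filter_upwards [hpos] with q hq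
    simp only [Function.comp, ContinuousLinearMap.toSpanSingleton_apply, smul_eq_mul]
    field_simp
    ring

end NonlocalOperator

section Consistency
open Filter Topology
variable {N : ℕ}
local notation "E" => EuclideanSpace ℝ (Fin N)

lemma pLaplacian_congr {p : ℝ} {v w : E → ℝ} {x : E} (h : v =ᶠ[𝓝 x] w) :
    pLaplacian p v x = pLaplacian p w x := by
  have h1 : (fun y => ‖gradient v y‖ ^ (p - 2) • gradient v y) =ᶠ[𝓝 x]
      fun y => ‖gradient w y‖ ^ (p - 2) • gradient w y := by
    filter_upwards [h.eventuallyEq_nhds] with y hy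
    rw [gradient, gradient, hy.fderiv_eq]
  unfold pLaplacian
  rw [h1.fderiv_eq]

lemma pLaplacian_eq_integral {p κ : ℝ} (hp : 2 < p) (hκ : 0 < κ)
    (hflux : ∀ q : E, flux p q = (κ * ‖q‖ ^ (p - 2)) • q) {w : E → ℝ} {x₀ : E}
    (hw : ContDiffAt ℝ 2 w x₀) :
    pLaplacian p w x₀ = κ⁻¹ * ∫ z, tent z * ((p - 1) * |fderiv ℝ w x₀ z| ^ (p - 2) *
        fderiv ℝ (fderiv ℝ w) x₀ z z) := by
  set X := fderiv ℝ (fderiv ℝ w) x₀ with hX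
  set q := gradient w x₀ with hq
  have hfl : (fun y => ‖gradient w y‖ ^ (p - 2) • gradient w y) =
      fun y => κ⁻¹ • flux p (gradient w y) := by
    ext1 y
    rw [hflux, smul_smul, ← mul_assoc, inv_mul_cancel₀ hκ.ne', one_mul]
  have hd : HasFDerivAt (fderiv ℝ w) X x₀ :=
    ((hw.fderiv_right (m := 1) (by norm_num)).differentiableAt (by norm_num)).hasFDerivAt
  let S : (E →L[ℝ] ℝ) →L[ℝ] E :=
    LinearMap.toContinuousLinearMap
      { toFun := (InnerProductSpace.toDual ℝ E).symm
        map_add' := map_add _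
        map_smul' := fun c l => by simp }
  have hg : HasFDerivAt (gradient w) (S.comp X) x₀ := S.hasFDerivAt.comp x₀ hd
  have hS : ∀ (l : E →L[ℝ] ℝ) z, inner ℝ z (S l) = l z := by
    intro l z
    rw [real_inner_comm]
    exact InnerProductSpace.toDual_symm_apply
  have hqz : ∀ z, inner ℝ q z = fderiv ℝ w x₀ z := fun z => InnerProductSpace.toDual_symm_apply
  have hA : HasFDerivAt (fun y => κ⁻¹ • flux p (gradient w y))
      (κ⁻¹ • ((∫ z, fluxDeriv p q z).comp (S.comp X))) x₀ :=
    (((hasFDerivAt_flux hp q).comp x₀ hg).const_smul κ⁻¹)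
  have hint := integrable_fluxDeriv hp q
  have hproj : ∀ (i : Fin N) (z : E), EuclideanSpace.proj (𝕜 := ℝ) i z = z i := fun _ _ => rfl
  have key : ∀ i : Fin N, EuclideanSpace.proj i
      ((κ⁻¹ • ((∫ z, fluxDeriv p q z).comp (S.comp X))) (EuclideanSpace.single i 1)) =
      κ⁻¹ * ∫ z, tent z * ((p - 1) * |fderiv ℝ w x₀ z| ^ (p - 2)) *
        (X (EuclideanSpace.single i 1) z * z i) := by
    intro i
    have e1 : ((κ⁻¹ • ((∫ z, fluxDeriv p q z).comp (S.comp X))) (EuclideanSpace.single i 1)) =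
        κ⁻¹ • ∫ z, fluxDeriv p q z (S (X (EuclideanSpace.single i 1))) := by
      rw [← ContinuousLinearMap.integral_apply hint]
      rfl
    rw [e1, map_smul, smul_eq_mul,
      ← ContinuousLinearMap.integral_comp_comm _ (hint.apply_continuousLinearMap _)]
    congr 2; ext z
    simp only [fluxDeriv, smul_apply, ContinuousLinearMap.smulRight_apply, innerSL_apply_apply,
      hS, hqz, hproj, PiLp.smul_apply, smul_eq_mul]
  have hi : ∀ i : Fin N, Integrable fun z => tent z * ((p - 1) * |fderiv ℝ w x₀ z| ^ (p - 2)) *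
        (X (EuclideanSpace.single i 1) z * z i) := by
    intro i
    have hc : Continuous fun z : E => |fderiv ℝ w x₀ z| ^ (p - 2) :=
      (continuous_abs_rpow_sub_two hp).comp (fderiv ℝ w x₀).continuous
    have : Continuous fun z : E => ((p - 1) * |fderiv ℝ w x₀ z| ^ (p - 2)) *
        (X (EuclideanSpace.single i 1) z * z i) := by fun_prop
    simpa only [mul_assoc] using integrable_tent_mul this
  unfold pLaplacian
  rw [hfl, hA.fderiv]
  simp only [key]
  rw [← Finset.mul_sum, ← integral_finsetSum _ fun i _ => hi i]
  congr 2; ext z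
  rw [← Finset.mul_sum]
  have hz : ∑ i, X (EuclideanSpace.single i 1) z * z i = X z z := by
    conv_rhs => rw [show X z = X (∑ i, z i • EuclideanSpace.single i (1:ℝ)) by
      congr 1
      simpa using ((EuclideanSpace.basisFun (Fin N) ℝ).sum_repr z).symm]
    simp only [map_sum, map_smul, sum_apply, smul_apply, smul_eq_mul, mul_comm]
  rw [hz]; ring

/-- Consistency: the nonlocal operators converge to the `p`-Laplacian. -/
lemma tendsto_nonlocal {p κ : ℝ} (hp : 2 < p) (hκ : 0 < κ)
    (hflux : ∀ q : E, flux p q = (κ * ‖q‖ ^ (p - 2)) • q) {w : E → ℝ} (hw : Continuous w) {x₀ : E}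
    (hw2 : ContDiffAt ℝ 2 w x₀) :
    Tendsto (fun q : ℝ × E => nonlocal p κ q.1 w q.2) (𝓝[>] 0 ×ˢ 𝓝 x₀)
      (𝓝 (pLaplacian p w x₀)) := by
  rw [pLaplacian_eq_integral hp hκ hflux hw2]
  exact tendsto_nonlocal_integral hp hw hw2

end Consistency

section ConcavityMethod

/-- The concavity argument: a lower bound on the derivative of `y` by its energy `J` together with
the Cauchy-Schwarz inequality bounds the length of the interval of existence. -/
lemma time_le_of_concavity {p j T : ℝ} {y y' J J' : ℝ → ℝ} (hp : 2 < p) (hj : 0 < j) (hT : 0 < T)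
    (hy : ∀ t ∈ Icc 0 T, HasDerivAt y (y' t) t) (hJ : ∀ t ∈ Icc 0 T, HasDerivAt J (J' t) t)
    (hy0 : ∀ t ∈ Icc 0 T, 0 ≤ y t) (hJ' : ∀ t ∈ Icc 0 T, 0 ≤ J' t)
    (h1 : ∀ t ∈ Icc 0 T, 2 * p * J t ≤ y' t) (h2 : ∀ t ∈ Icc 0 T, y' t ^ 2 ≤ 4 * (y t * J' t))
    (hj0 : j ≤ J 0) : p * (p - 2) * j * T ≤ y 0 := by
  have m0 : (0 : ℝ) ∈ Icc 0 T := ⟨le_rfl, hT.le⟩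
  have mT : T ∈ Icc 0 T := ⟨hT.le, le_rfl⟩
  have hmono : ∀ {h h' : ℝ → ℝ}, (∀ t ∈ Icc 0 T, HasDerivAt h (h' t) t) →
      (∀ t ∈ Icc 0 T, 0 ≤ h' t) → MonotoneOn h (Icc 0 T) := by
    intro h h' hd hn
    refine monotoneOn_of_hasDerivWithinAt_nonneg (convex_Icc 0 T)
      (fun t ht => (hd t ht).continuousAt.continuousWithinAt)
      (fun t ht => (hd t (interior_subset ht)).hasDerivWithinAt)
      fun t ht => hn t (interior_subset ht)
  have hJj : ∀ t ∈ Icc 0 T, j ≤ J t := fun t ht =>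
    hj0.trans (hmono hJ hJ' m0 ht ht.1)
  have hy'pos : ∀ t ∈ Icc 0 T, 0 < y' t := fun t ht => by
    have := hJj t ht
    exact lt_of_lt_of_le (by positivity) ((mul_le_mul_of_nonneg_left this
      (by positivity : (0:ℝ) ≤ 2 * p)).trans (h1 t ht))
  have hypos : ∀ t ∈ Icc 0 T, 0 < y t := fun t ht => by
    refine lt_of_le_of_ne (hy0 t ht) fun h => ?_
    have := h2 t ht
    rw [← h] at this
    nlinarith [hy'pos t ht]
  have hQ : MonotoneOn (fun t => J t * y t ^ (-(p / 2))) (Icc 0 T) := by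
    refine hmono (fun t ht => (hJ t ht).mul ((hy t ht).rpow_const (Or.inl (hypos t ht).ne')))
      fun t ht => ?_
    have hyt := hypos t ht
    have e : y t ^ (-(p / 2)) = y t ^ (-(p / 2) - 1) * y t := by
      rw [← Real.rpow_add_one hyt.ne']; congr 1; ring
    have hz : 0 ≤ y t ^ (-(p / 2) - 1) := by positivity
    have : 0 ≤ J' t * y t - p / 2 * (J t * y' t) := by
      nlinarith [h2 t ht, mul_le_mul_of_nonneg_left (h1 t ht) (hy'pos t ht).le]
    rw [e]
    calc 0 ≤ y t ^ (-(p / 2) - 1) * (J' t * y t - p / 2 * (J t * y' t)) := mul_nonneg hz this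
      _ = _ := by ring
  have hy00 := hypos 0 m0
  set d := p * (p - 2) * j * y 0 ^ (-(p / 2)) with hd
  have hR : MonotoneOn (fun t => -(y t ^ (1 - p / 2)) - d * t) (Icc 0 T) := by
    refine hmono (fun t ht => ((hy t ht).rpow_const (p := 1 - p / 2)
      (Or.inl (hypos t ht).ne')).neg.sub ((hasDerivAt_id t).const_mul d)) fun t ht => ?_
    have hyt := hypos t ht
    have hq := hQ m0 ht ht.1
    have e : y t ^ (1 - p / 2 - 1) = y t ^ (-(p / 2)) := by congr 1; ring
    have hz : 0 < y t ^ (-(p / 2)) := by positivity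
    have hz0 : 0 < y 0 ^ (-(p / 2)) := by positivity
    have a1 : j * y 0 ^ (-(p / 2)) ≤ J t * y t ^ (-(p / 2)) :=
      (mul_le_mul_of_nonneg_right hj0 hz0.le).trans hq
    have a2 : 2 * p * (J t * y t ^ (-(p / 2))) ≤ y' t * y t ^ (-(p / 2)) := by
      rw [← mul_assoc]; exact mul_le_mul_of_nonneg_right (h1 t ht) hz.le
    have a3 : 2 * p * (j * y 0 ^ (-(p / 2))) ≤ y' t * y t ^ (-(p / 2)) :=
      (mul_le_mul_of_nonneg_left a1 (by positivity)).trans a2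
    have a4 := mul_le_mul_of_nonneg_left a3 (by linarith : 0 ≤ p / 2 - 1)
    rw [e, hd]
    linarith
  have hfin := hR m0 mT hT.le
  simp only [mul_zero, sub_zero] at hfin
  have hTpos : 0 ≤ y T ^ (1 - p / 2) := (Real.rpow_pos_of_pos (hypos T mT) _).le
  have e0 : y 0 ^ (1 - p / 2) = y 0 ^ (-(p / 2)) * y 0 := by
    rw [← Real.rpow_add_one hy00.ne']; congr 1; ring
  have hz0 : 0 < y 0 ^ (-(p / 2)) := by positivity
  have : y 0 ^ (-(p / 2)) * (p * (p - 2) * j * T) ≤ y 0 ^ (-(p / 2)) * y 0 := by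
    rw [← e0]; rw [hd] at hfin; linarith
  exact le_of_mul_le_mul_left this hz0

end ConcavityMethod

section Evolution
open Filter Topology

lemma zero_le_deriv_of_forall_le {h : ℝ → ℝ} {d t : ℝ} (hd : HasDerivAt h d t) (ht : 0 < t)
    (hmax : ∀ s ∈ Icc 0 t, h s ≤ h t) : 0 ≤ d := by
  have hw : HasDerivWithinAt h d (Iio t) t := hd.hasDerivWithinAt
  rw [hasDerivWithinAt_iff_tendsto_slope' (by simp)] at hw
  refine ge_of_tendsto hw ?_
  filter_upwards [Ioo_mem_nhdsLT ht] with s hs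
  rw [slope_def_field]
  exact div_nonneg_of_nonpos (by linarith [hmax s ⟨hs.1.le, hs.2.le⟩]) (by linarith [hs.2])

variable {X : Type*} [MetricSpace X] [CompactSpace X]

/-- A maximum principle for differentiable curves of continuous functions. -/
lemma le_add_mul_of_forall_max {V V' : ℝ → C(X, ℝ)} {β : X → ℝ} {K T : ℝ}
    (hβ : Continuous β)
    (hV : ∀ t ∈ Icc 0 T, HasDerivAt V (V' t) t) (h0 : ∀ x, V 0 x ≤ β x)
    (H : ∀ t ∈ Ioc 0 T, ∀ x, β x + K * t < V t x → (∀ y, V t y - β y ≤ V t x - β x) →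
      V' t x < K) :
    ∀ t ∈ Icc 0 T, ∀ x, V t x ≤ β x + K * t := by
  by_contra! hcon
  obtain ⟨t₁, ht₁, x₁, hx₁⟩ := hcon
  have hVc : ContinuousOn V (Icc 0 T) := fun t ht => (hV t ht).continuousAt.continuousWithinAt
  have hc : ContinuousOn (fun q : ℝ × X => V q.1 q.2 - β q.2 - K * q.1) (Icc 0 T ×ˢ univ) := by
    have h1 : ContinuousOn (fun q : ℝ × X => V q.1 q.2) (Icc 0 T ×ˢ univ) := by
      have := (hVc.comp continuousOn_fst (s := Icc 0 T ×ˢ (univ : Set X))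
        fun q hq => hq.1)
      exact continuous_eval.comp_continuousOn (this.prodMk continuousOn_snd)
    exact (h1.sub (hβ.comp continuous_snd).continuousOn).sub (by fun_prop)
  obtain ⟨⟨t, x⟩, ⟨ht, -⟩, hm⟩ := (isCompact_Icc.prod isCompact_univ).exists_isMaxOn
    ⟨(t₁, x₁), ht₁, mem_univ _⟩ hc
  have hm' : ∀ s ∈ Icc 0 T, ∀ y, V s y - β y - K * s ≤ V t x - β x - K * t :=
    fun s hs y => hm (show (s, y) ∈ Icc 0 T ×ˢ univ from ⟨hs, mem_univ y⟩)
  have hpos : β x + K * t < V t x := by linarith [hm' t₁ ht₁ x₁]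
  simp only at ht
  have ht0 : 0 < t := by
    refine lt_of_le_of_ne ht.1 fun h => ?_
    rw [← h] at hpos
    linarith [h0 x]
  have hlt := H t ⟨ht0, ht.2⟩ x hpos fun y => by linarith [hm' t ht y]
  have hev : HasDerivAt (fun s => V s x - β x - K * s) (V' t x - K * 1) t :=
    ((((ContinuousMap.evalCLM ℝ x).hasFDerivAt).comp_hasDerivAt t (hV t ht)).sub_const _).sub
      ((hasDerivAt_id t).const_mul K)
  have := zero_le_deriv_of_forall_le hev ht0 fun s hs => hm' s ⟨hs.1, hs.2.trans ht.2⟩ x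
  linarith

variable [MeasurableSpace X] [BorelSpace X] (μ : Measure X) [IsFiniteMeasure μ]

/-- The nonlocal `p`-Laplacian with continuous kernel `k`, on continuous functions. -/
noncomputable def nonlocalMap {p : ℝ} (hp : 2 < p) (k : C(X × X, ℝ)) (w : C(X, ℝ)) : C(X, ℝ) where
  toFun x := ∫ y, k (x, y) * signedPow p (w y - w x) ∂μ
  continuous_toFun := by
    have : Continuous (Function.uncurry fun x y : X => k (x, y) * signedPow p (w y - w x)) :=
      k.continuous.mul ((continuous_signedPow hp).comp (by fun_prop))
    simpa using! continuous_parametric_integral_of_continuous (μ := μ) this isCompact_univ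

variable {μ} {p : ℝ} (hp : 2 < p) {k : C(X × X, ℝ)}

lemma norm_nonlocalMap_sub_le {c : ℝ} {v w : C(X, ℝ)} (hv : ‖v‖ ≤ c) (hw : ‖w‖ ≤ c) :
    ‖nonlocalMap μ hp k v - nonlocalMap μ hp k w‖ ≤
      ‖k‖ * ((p - 1) * (2 * c) ^ (p - 2) * 2) * μ.real univ * ‖v - w‖ := by
  have hc : 0 ≤ c := (norm_nonneg _).trans hv
  have hp1 : 0 ≤ p - 1 := by linarith
  refine (ContinuousMap.norm_le _ (by positivity)).2 fun x => ?_
  have hint : ∀ u : C(X, ℝ), Integrable (fun y => k (x, y) * signedPow p (u y - u x)) μ := fun u =>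
    Continuous.integrable_of_hasCompactSupport
      ((k.continuous.comp (by fun_prop)).mul ((continuous_signedPow hp).comp (by fun_prop)))
      (HasCompactSupport.of_compactSpace _)
  have e : (nonlocalMap μ hp k v - nonlocalMap μ hp k w) x =
      ∫ y, (k (x, y) * signedPow p (v y - v x) - k (x, y) * signedPow p (w y - w x)) ∂μ :=
    (integral_sub (hint v) (hint w)).symm
  have hb : ∀ u : C(X, ℝ), ‖u‖ ≤ c → ∀ y, |u y - u x| ≤ 2 * c := fun u hu y => by
    have h1 := (u.norm_coe_le_norm y).trans hu
    have h2 := (u.norm_coe_le_norm x).trans hu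
    rw [Real.norm_eq_abs] at h1 h2
    exact (abs_sub _ _).trans (by linarith)
  rw [e]
  refine (norm_integral_le_of_norm_le_const (C := ‖k‖ * ((p - 1) * (2 * c) ^ (p - 2) * 2) *
    ‖v - w‖) (ae_of_all _ fun y => ?_)).trans (le_of_eq (by ring))
  rw [← mul_sub, norm_mul, mul_assoc]
  refine mul_le_mul (k.norm_coe_le_norm _) ?_ (norm_nonneg _) (norm_nonneg _)
  refine (abs_signedPow_sub_le hp (hb v hv y) (hb w hw y)).trans ?_
  rw [mul_assoc _ (2 : ℝ)]
  gcongr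
  have h1 := (v - w).norm_coe_le_norm y
  have h2 := (v - w).norm_coe_le_norm x
  simp only [ContinuousMap.sub_apply, Real.norm_eq_abs] at h1 h2
  calc |v y - v x - (w y - w x)| = |(v y - w y) - (v x - w x)| := by congr 1; ring
    _ ≤ _ := (abs_sub _ _).trans (by linarith)

end Evolution

section Existence
open Filter Topology NNReal
variable {X : Type*} [MetricSpace X] [CompactSpace X]

/-- Pointwise truncation of a continuous function to `[-c, c]`. -/
noncomputable def truncate (c : ℝ) (w : C(X, ℝ)) : C(X, ℝ) where
  toFun x := max (-c) (min c (w x))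
  continuous_toFun := by fun_prop

lemma norm_truncate_le {c : ℝ} (hc : 0 ≤ c) (w : C(X, ℝ)) : ‖truncate c w‖ ≤ c :=
  (ContinuousMap.norm_le _ hc).2 fun x =>
    abs_le.2 ⟨le_max_left _ _, max_le (by linarith) (min_le_left _ _)⟩

lemma norm_truncate_sub_le (c : ℝ) (v w : C(X, ℝ)) :
    ‖truncate c v - truncate c w‖ ≤ ‖v - w‖ := by
  refine (ContinuousMap.norm_le _ (norm_nonneg _)).2 fun x => ?_
  refine le_trans ?_ ((v - w).norm_coe_le_norm x)
  simp only [truncate, ContinuousMap.sub_apply, ContinuousMap.coe_mk, Real.norm_eq_abs]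
  exact (abs_max_sub_max_le_max _ _ _ _).trans (max_le (by simp)
    ((abs_min_sub_min_le_max _ _ _ _).trans (max_le (by simp) le_rfl)))

lemma truncate_mono {Y : Type*} [MetricSpace Y] {c : ℝ} {v : C(Y, ℝ)} {x y : Y} (h : v x ≤ v y) :
    truncate c v x ≤ truncate c v y :=
  max_le_max le_rfl (min_le_min le_rfl h)

lemma truncate_eq_self {Y : Type*} [MetricSpace Y] {c : ℝ} {v : C(Y, ℝ)} (h0 : ∀ x, 0 ≤ v x) (h : ∀ x, v x ≤ c) :
    truncate c v = v := by
  ext x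
  have := (h0 x).trans (h x)
  simp only [truncate, ContinuousMap.coe_mk]
  rw [min_eq_right (h x), max_eq_right (by linarith [h0 x])]

variable [MeasurableSpace X] [BorelSpace X] {μ : Measure X} [IsFiniteMeasure μ]
variable {p : ℝ} (hp : 2 < p) {k : C(X × X, ℝ)}

lemma nonlocalMap_nonpos (hk : ∀ q, 0 ≤ k q) {w : C(X, ℝ)} {x : X} (hx : ∀ y, w y ≤ w x) :
    nonlocalMap μ hp k w x ≤ 0 := by
  refine integral_nonpos fun y => mul_nonpos_of_nonneg_of_nonpos (hk _) ?_
  rw [← signedPow_zero p]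
  exact monotone_signedPow hp (by linarith [hx y])

lemma nonlocalMap_nonneg (hk : ∀ q, 0 ≤ k q) {w : C(X, ℝ)} {x : X} (hx : ∀ y, w x ≤ w y) :
    0 ≤ nonlocalMap μ hp k w x := by
  refine integral_nonneg fun y => mul_nonneg (hk _) ?_
  rw [← signedPow_zero p]
  exact monotone_signedPow hp (by linarith [hx y])

lemma nonlocalMap_zero : nonlocalMap μ hp k 0 = 0 := by
  ext x; simp [nonlocalMap, signedPow_zero]

/-- Global existence and a priori bounds for the nonlocal evolution with damping `χ` and
source `g`. -/
lemma exists_nonlocal_evolution (hk : ∀ q, 0 ≤ k q) {χ : C(X, ℝ)} (hχ : ∀ x, 0 ≤ χ x)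
    {g : ℝ → C(X, ℝ)} (hg : Continuous g) (hg0 : ∀ t x, 0 ≤ g t x) {G : ℝ} (hG : ∀ t x, g t x ≤ G)
    (hG0 : 0 ≤ G)
    {v₀ : C(X, ℝ)} (hv₀ : ∀ x, 0 ≤ v₀ x) {c₀ : ℝ} (hc₀ : 0 ≤ c₀) (hv₀c : ∀ x, v₀ x ≤ c₀)
    {T : ℝ} (hT : 0 < T) :
    ∃ v : ℝ → C(X, ℝ), v 0 = v₀ ∧
      (∀ t ∈ Icc 0 T, HasDerivAt v (nonlocalMap μ hp k (v t) - χ * v t + g t) t) ∧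
      (∀ t ∈ Icc 0 T, ∀ x, 0 ≤ v t x) ∧ ∀ t ∈ Icc 0 T, ∀ x, v t x ≤ c₀ + (G + 1) * T := by
  set c := c₀ + (G + 1) * T with hc
  have hc0 : 0 ≤ c := by positivity
  let Φ : ℝ → C(X, ℝ) → C(X, ℝ) := fun t w =>
    nonlocalMap μ hp k (truncate c w) - χ * truncate c w + g t
  have hp1 : 0 ≤ p - 1 := by linarith
  set A : ℝ := ‖k‖ * ((p - 1) * (2 * c) ^ (p - 2) * 2) * μ.real univ with hA
  have hA0 : 0 ≤ A := by positivity
  have hgn : ∀ t, ‖g t‖ ≤ G := fun t => (ContinuousMap.norm_le _ hG0).2 fun x => by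
    rw [Real.norm_eq_abs, abs_of_nonneg (hg0 t x)]; exact hG t x
  have hlip : ∀ t, LipschitzWith (A + ‖χ‖).toNNReal (Φ t) := by
    intro t
    refine LipschitzWith.of_dist_le_mul fun v w => ?_
    rw [dist_eq_norm, dist_eq_norm, Real.coe_toNNReal _ (by positivity)]
    have e : Φ t v - Φ t w = (nonlocalMap μ hp k (truncate c v) - nonlocalMap μ hp k (truncate c w))
        - χ * (truncate c v - truncate c w) := by simp only [Φ]; ring
    rw [e, add_mul]
    have h3 := norm_truncate_sub_le c v w
    refine (norm_sub_le _ _).trans (add_le_add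
      ((norm_nonlocalMap_sub_le hp (norm_truncate_le hc0 v) (norm_truncate_le hc0 w)).trans ?_)
      ((norm_mul_le _ _).trans (by gcongr)))
    exact mul_le_mul_of_nonneg_left h3 hA0
  set L : ℝ := (A + ‖χ‖) * c + G with hL
  have hL0 : 0 ≤ L := by positivity
  have hbd : ∀ t w, ‖Φ t w‖ ≤ L := by
    intro t w
    have h1 := norm_nonlocalMap_sub_le (μ := μ) (k := k) hp (norm_truncate_le hc0 w)
      (w := 0) (by simpa using hc0)
    rw [nonlocalMap_zero, sub_zero, sub_zero] at h1
    have h2 := norm_truncate_le hc0 w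
    calc ‖Φ t w‖ ≤ ‖nonlocalMap μ hp k (truncate c w)‖ + ‖χ‖ * ‖truncate c w‖ + ‖g t‖ :=
          (norm_add_le _ _).trans (add_le_add ((norm_sub_le _ _).trans
            (add_le_add le_rfl (norm_mul_le _ _))) le_rfl)
      _ ≤ A * c + ‖χ‖ * c + G := by
          refine add_le_add (add_le_add (h1.trans ?_) (by gcongr)) (hgn t)
          exact mul_le_mul_of_nonneg_left h2 hA0
      _ = L := by rw [hL]; ring
  have hPL : IsPicardLindelof Φ (tmin := -1) (tmax := T + 1)
      ⟨0, by norm_num, by linarith⟩ v₀ (L * (T + 1)).toNNReal 0 L.toNNReal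
      (A + ‖χ‖).toNNReal := by
    refine ⟨fun t _ => (hlip t).lipschitzOnWith, fun w _ => ?_, fun t _ w _ => ?_, ?_⟩
    · exact (continuous_const.add hg).continuousOn
    · rw [Real.coe_toNNReal _ hL0]; exact hbd t w
    · rw [Real.coe_toNNReal _ hL0, Real.coe_toNNReal _ (by positivity)]
      simp only [sub_zero, zero_sub, neg_neg, NNReal.coe_zero]
      rw [max_eq_left (by linarith)]
  obtain ⟨v, hv0, hv⟩ := hPL.exists_eq_forall_mem_Icc_hasDerivWithinAt₀
  simp only at hv0
  have hd : ∀ t ∈ Icc 0 T, HasDerivAt v (Φ t (v t)) t := fun t ht =>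
    (hv t ⟨by linarith [ht.1], by linarith [ht.2]⟩).hasDerivAt
      (Icc_mem_nhds (by linarith [ht.1]) (by linarith [ht.2]))
  have hlow : ∀ t ∈ Icc 0 T, ∀ x, 0 ≤ v t x := by
    intro t ht x
    have key : ∀ ε > 0, -(v t x) ≤ ε := by
      intro ε hε
      have := le_add_mul_of_forall_max (V := fun t => -v t) (V' := fun t => -Φ t (v t))
        (β := fun _ => 0) (K := ε / T) (T := T) continuous_const (fun t ht => (hd t ht).neg)
        (fun x => by simpa [hv0] using hv₀ x) ?_ t ht x
      · simp only [ContinuousMap.neg_apply, zero_add] at this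
        refine this.trans ?_
        rw [div_mul_eq_mul_div, div_le_iff₀ hT]
        exact mul_le_mul_of_nonneg_left ht.2 hε.le
      · intro s hs y hpos hmax
        have hs0 : 0 < s := hs.1
        have hneg : v s y ≤ 0 := by
          have : 0 ≤ ε / T * s := by positivity
          simp only [ContinuousMap.neg_apply, zero_add] at hpos
          linarith
        have hmin : ∀ z, v s y ≤ v s z := fun z => by
          have := hmax z
          simp only [ContinuousMap.neg_apply] at this
          linarith
        have h1 : 0 ≤ nonlocalMap μ hp k (truncate c (v s)) y :=
          nonlocalMap_nonneg hp hk fun z => truncate_mono (hmin z)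
        have h2 : truncate c (v s) y ≤ 0 :=
          max_le (by linarith) ((min_le_right _ _).trans hneg)
        have h3 : χ y * truncate c (v s) y ≤ 0 := mul_nonpos_of_nonneg_of_nonpos (hχ y) h2
        have h4 := hg0 s y
        have h5 : 0 < ε / T := by positivity
        simp only [Φ, ContinuousMap.neg_apply, ContinuousMap.add_apply, ContinuousMap.sub_apply,
          ContinuousMap.mul_apply]
        linarith
    have := le_of_forall_pos_le_add (a := -(v t x)) (b := 0) fun ε hε => by
      simpa using key ε hε
    linarith
  have hup : ∀ t ∈ Icc 0 T, ∀ x, v t x ≤ c := by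
    intro t ht x
    have := le_add_mul_of_forall_max (V := v) (V' := fun t => Φ t (v t))
        (β := fun _ => c₀) (K := G + 1) (T := T) continuous_const hd
        (fun x => by simpa [hv0] using hv₀c x) ?_ t ht x
    · exact this.trans (by rw [hc]; gcongr; exact ht.2)
    · intro s hs y _ hmax
      have h1 : nonlocalMap μ hp k (truncate c (v s)) y ≤ 0 :=
        nonlocalMap_nonpos hp hk fun z => truncate_mono (by linarith [hmax z])
      have h2 : 0 ≤ truncate c (v s) y :=
        (le_min hc0 (hlow s ⟨hs.1.le, hs.2⟩ y)).trans (le_max_right _ _)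
      have h3 := mul_nonneg (hχ y) h2
      have h4 := hG s y
      simp only [Φ, ContinuousMap.add_apply, ContinuousMap.sub_apply, ContinuousMap.mul_apply]
      linarith
  refine ⟨v, hv0, fun t ht => ?_, hlow, hup⟩
  have := hd t ht
  simp only [Φ] at this
  rwa [truncate_eq_self (hlow t ht) (hup t ht)] at this

end Existence

section Energy
open Filter Topology

lemma Continuous.integrable_of_compactSpace {Z : Type*} [TopologicalSpace Z] [CompactSpace Z]
    [MeasurableSpace Z] [OpensMeasurableSpace Z] {ν : Measure Z}
    [IsFiniteMeasure ν] {h : Z → ℝ} (hh : Continuous h) : Integrable h ν :=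
  hh.integrable_of_hasCompactSupport (HasCompactSupport.of_compactSpace _)

/-- Differentiation of a weighted integral of a function of a differentiable curve. -/
lemma hasDerivAt_integral_mul_comp {Z : Type*} [TopologicalSpace Z] [CompactSpace Z]
    [MeasurableSpace Z] [OpensMeasurableSpace Z] {ν : Measure Z} [IsFiniteMeasure ν]
    {H h : ℝ → ℝ} (hH : ∀ s, HasDerivAt H (h s) s) (hh : Continuous h) {m : Z → ℝ}
    (hm : Continuous m) {W : ℝ → Z → ℝ} {W' : Z → ℝ} {t C : ℝ} (hC : 0 ≤ C)
    (hWc : ∀ s, Continuous (W s)) (hW'c : Continuous W')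
    (hW : ∀ z, HasDerivAt (fun s => W s z) (W' z) t)
    (hlip : ∀ᶠ s in 𝓝 t, ∀ z, |W s z - W t z| ≤ C * |s - t|) :
    HasDerivAt (fun s => ∫ z, m z * H (W s z) ∂ν) (∫ z, m z * (h (W t z) * W' z) ∂ν) t := by
  have hHc : Continuous H := continuous_iff_continuousAt.2 fun s => (hH s).continuousAt
  obtain ⟨R, hR⟩ := (isCompact_range (hWc t)).isBounded.exists_norm_le
  obtain ⟨A, hA⟩ := (isCompact_Icc (a := -(R + C)) (b := R + C)).exists_bound_of_continuousOn
    hh.continuousOn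
  obtain ⟨M, hM⟩ := (isCompact_range hm).isBounded.exists_norm_le
  have hM' : ∀ z, |m z| ≤ M := fun z => hM _ (mem_range_self z)
  have key := hasFDerivAt_integral_of_dominated_loc_of_lip' (𝕜 := ℝ) (μ := ν)
    (F := fun s z => m z * H (W s z))
    (F' := fun z => ContinuousLinearMap.toSpanSingleton ℝ (m z * (h (W t z) * W' z)))
    (x₀ := t) (bound := fun _ => M * (A * C))
    (hlip.and (Metric.ball_mem_nhds t one_pos))
    (fun s _ => (hm.mul (hHc.comp (hWc s))).aestronglyMeasurable)
    (hm.mul (hHc.comp (hWc t))).integrable_of_compactSpace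
    ?_ (ae_of_all _ fun z s hs => ?_) (integrable_const _)
    (ae_of_all _ fun z => ?_)
  · have h2 := key.2.hasDerivAt
    have hint : Integrable (fun z => m z * (h (W t z) * W' z)) ν :=
      (hm.mul ((hh.comp (hWc t)).mul hW'c)).integrable_of_compactSpace
    rw [ContinuousLinearMap.integral_apply key.1] at h2
    simpa using h2
  · exact ((ContinuousLinearMap.toSpanSingletonCLE (𝕜 := ℝ) (E := ℝ)).continuous.comp
      (hm.mul ((hh.comp (hWc t)).mul hW'c))).aestronglyMeasurable
  · obtain ⟨hs1, hs2⟩ := hs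
    have hs2' : |s - t| ≤ 1 := (le_of_lt (by simpa [dist_eq_norm] using hs2))
    have b0 : |W t z| ≤ R := hR _ (mem_range_self z)
    have hst := hs1 z
    have b1 : |W s z - W t z| ≤ C := hst.trans (mul_le_of_le_one_right hC hs2')
    have m0 : W t z ∈ Icc (-(R + C)) (R + C) := by
      rw [abs_le] at b0; exact ⟨by linarith, by linarith⟩
    have m1 : W s z ∈ Icc (-(R + C)) (R + C) := by
      rw [abs_le] at b0 b1; exact ⟨by linarith, by linarith⟩
    have hd := Convex.norm_image_sub_le_of_norm_hasDerivWithin_le (f := H) (f' := h)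
      (fun x _ => (hH x).hasDerivWithinAt) hA (convex_Icc _ _) m0 m1
    have hA0 : 0 ≤ A := (norm_nonneg _).trans (hA _ m0)
    rw [← mul_sub, norm_mul, Real.norm_eq_abs, mul_assoc]
    refine mul_le_mul (hM' z) (hd.trans ?_) (norm_nonneg _) ((abs_nonneg _).trans (hM' z))
    rw [mul_assoc]
    exact mul_le_mul_of_nonneg_left hst hA0
  · exact (((hH _).comp t (hW z)).const_mul (m z)).hasFDerivAt.congr_fderiv (by ext; simp)

variable {X : Type*} [MetricSpace X] [CompactSpace X]

lemma ContinuousMap.hasDerivAt_apply {v : ℝ → C(X, ℝ)} {v' : C(X, ℝ)} {t : ℝ}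
    (hv : HasDerivAt v v' t) (x : X) : HasDerivAt (fun s => v s x) (v' x) t :=
  ((ContinuousMap.evalCLM ℝ x : C(X, ℝ) →L[ℝ] ℝ).hasFDerivAt (x := v t)).comp_hasDerivAt t hv

lemma ContinuousMap.exists_lipschitz_of_hasDerivAt {v : ℝ → C(X, ℝ)} {v' : C(X, ℝ)} {t : ℝ}
    (hv : HasDerivAt v v' t) :
    ∃ C, 0 ≤ C ∧ ∀ᶠ s in 𝓝 t, ∀ x, |v s x - v t x| ≤ C * |s - t| := by
  obtain ⟨C, hC, h⟩ := hv.isBigO_sub.exists_nonneg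
  refine ⟨C, hC, h.bound.mono fun s hs x => ?_⟩
  exact ((v s - v t).norm_coe_le_norm x).trans hs

variable [MeasurableSpace X] [BorelSpace X] {μ : Measure X} [IsFiniteMeasure μ]

lemma hasDerivAt_integral_comp_curve {H h : ℝ → ℝ} (hH : ∀ s, HasDerivAt H (h s) s)
    (hh : Continuous h) (m : C(X, ℝ)) {v : ℝ → C(X, ℝ)} {v' : C(X, ℝ)} {t : ℝ}
    (hv : HasDerivAt v v' t) :
    HasDerivAt (fun s => ∫ x, m x * H (v s x) ∂μ) (∫ x, m x * (h (v t x) * v' x) ∂μ) t := by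
  obtain ⟨C, hC, hlip⟩ := ContinuousMap.exists_lipschitz_of_hasDerivAt hv
  exact hasDerivAt_integral_mul_comp hH hh m.continuous hC (fun s => (v s).continuous)
    v'.continuous (ContinuousMap.hasDerivAt_apply hv) hlip

variable {p : ℝ} (hp : 2 < p) {k : C(X × X, ℝ)}

lemma hasDerivAt_interaction_energy (hp : 2 < p) {v : ℝ → C(X, ℝ)} {v' : C(X, ℝ)} {t : ℝ}
    (hv : HasDerivAt v v' t) :
    HasDerivAt (fun s => ∫ q : X × X, k q * |v s q.1 - v s q.2| ^ p ∂(μ.prod μ))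
      (∫ q : X × X, k q * ((p * signedPow p (v t q.1 - v t q.2)) * (v' q.1 - v' q.2))
        ∂(μ.prod μ)) t := by
  obtain ⟨C, hC, hlip⟩ := ContinuousMap.exists_lipschitz_of_hasDerivAt hv
  refine hasDerivAt_integral_mul_comp (W := fun s q => v s q.1 - v s q.2)
    (hasDerivAt_abs_rpow' hp) (continuous_const.mul (continuous_signedPow hp)) k.continuous
    (C := 2 * C) (by positivity) (fun s => by fun_prop) (by fun_prop)
    (fun q => (ContinuousMap.hasDerivAt_apply hv q.1).sub (ContinuousMap.hasDerivAt_apply hv q.2))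
    (hlip.mono fun s hs q => ?_)
  have h1 := hs q.1
  have h2 := hs q.2
  calc |v s q.1 - v s q.2 - (v t q.1 - v t q.2)|
      = |(v s q.1 - v t q.1) - (v s q.2 - v t q.2)| := by congr 1; ring
    _ ≤ _ := (abs_sub _ _).trans (by linarith)

/-- Nonlocal integration by parts. -/
lemma integral_interaction_eq (hks : ∀ x y, k (x, y) = k (y, x)) (v h : C(X, ℝ)) :
    ∫ q : X × X, k q * (signedPow p (v q.1 - v q.2) * (h q.1 - h q.2)) ∂(μ.prod μ) =
      -2 * ∫ x, h x * nonlocalMap μ hp k v x ∂μ := by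
  have hφ := continuous_signedPow hp
  have h1 : Continuous fun q : X × X => k q * (signedPow p (v q.1 - v q.2) * h q.1) := by fun_prop
  have h2 : Continuous fun q : X × X => k q * (signedPow p (v q.1 - v q.2) * h q.2) := by fun_prop
  have e1 : ∫ q : X × X, k q * (signedPow p (v q.1 - v q.2) * h q.2) ∂(μ.prod μ) =
      -∫ q : X × X, k q * (signedPow p (v q.1 - v q.2) * h q.1) ∂(μ.prod μ) := by
    rw [← integral_prod_swap, ← integral_neg]
    congr 1; ext ⟨x, y⟩
    simp only [Prod.swap, hks y x]
    rw [← neg_sub (v x) (v y), signedPow_neg]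
    ring
  have e2 : ∫ q : X × X, k q * (signedPow p (v q.1 - v q.2) * h q.1) ∂(μ.prod μ) =
      -∫ x, h x * nonlocalMap μ hp k v x ∂μ := by
    rw [integral_prod _ h1.integrable_of_compactSpace, ← integral_neg]
    congr 1; ext x
    rw [← mul_neg]
    change _ = h x * -∫ y, k (x, y) * signedPow p (v y - v x) ∂μ
    rw [← integral_neg, ← integral_const_mul]
    congr 1; ext y
    simp only
    rw [← neg_sub (v y) (v x), signedPow_neg]
    ring
  simp only [mul_sub]
  rw [integral_sub h1.integrable_of_compactSpace h2.integrable_of_compactSpace, e1, e2]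
  ring

lemma continuous_nonlocalMap : Continuous (nonlocalMap μ hp k) := by
  refine continuous_iff_continuousAt.2 fun w => ?_
  rw [ContinuousAt, tendsto_iff_norm_sub_tendsto_zero]
  set A := ‖k‖ * ((p - 1) * (2 * (‖w‖ + 1)) ^ (p - 2) * 2) * μ.real univ
  have hlim : Tendsto (fun u => A * ‖u - w‖) (𝓝 w) (𝓝 0) := by
    have : Tendsto (fun u => A * ‖u - w‖) (𝓝 w) (𝓝 (A * ‖w - w‖)) :=
      Continuous.tendsto (by fun_prop) w
    simpa using this
  refine squeeze_zero' (Eventually.of_forall fun _ => norm_nonneg _) ?_ hlim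
  filter_upwards [Metric.ball_mem_nhds w one_pos] with u hu
  refine norm_nonlocalMap_sub_le hp ?_ (by linarith)
  have h1 : ‖u - w‖ < 1 := by simpa [dist_eq_norm] using hu
  have h2 := norm_le_norm_add_norm_sub' u w
  linarith

end Energy

section BlowUp
open Filter Topology
variable {X : Type*} [MetricSpace X] [CompactSpace X]
variable [MeasurableSpace X] [BorelSpace X] {μ : Measure X} [IsFiniteMeasure μ]
variable {p : ℝ} (hp : 2 < p) {k : C(X × X, ℝ)}

lemma exists_hasDerivAt_of_continuousOn {ψ : ℝ → ℝ} {T : ℝ} (hT : 0 ≤ T)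
    (hψ : ContinuousOn ψ (Icc 0 T)) :
    ∃ B : ℝ → ℝ, B 0 = 0 ∧ ∀ t ∈ Icc 0 T, HasDerivAt B (ψ t) t := by
  have hc : Continuous (IccExtend hT ((Icc 0 T).domRestrict ψ)) := hψ.domRestrict.Icc_extend'
  refine ⟨fun t => ∫ s in (0:ℝ)..t, IccExtend hT ((Icc 0 T).domRestrict ψ) s, by simp, fun t ht => ?_⟩
  have := intervalIntegral.integral_hasDerivAt_right (hc.intervalIntegrable 0 t)
    (hc.stronglyMeasurableAtFilter _ _) hc.continuousAt
  rwa [IccExtend_of_mem _ _ ht] at this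

lemma continuous_integral_eval (ν : Measure X) [IsFiniteMeasure ν] :
    Continuous fun w : C(X, ℝ) => ∫ x, w x ∂ν := by
  refine continuous_iff_continuousAt.2 fun w => ?_
  rw [ContinuousAt, tendsto_iff_norm_sub_tendsto_zero]
  have hlim : Tendsto (fun u => ‖u - w‖ * ν.real univ) (𝓝 w) (𝓝 0) := by
    have : Tendsto (fun u => ‖u - w‖ * ν.real univ) (𝓝 w) (𝓝 (‖w - w‖ * ν.real univ)) :=
      Continuous.tendsto (by fun_prop) w
    simpa using this
  refine squeeze_zero (fun _ => norm_nonneg _) (fun u => ?_) hlim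
  rw [← integral_sub u.continuous.integrable_of_compactSpace w.continuous.integrable_of_compactSpace]
  exact norm_integral_le_of_norm_le_const (ae_of_all _ fun x => (u - w).norm_coe_le_norm x)

/-- The energy method for the nonlocal evolution driven by a source close to `f ∘ v` on `S`. -/
lemma time_le_of_evolution (hks : ∀ x y, k (x, y) = k (y, x)) (hk : ∀ q, 0 ≤ k q)
    {χ : C(X, ℝ)} (hχ : ∀ x, 0 ≤ χ x) {S : Set X} (hS : MeasurableSet S)
    {f F : ℝ → ℝ} (hf : Continuous f) (hF : ∀ s, HasDerivAt F (f s) s) (hF0 : F 0 = 0) {γ : ℝ}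
    (hCp : ∀ s, 0 ≤ s → p * F s ≤ s * f s + γ) {C G : ℝ} (hC : 0 ≤ C) (hG : 0 ≤ G)
    (hfG : ∀ s ∈ Icc 0 C, |f s| ≤ G) {v g : ℝ → C(X, ℝ)} {U : ℝ → X → ℝ} {T : ℝ} (hT : 0 < T)
    (hg : Continuous g)
    (hv : ∀ t ∈ Icc 0 T, HasDerivAt v (nonlocalMap μ hp k (v t) - χ * v t + g t) t)
    (hgU : ∀ t ∈ Icc 0 T, ∀ x ∈ S, g t x = f (U t x)) (hgS : ∀ t ∈ Icc 0 T, ∀ x ∉ S, g t x = 0)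
    (hvC : ∀ t ∈ Icc 0 T, ∀ x, v t x ∈ Icc 0 C) (hUC : ∀ t ∈ Icc 0 T, ∀ x ∈ S, U t x ∈ Icc 0 C)
    {δ ω : ℝ} (hUv : ∀ t ∈ Icc 0 T, ∀ x ∈ S, |U t x - v t x| ≤ δ)
    (hω : ∀ a ∈ Icc 0 C, ∀ b ∈ Icc 0 C, |a - b| ≤ δ → |f a - f b| ≤ ω) (hω0 : 0 ≤ ω)
    (hω1 : ω ≤ 1 / 2)
    (hsmall : 2 * p * ω * μ.real S * (T + G * C) + (p * G + G) * δ * μ.real S ≤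
      (p - 1) * γ * μ.real S)
    {j : ℝ} (hj : 0 < j)
    (hj0 : j ≤ -(1 / p) * (1 / 2 * ∫ q : X × X, k q * |v 0 q.1 - v 0 q.2| ^ p ∂(μ.prod μ))
      - 1 / 2 * (∫ x, χ x * v 0 x ^ 2 ∂μ) + (∫ x in S, F (v 0 x) ∂μ) - γ * μ.real S) :
    p * (p - 2) * j * T ≤ ∫ x, v 0 x ^ 2 ∂μ := by
  have hp0 : 0 < p := by linarith
  have m0 : (0 : ℝ) ∈ Icc 0 T := ⟨le_rfl, hT.le⟩
  have hFc : Continuous F := continuous_iff_continuousAt.2 fun s => (hF s).continuousAt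
  set m := μ.real S with hm
  have hm0 : 0 ≤ m := measureReal_nonneg
  have hvc : ContinuousOn v (Icc 0 T) := fun t ht => (hv t ht).continuousAt.continuousWithinAt
  set v' : ℝ → C(X, ℝ) := fun t => nonlocalMap μ hp k (v t) - χ * v t + g t with hv'
  have hv'c : ContinuousOn v' (Icc 0 T) :=
    (((continuous_nonlocalMap hp).comp_continuousOn hvc).sub (continuousOn_const.mul hvc)).add
      hg.continuousOn
  have hint : ∀ {h : X → ℝ}, Continuous h → Integrable h μ := fun hh =>
    hh.integrable_of_compactSpace
  obtain ⟨B, hB0, hB⟩ := exists_hasDerivAt_of_continuousOn hT.le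
    ((continuous_integral_eval μ).comp_continuousOn (hg.continuousOn.mul hv'c))
  simp only [Function.comp_apply] at hB
  -- the Lipschitz bound for `F`
  have hFlip : ∀ a ∈ Icc 0 C, ∀ b ∈ Icc 0 C, |F a - F b| ≤ G * |a - b| := fun a ha b hb =>
    Convex.norm_image_sub_le_of_norm_hasDerivWithin_le (f := F) (f' := f)
      (fun x _ => (hF x).hasDerivWithinAt) hfG (convex_Icc _ _) hb ha
  -- the energy and its derivative
  set D : ℝ → ℝ := fun t => ∫ q : X × X, k q * |v t q.1 - v t q.2| ^ p ∂(μ.prod μ) with hD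
  set c₀ : ℝ := ∫ x in S, F (v 0 x) ∂μ with hc₀
  set J : ℝ → ℝ := fun t => -(1 / p) * (1 / 2 * D t) - 1 / 2 * (∫ x, χ x * v t x ^ 2 ∂μ)
    + B t + c₀ - γ * m with hJ
  have hDv : ∀ t, D t = -2 * ∫ x, v t x * nonlocalMap μ hp k (v t) x ∂μ := by
    intro t
    rw [← integral_interaction_eq hp hks]
    simp only [hD, signedPow_mul_self hp]
  have hDd : ∀ t ∈ Icc 0 T, HasDerivAt D
      (p * (-2 * ∫ x, v' t x * nonlocalMap μ hp k (v t) x ∂μ)) t := by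
    intro t ht
    refine (hasDerivAt_interaction_energy hp (hv t ht)).congr_deriv ?_
    rw [← integral_interaction_eq hp hks, ← integral_const_mul]
    congr 1; ext q; ring
  have hsq : ∀ s : ℝ, HasDerivAt (fun s : ℝ => s ^ 2) (2 * s) s := fun s => by
    simpa using hasDerivAt_pow 2 s
  have hJd : ∀ t ∈ Icc 0 T, HasDerivAt J (∫ x, v' t x ^ 2 ∂μ) t := by
    intro t ht
    have h1 := (((hDd t ht).const_mul (1 / 2)).const_mul (-(1 / p)))
    have h2 := (hasDerivAt_integral_comp_curve (μ := μ) hsq (by fun_prop) χ (hv t ht)).const_mul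
      (1 / 2)
    refine ((((h1.sub h2).add (hB t ht)).add_const c₀).sub_const (γ * m)).congr_deriv ?_
    rw [← integral_const_mul (1 / 2)]
    have e : -(1 / p) * (1 / 2 * (p * (-2 * ∫ x, v' t x * nonlocalMap μ hp k (v t) x ∂μ))) =
        ∫ x, v' t x * nonlocalMap μ hp k (v t) x ∂μ := by field_simp
    rw [e, ← integral_sub (hint (by fun_prop)) (hint (by fun_prop)),
      ← integral_add (hint (by fun_prop)) (hint (by fun_prop))]
    congr 1; ext x
    have : v' t x = nonlocalMap μ hp k (v t) x - χ x * v t x + g t x := rfl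
    change v' t x * nonlocalMap μ hp k (v t) x - 1 / 2 * (χ x * (2 * v t x * v' t x)) +
      g t x * v' t x = _
    rw [show v' t x ^ 2 = v' t x * (nonlocalMap μ hp k (v t) x - χ x * v t x + g t x) by
      rw [← this, sq]]
    ring
  -- the `L²` norm and its derivative
  have hyd : ∀ t ∈ Icc 0 T, HasDerivAt (fun t => ∫ x, v t x ^ 2 ∂μ)
      (2 * ∫ x, v t x * v' t x ∂μ) t := by
    intro t ht
    have := hasDerivAt_integral_comp_curve (μ := μ) hsq (by fun_prop) 1 (hv t ht)
    simp only [ContinuousMap.one_apply, one_mul] at this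
    refine this.congr_deriv ?_
    rw [← integral_const_mul]
    congr 1; ext x
    change 2 * v t x * v' t x = _
    ring
  have hJ0 : j ≤ J 0 := by
    simp only [hJ, hB0, add_zero]
    exact hj0
  -- comparison of `B` with the potential energy of `v`
  have hPd : ∀ t ∈ Icc 0 T, HasDerivAt (fun t => ∫ x in S, F (v t x) ∂μ)
      (∫ x in S, f (v t x) * v' t x ∂μ) t := by
    intro t ht
    have := hasDerivAt_integral_comp_curve (μ := μ.restrict S) hF hf 1 (hv t ht)
    simpa only [ContinuousMap.one_apply, one_mul] using this
  set H : ℝ → ℝ := fun t => c₀ + B t - ∫ x in S, F (v t x) ∂μ with hH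
  have hgS' : ∀ t ∈ Icc 0 T, ∀ w : C(X, ℝ), ∫ x, g t x * w x ∂μ =
      ∫ x in S, f (U t x) * w x ∂μ := by
    intro t ht w
    rw [← setIntegral_eq_integral_of_forall_compl_eq_zero (s := S)
      (fun x hx => by rw [hgS t ht x hx, zero_mul])]
    exact setIntegral_congr_fun hS fun x hx => by simp only [hgU t ht x hx]
  have hfUint : ∀ t ∈ Icc 0 T, ∀ w : C(X, ℝ), IntegrableOn (fun x => f (U t x) * w x) S μ := by
    intro t ht w
    refine ((hint (h := fun x => g t x * w x) (by fun_prop)).integrableOn).congr_fun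
      (fun x hx => ?_) hS
    simp only [hgU t ht x hx]
  have hHd : ∀ t ∈ Icc 0 T, HasDerivAt (fun t => ω * (m * t + J t) - H t)
      (ω * (m * 1 + ∫ x, v' t x ^ 2 ∂μ) -
        ((∫ x, g t x * v' t x ∂μ) - ∫ x in S, f (v t x) * v' t x ∂μ)) t := fun t ht =>
    ((((hasDerivAt_id t).const_mul m).add (hJd t ht)).const_mul ω).sub
      (((hB t ht).const_add c₀).sub (hPd t ht))
  have hHd0 : ∀ t ∈ Icc 0 T, 0 ≤ ω * (m * 1 + ∫ x, v' t x ^ 2 ∂μ) -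
        ((∫ x, g t x * v' t x ∂μ) - ∫ x in S, f (v t x) * v' t x ∂μ) := by
    intro t ht
    rw [hgS' t ht, sub_nonneg, ← integral_sub (hfUint t ht _) (hint (by fun_prop)).integrableOn]
    calc ∫ x in S, (f (U t x) * v' t x - f (v t x) * v' t x) ∂μ
        ≤ ∫ x in S, ω * (1 + v' t x ^ 2) ∂μ := by
          refine setIntegral_mono_on ((hfUint t ht _).sub (hint (by fun_prop)).integrableOn)
            (hint (by fun_prop)).integrableOn hS fun x hx => ?_
          rw [← sub_mul]
          have h1 := hω _ (hUC t ht x hx) _ (hvC t ht x) (hUv t ht x hx)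
          refine (le_abs_self _).trans ?_
          rw [abs_mul]
          refine mul_le_mul h1 ?_ (abs_nonneg _) hω0
          nlinarith [sq_abs (v' t x), sq_nonneg (|v' t x| - 1)]
      _ = ω * (m + ∫ x in S, v' t x ^ 2 ∂μ) := by
          rw [integral_const_mul, integral_add (integrable_const _) (hint (by fun_prop)).integrableOn]
          simp [hm]
      _ ≤ _ := by
          rw [mul_one]
          refine mul_le_mul_of_nonneg_left (add_le_add le_rfl ?_) hω0
          exact setIntegral_le_integral (hint (by fun_prop)) (ae_of_all _ fun x => sq_nonneg _)
  have hHmono := monotoneOn_of_hasDerivWithinAt_nonneg (convex_Icc 0 T)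
      (fun t ht => (hHd t ht).continuousAt.continuousWithinAt)
      (fun t ht => (hHd t (interior_subset ht)).hasDerivWithinAt)
      fun t ht => hHd0 t (interior_subset ht)
  have hFS : ∀ t ∈ Icc 0 T, ∫ x in S, F (v t x) ∂μ ≤ G * C * m := by
    intro t ht
    calc ∫ x in S, F (v t x) ∂μ ≤ ∫ _x in S, G * C ∂μ := by
          refine setIntegral_mono_on (hint (by fun_prop)).integrableOn
            (integrable_const _) hS fun x _ => ?_
          have h1 := hFlip _ (hvC t ht x) 0 ⟨le_rfl, hC⟩
          rw [hF0, sub_zero, sub_zero, abs_of_nonneg (hvC t ht x).1] at h1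
          exact (le_abs_self _).trans (h1.trans (by gcongr; exact (hvC t ht x).2))
      _ = _ := by simp [hm, mul_comm]
  have hHle : ∀ t ∈ Icc 0 T, H t ≤ 2 * ω * m * (T + G * C) := by
    intro t ht
    have h1 := hHmono m0 ht ht.1
    have hH0 : H 0 = 0 := by simp [hH, hB0, hc₀]
    simp only [mul_zero, zero_add, hH0, sub_zero] at h1
    have hJ0' : 0 ≤ J 0 := hj.le.trans hJ0
    have hDt : 0 ≤ D t := integral_nonneg fun q => mul_nonneg (hk q) (by positivity)
    have hχt : 0 ≤ ∫ x, χ x * v t x ^ 2 ∂μ :=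
      integral_nonneg fun x => mul_nonneg (hχ x) (sq_nonneg _)
    have hF' : 0 ≤ γ := by
      have := hCp 0 le_rfl
      rw [hF0] at this; linarith
    have hJt : J t ≤ H t + G * C * m := by
      have h2 := hFS t ht
      have h3 : 0 ≤ 1 / p * (1 / 2 * D t) := by positivity
      have h4 : 0 ≤ γ * m := by positivity
      simp only [hJ, hH]
      linarith
    have h5 : H t ≤ ω * (m * T + (H t + G * C * m)) := by
      have h6 : ω * (m * t + J t) ≤ ω * (m * T + (H t + G * C * m)) := by
        have := ht.2
        gcongr
      have h7 : 0 ≤ ω * J 0 := by positivity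
      linarith
    have h8 : 0 ≤ ω * m * (T + G * C) := by positivity
    rcases le_or_gt (H t) 0 with h0 | h0
    · linarith
    · nlinarith
  refine time_le_of_concavity hp hj hT hyd hJd (fun t _ => integral_nonneg fun x => sq_nonneg _)
    (fun t _ => integral_nonneg fun x => sq_nonneg _) (fun t ht => ?_) (fun t ht => ?_) hJ0
  · -- the differential inequality
    have e1 : ∫ x, v t x * v' t x ∂μ = -(1 / 2 * D t) - (∫ x, χ x * v t x ^ 2 ∂μ) +
        ∫ x in S, f (U t x) * v t x ∂μ := by
      rw [hDv, ← hgS' t ht, show -(1 / 2 * (-2 * ∫ x, v t x * nonlocalMap μ hp k (v t) x ∂μ)) =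
        ∫ x, v t x * nonlocalMap μ hp k (v t) x ∂μ by ring,
        ← integral_sub (hint (by fun_prop)) (hint (by fun_prop)),
        ← integral_add (hint (by fun_prop)) (hint (by fun_prop))]
      congr 1; ext x
      have : v' t x = nonlocalMap μ hp k (v t) x - χ x * v t x + g t x := rfl
      rw [this]; ring
    have e2 : p * (∫ x in S, F (v t x) ∂μ) - γ * m - (p * G + G) * δ * m ≤
        ∫ x in S, f (U t x) * v t x ∂μ := by
      have hFi : IntegrableOn (fun x => p * F (v t x)) S μ := (hint (by fun_prop)).integrableOn
      calc p * (∫ x in S, F (v t x) ∂μ) - γ * m - (p * G + G) * δ * m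
          = ∫ x in S, (p * F (v t x) - (γ + (p * G + G) * δ)) ∂μ := by
            rw [integral_sub hFi (integrable_const _), integral_const_mul]
            simp only [integral_const, measureReal_restrict_apply_univ, smul_eq_mul, ← hm]
            ring
        _ ≤ _ := by
          refine setIntegral_mono_on (hFi.sub (integrable_const _)) (hfUint t ht _) hS
            fun x hx => ?_
          have hu := hUC t ht x hx
          have hd := hUv t ht x hx
          have a1 := hCp _ hu.1
          have a2 := (abs_le.1 (hFlip _ (hvC t ht x) _ hu)).2
          have a3 : |v t x - U t x| ≤ δ := by rwa [abs_sub_comm]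
          have a4 := mul_le_mul_of_nonneg_left (a2.trans (mul_le_mul_of_nonneg_left a3 hG)) hp0.le
          have a5 : |f (U t x) * (U t x - v t x)| ≤ G * δ := by
            rw [abs_mul]; exact mul_le_mul (hfG _ hu) hd (abs_nonneg _) hG
          have a6 := (abs_le.1 a5).2
          linarith
    have e3 := hHle t ht
    have e4 : 0 ≤ ∫ x, χ x * v t x ^ 2 ∂μ :=
      integral_nonneg fun x => mul_nonneg (hχ x) (sq_nonneg _)
    have e5 : (∫ x, χ x * v t x ^ 2 ∂μ) * 2 ≤ (∫ x, χ x * v t x ^ 2 ∂μ) * p :=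
      mul_le_mul_of_nonneg_left hp.le e4
    have e6 := mul_le_mul_of_nonneg_left e3 hp0.le
    rw [e1]
    have e7 : p * J t = -(1 / 2 * D t) - p / 2 * (∫ x, χ x * v t x ^ 2 ∂μ) +
        p * (H t + ∫ x in S, F (v t x) ∂μ) - p * (γ * m) := by
      simp only [hJ, hH]
      field_simp
      ring
    linarith
  · -- Cauchy-Schwarz
    have hcs : ∀ z : ℝ, 0 ≤ (∫ x, v' t x ^ 2 ∂μ) * (z * z) +
        (2 * ∫ x, v t x * v' t x ∂μ) * z + ∫ x, v t x ^ 2 ∂μ := by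
      intro z
      have : (∫ x, v' t x ^ 2 ∂μ) * (z * z) + (2 * ∫ x, v t x * v' t x ∂μ) * z +
          ∫ x, v t x ^ 2 ∂μ = ∫ x, (z * v' t x + v t x) ^ 2 ∂μ := by
        rw [mul_right_comm, ← integral_mul_const, ← integral_const_mul,
          ← integral_add (hint (by fun_prop)) (hint (by fun_prop)),
          ← integral_add (hint (by fun_prop)) (hint (by fun_prop))]
        congr 1; ext x; ring
      rw [this]
      exact integral_nonneg fun x => sq_nonneg _
    have := discrim_le_zero hcs
    rw [discrim] at this
    linarith

end BlowUp

section Doubling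
open Filter Topology
variable {N : ℕ}
local notation "E" => EuclideanSpace ℝ (Fin N)

lemma Ultrafilter.exists_tendsto_of_eventually_mem {ι Y : Type*} [TopologicalSpace Y]
    (𝒰 : Ultrafilter ι) {K : Set Y} (hK : IsCompact K) {s : ι → Y} (hs : ∀ᶠ i in 𝒰, s i ∈ K) :
    ∃ a ∈ K, Tendsto s 𝒰 (𝓝 a) := by
  obtain ⟨a, ha, hle⟩ := hK.ultrafilter_le_nhds (𝒰.map s) (le_principal_iff.2 hs)
  exact ⟨a, ha, hle⟩

/-- A uniform modulus of continuity with respect to the last variable. -/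
lemma exists_modulus_snd {Y : Type*} [PseudoMetricSpace Y] {g : Y → ℝ → ℝ}
    (hg : Continuous fun q : Y × ℝ => g q.1 q.2) {K : Set Y} (hK : IsCompact K) (T : ℝ) {e : ℝ}
    (he : 0 < e) :
    ∃ ζ > 0, ∀ x ∈ K, ∀ s ∈ Icc 0 T, ∀ t ∈ Icc 0 T, |s - t| ≤ ζ → |g x s - g x t| < e := by
  have hu := (hK.prod isCompact_Icc).uniformContinuousOn_of_continuous
    (hg.continuousOn (s := K ×ˢ Icc 0 T))
  obtain ⟨ζ, hζ, H⟩ := Metric.uniformContinuousOn_iff.1 hu e he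
  refine ⟨ζ / 2, half_pos hζ, fun x hx s hs t ht hst => ?_⟩
  have := H (x, s) ⟨hx, hs⟩ (x, t) ⟨hx, ht⟩ (by
    rw [Prod.dist_eq, dist_self, Real.dist_eq]
    exact max_lt hζ (by linarith))
  rwa [Real.dist_eq] at this

/-- Asymptotic comparison of nonlocal subsolutions with a classical solution, by doubling the time
variable. -/
lemma eventually_le_of_subsolution {p κ : ℝ} (hp : 2 < p) (hκ : 0 < κ)
    (hflux : ∀ q : E, flux p q = (κ * ‖q‖ ^ (p - 2)) • q) {Ω : Set E}
    (hΩbdd : Bornology.IsBounded Ω) {Ψ h : E → ℝ → ℝ}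
    (hΨ : Continuous fun q : E × ℝ => Ψ q.1 q.2) (hh : Continuous fun q : E × ℝ => h q.1 q.2)
    {T T₁ C δ ρ τ r₀ : ℝ} (hT : 0 < T) (hT₁ : T < T₁) (hC : 0 < C) (hδ : 0 < δ) (hρ : 0 < ρ)
    (hτ : 0 < τ) (hr₀ : 0 < r₀)
    (hΨ2 : ∀ x ∈ Ω, ∀ s ∈ Ioo 0 T₁, ContDiffAt ℝ 2 (fun y => Ψ y s) x)
    (hΨt : ∀ x ∈ Ω, ∀ s ∈ Ioo 0 T₁,
      HasDerivAt (Ψ x) (pLaplacian p (fun y => Ψ y s) x + h x s) s)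
    {V V' : ℝ → E → ℝ → ℝ}
    (hVc : ∀ r ∈ Ioo 0 r₀, ContinuousOn (fun q : E × ℝ => V r q.1 q.2) (closure Ω ×ˢ Icc 0 T))
    (hVd : ∀ r ∈ Ioo 0 r₀, ∀ x ∈ Ω, ∀ t ∈ Icc 0 T, HasDerivAt (V r x) (V' r x t) t)
    (hVC : ∀ r ∈ Ioo 0 r₀, ∀ x ∈ closure Ω, ∀ t ∈ Icc 0 T, |V r x t| ≤ C)
    (hΨC : ∀ x ∈ closure Ω, ∀ s, |Ψ x s| ≤ C)
    (hsub : ∀ r ∈ Ioo 0 r₀, ∀ x ∈ Ω, ∀ t ∈ Icc 0 T, ∀ s, δ < V r x t - Ψ x s →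
      ∀ w : E → ℝ, Continuous w → (∀ y ∈ Metric.ball x r, V r y t - w y ≤ V r x t - w x) →
      V' r x t ≤ nonlocal p κ r w x + h x t)
    (hbdry : ∀ r ∈ Ioo 0 r₀, ∀ x ∈ closure Ω, Metric.infDist x Ωᶜ ≤ ρ → ∀ t ∈ Icc 0 T, ∀ s,
      V r x t - Ψ x s ≤ δ)
    (hinit : ∀ r ∈ Ioo 0 r₀, ∀ x ∈ closure Ω, ∀ t ∈ Icc 0 T, t ≤ τ → V r x t - Ψ x t ≤ 6 * δ) :
    ∀ᶠ r in 𝓝[>] (0 : ℝ), ∀ x ∈ closure Ω, ∀ t ∈ Icc 0 T, V r x t - Ψ x t ≤ 10 * δ := by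
  set K := closure Ω with hK
  have hKc : IsCompact K := hΩbdd.isCompact_closure
  set η := δ / T with hη
  have hη0 : 0 < η := div_pos hδ hT
  obtain ⟨ζ₁, hζ₁, H₁⟩ := exists_modulus_snd hΨ hKc T₁ hδ
  obtain ⟨ζ₂, hζ₂, H₂⟩ := exists_modulus_snd hh hKc T₁ hη0
  obtain ⟨ζ, hζ, hζ1, hζ2, hζ3, hζ4⟩ : ∃ ζ > 0, ζ ≤ ζ₁ ∧ ζ ≤ ζ₂ ∧ ζ ≤ τ / 2 ∧ ζ ≤ (T₁ - T) / 2 :=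
    ⟨min (min ζ₁ ζ₂) (min (τ / 2) ((T₁ - T) / 2)),
      lt_min (lt_min hζ₁ hζ₂) (lt_min (by linarith) (by linarith)),
      (min_le_left _ _).trans (min_le_left _ _), (min_le_left _ _).trans (min_le_right _ _),
      (min_le_right _ _).trans (min_le_left _ _), (min_le_right _ _).trans (min_le_right _ _)⟩
  set ε := ζ ^ 2 / (4 * C) with hε
  have hε0 : 0 < ε := by positivity
  set Q : E → ℝ → ℝ → ℝ := fun x t s => Ψ x s + (t - s) ^ 2 / (2 * ε) with hQ
  have hQc : Continuous fun q : (E × ℝ) × ℝ => Q q.1.1 q.1.2 q.2 := by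
    have : Continuous fun q : (E × ℝ) × ℝ => Ψ q.1.1 q.2 :=
      hΨ.comp (f := fun q : (E × ℝ) × ℝ => (q.1.1, q.2)) (by fun_prop)
    simp only [hQ]; fun_prop
  -- localization of almost maximal points
  have hloc : ∀ r ∈ Ioo 0 r₀, ∀ x ∈ K, ∀ t ∈ Icc 0 T, ∀ s ∈ Icc 0 T₁,
      8 * δ ≤ V r x t - η * t - Q x t s →
      δ < V r x t - Ψ x s ∧ |t - s| ≤ ζ ∧ ρ < Metric.infDist x Ωᶜ ∧ τ < t := by
    intro r hr x hx t ht s hs hW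
    have ht0 : 0 ≤ η * t := mul_nonneg hη0.le ht.1
    have hsq : 0 ≤ (t - s) ^ 2 / (2 * ε) := by positivity
    have b1 := abs_le.1 (hVC r hr x hx t ht)
    have b2 := abs_le.1 (hΨC x hx s)
    simp only [hQ] at hW
    have hgap : δ < V r x t - Ψ x s := by linarith
    have hts : |t - s| ≤ ζ := by
      refine abs_le_of_sq_le_sq ?_ hζ.le
      have : (t - s) ^ 2 / (2 * ε) ≤ 2 * C := by linarith
      rw [div_le_iff₀ (by positivity)] at this
      refine this.trans (le_of_eq ?_)
      rw [hε]; field_simp; ring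
    refine ⟨hgap, hts, ?_, ?_⟩
    · by_contra! hd
      linarith [hbdry r hr x hx hd t ht s]
    · by_contra! hd
      have h1 := hinit r hr x hx t ht hd
      have h2 := abs_lt.1 (H₁ x hx t ⟨ht.1, by linarith [ht.2]⟩ s hs (hts.trans hζ1))
      linarith
  by_contra hfreq
  rw [Filter.not_eventually] at hfreq
  set bad : Set ℝ := {r | ¬ ∀ x ∈ K, ∀ t ∈ Icc 0 T, V r x t - Ψ x t ≤ 10 * δ} with hbad
  have : (𝓝[>] (0 : ℝ) ⊓ 𝓟 bad).NeBot := frequently_mem_iff_neBot.1 hfreq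
  obtain ⟨𝒰, h𝒰⟩ := Ultrafilter.exists_le (𝓝[>] (0 : ℝ) ⊓ 𝓟 bad)
  have h𝒰0 : (𝒰 : Filter ℝ) ≤ 𝓝[>] 0 := h𝒰.trans inf_le_left
  have hbadU : ∀ᶠ r in (𝒰 : Filter ℝ), r ∈ bad := h𝒰.trans inf_le_right (mem_principal_self _)
  have hr0U : ∀ᶠ r in (𝒰 : Filter ℝ), r ∈ Ioo 0 r₀ := h𝒰0 (Ioo_mem_nhdsGT hr₀)
  have hrρU : ∀ᶠ r in (𝒰 : Filter ℝ), r ∈ Ioo 0 ρ := h𝒰0 (Ioo_mem_nhdsGT hρ)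
  -- maximizers with respect to all variables
  have hmax1 : ∀ r, r ∈ bad ∧ r ∈ Ioo 0 r₀ → ∃ s ∈ Icc 0 T₁, ∃ M, 9 * δ ≤ M ∧
      (∃ x ∈ K, ∃ t ∈ Icc 0 T, V r x t - η * t - Q x t s = M) ∧
      ∀ x ∈ K, ∀ t ∈ Icc 0 T, ∀ s ∈ Icc 0 T₁, V r x t - η * t - Q x t s ≤ M := by
    rintro r ⟨hrb, hr⟩
    simp only [hbad, mem_ofPred_eq, not_forall, not_le] at hrb
    obtain ⟨x₁, hx₁, t₁, ht₁, hv₁⟩ := hrb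
    have hc : ContinuousOn (fun q : (E × ℝ) × ℝ => V r q.1.1 q.1.2 - η * q.1.2 - Q q.1.1 q.1.2 q.2)
        ((K ×ˢ Icc 0 T) ×ˢ Icc 0 T₁) :=
      (((hVc r hr).comp continuousOn_fst fun q hq => hq.1).sub (by fun_prop)).sub hQc.continuousOn
    have ht₁' : t₁ ∈ Icc 0 T₁ := ⟨ht₁.1, by linarith [ht₁.2]⟩
    obtain ⟨⟨⟨x, t⟩, s⟩, ⟨⟨hx, ht⟩, hs⟩, hm⟩ := ((hKc.prod isCompact_Icc).prod
      isCompact_Icc).exists_isMaxOn ⟨((x₁, t₁), t₁), ⟨hx₁, ht₁⟩, ht₁'⟩ hc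
    refine ⟨s, hs, _, ?_, ⟨x, hx, t, ht, rfl⟩, fun y hy t' ht' s' hs' =>
      hm (show ((y, t'), s') ∈ (K ×ˢ Icc 0 T) ×ˢ Icc 0 T₁ from ⟨⟨hy, ht'⟩, hs'⟩)⟩
    have h1 := hm (show ((x₁, t₁), t₁) ∈ (K ×ˢ Icc 0 T) ×ˢ Icc 0 T₁ from ⟨⟨hx₁, ht₁⟩, ht₁'⟩)
    have h2 : η * t₁ ≤ δ := by
      rw [hη, div_mul_eq_mul_div, div_le_iff₀ hT]
      exact mul_le_mul_of_nonneg_left ht₁.2 hδ.le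
    simp only [hQ, sub_self, zero_pow two_ne_zero, zero_div, add_zero, mem_ofPred_eq] at h1 ⊢
    linarith
  choose! sr hsr M hM hMx hMmax using hmax1
  have hgood : ∀ᶠ r in (𝒰 : Filter ℝ), r ∈ bad ∧ r ∈ Ioo 0 r₀ := hbadU.and hr0U
  obtain ⟨sl, hsl, hslim⟩ := 𝒰.exists_tendsto_of_eventually_mem isCompact_Icc (hgood.mono hsr)
  -- maximizers for the frozen time `sl`
  have hmax2 : ∀ r, r ∈ bad ∧ r ∈ Ioo 0 r₀ → ∃ q ∈ K ×ˢ Icc 0 T, ∀ y ∈ K, ∀ t ∈ Icc 0 T,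
      V r y t - η * t - Q y t sl ≤ V r q.1 q.2 - η * q.2 - Q q.1 q.2 sl := by
    rintro r hr
    have hc : ContinuousOn (fun q : E × ℝ => V r q.1 q.2 - η * q.2 - Q q.1 q.2 sl)
        (K ×ˢ Icc 0 T) :=
      ((hVc r hr.2).sub (by fun_prop)).sub
        (hQc.comp (f := fun q : E × ℝ => (q, sl)) (by fun_prop)).continuousOn
    obtain ⟨x₁, hx₁, t₁, ht₁, -⟩ := hMx r hr
    obtain ⟨q, hq, hm⟩ := (hKc.prod isCompact_Icc).exists_isMaxOn ⟨(x₁, t₁), hx₁, ht₁⟩ hc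
    exact ⟨q, hq, fun y hy t ht => hm (show (y, t) ∈ K ×ˢ Icc 0 T from ⟨hy, ht⟩)⟩
  choose! qr hqr hqmax using hmax2
  obtain ⟨⟨xl, tl⟩, ⟨hxl, htl⟩, hqlim⟩ := 𝒰.exists_tendsto_of_eventually_mem
    (hKc.prod isCompact_Icc) (hgood.mono hqr)
  -- freezing the time costs little
  have hfreeze : ∀ e > 0, ∀ᶠ r in (𝒰 : Filter ℝ),
      M r - e ≤ V r (qr r).1 (qr r).2 - η * (qr r).2 - Q (qr r).1 (qr r).2 sl := by
    intro e he
    obtain ⟨ζ', hζ', H'⟩ := exists_modulus_snd (g := fun (q : E × ℝ) s => Q q.1 q.2 s) hQc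
      (hKc.prod (isCompact_Icc (a := 0) (b := T))) T₁ he
    filter_upwards [hgood, hslim (Metric.closedBall_mem_nhds sl hζ')] with r hr hrs
    obtain ⟨x, hx, t, ht, hxt⟩ := hMx r hr
    have h1 := hqmax r hr x hx t ht
    have h2 := abs_lt.1 (H' (x, t) ⟨hx, ht⟩ (sr r) (hsr r hr) sl hsl (by
      simpa [Real.dist_eq] using hrs))
    simp only at h2
    linarith
  have hlocU : ∀ᶠ r in (𝒰 : Filter ℝ), δ < V r (qr r).1 (qr r).2 - Ψ (qr r).1 sl ∧
      |(qr r).2 - sl| ≤ ζ ∧ ρ < Metric.infDist (qr r).1 Ωᶜ ∧ τ < (qr r).2 := by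
    filter_upwards [hgood, hfreeze δ hδ] with r hr h1
    exact hloc r hr.2 _ (hqr r hr).1 _ (hqr r hr).2 sl hsl (by linarith [hM r hr])
  have hxlim : Tendsto (fun r => (qr r).1) 𝒰 (𝓝 xl) := (continuous_fst.tendsto _).comp hqlim
  have htlim : Tendsto (fun r => (qr r).2) 𝒰 (𝓝 tl) := (continuous_snd.tendsto _).comp hqlim
  have hts : |tl - sl| ≤ ζ := le_of_tendsto ((htlim.sub_const sl).abs) (hlocU.mono fun r h => h.2.1)
  have hτt : τ ≤ tl := ge_of_tendsto htlim (hlocU.mono fun r h => h.2.2.2.le)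
  have hxlΩ : xl ∈ Ω := by
    by_contra hcon
    have h1 : ρ ≤ Metric.infDist xl Ωᶜ :=
      ge_of_tendsto (((Metric.continuous_infDist_pt _).tendsto _).comp hxlim)
        (hlocU.mono fun r h => h.2.2.1.le)
    rw [Metric.infDist_zero_of_mem hcon] at h1
    linarith
  have hsl_mem : sl ∈ Ioo 0 T₁ := by
    have := abs_le.1 hts
    exact ⟨by linarith, by linarith [htl.2]⟩
  -- first-order condition in the frozen time
  have hmin : ∀ s ∈ Icc 0 T₁, Q xl tl sl ≤ Q xl tl s := by
    intro s hs
    have hl : ∀ s, Tendsto (fun r => Q (qr r).1 (qr r).2 s) 𝒰 (𝓝 (Q xl tl s)) := fun s =>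
      ((hQc.comp (f := fun q : E × ℝ => (q, s)) (by fun_prop)).tendsto (xl, tl)).comp hqlim
    refine le_of_forall_pos_le_add fun e he => ?_
    refine le_of_tendsto_of_tendsto (hl sl) ((hl s).add_const e) ?_
    filter_upwards [hgood, hfreeze e he] with r hr h1
    have h2 := hMmax r hr _ (hqr r hr).1 _ (hqr r hr).2 s hs
    linarith
  have hQd : HasDerivAt (fun s => Q xl tl s) (pLaplacian p (fun y => Ψ y sl) xl + h xl sl +
      (2 * (tl - sl) * (-1)) / (2 * ε)) sl := by
    have h1 : HasDerivAt (fun s : ℝ => tl - s) (-1) sl := (hasDerivAt_id sl).const_sub tl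
    have h2 := (h1.pow 2).div_const (2 * ε)
    refine ((hΨt xl hxlΩ sl hsl_mem).add h2).congr_deriv (by norm_num)
  have hcrit := (IsLocalMin.hasDerivAt_eq_zero (Filter.mem_of_superset
    (Icc_mem_nhds hsl_mem.1 hsl_mem.2) hmin) hQd)
  -- the limiting subsolution inequality
  have hlimL : Tendsto (fun r => nonlocal p κ r (fun y => Ψ y sl) (qr r).1 + h (qr r).1 (qr r).2) 𝒰
      (𝓝 (pLaplacian p (fun y => Ψ y sl) xl + h xl tl)) := by
    have hw : Continuous fun y => Ψ y sl := hΨ.comp (f := fun y : E => (y, sl)) (by fun_prop)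
    have h1 := (tendsto_nonlocal hp hκ hflux hw (hΨ2 xl hxlΩ sl hsl_mem)).comp
      ((tendsto_id.mono_left h𝒰0 : Tendsto id (𝒰 : Filter ℝ) (𝓝[>] 0)).prodMk hxlim)
    exact h1.add ((hh.tendsto (xl, tl)).comp hqlim)
  have hineq : ∀ᶠ r in (𝒰 : Filter ℝ), ((qr r).2 - sl) / ε + η ≤
      nonlocal p κ r (fun y => Ψ y sl) (qr r).1 + h (qr r).1 (qr r).2 := by
    filter_upwards [hgood, hlocU, hrρU] with r hr hl hrρ
    obtain ⟨hl1, hl2, hl3, hl4⟩ := hl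
    have hball : ∀ y ∈ Metric.ball (qr r).1 r, y ∈ Ω := by
      intro y hy
      by_contra hcon
      have := Metric.infDist_le_dist_of_mem (x := (qr r).1) (mem_compl hcon)
      rw [Metric.mem_ball, dist_comm] at hy
      linarith [hrρ.2]
    have hqΩ : (qr r).1 ∈ Ω := hball _ (Metric.mem_ball_self hrρ.1)
    have hq2 := (hqr r hr).2
    have h1 := hsub r hr.2 _ hqΩ _ hq2 sl hl1 (fun y => Ψ y sl)
      (hΨ.comp (f := fun y : E => (y, sl)) (by fun_prop)) fun y hy => by
        have := hqmax r hr y (subset_closure (hball y hy)) _ hq2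
        simp only [hQ] at this
        linarith
    refine le_trans ?_ h1
    have h2 : HasDerivAt (fun t : ℝ => t - sl) 1 (qr r).2 := (hasDerivAt_id _).sub_const sl
    have h3 := ((hVd r hr.2 _ hqΩ _ hq2).sub ((hasDerivAt_id _).const_mul η)).sub
      (((h2.pow 2).div_const (2 * ε)).const_add (Ψ (qr r).1 sl))
    have h4 := zero_le_deriv_of_forall_le h3 (hτ.trans hl4) fun t ht => by
      have := hqmax r hr _ (hqr r hr).1 t ⟨ht.1, ht.2.trans hq2.2⟩
      simpa [hQ] using this
    have e : (2 : ℕ) * ((qr r).2 - sl) ^ (2 - 1) * 1 / (2 * ε) = ((qr r).2 - sl) / ε := by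
      norm_num; field_simp
    rw [e] at h4
    linarith
  have hfin := le_of_tendsto_of_tendsto (((htlim.sub_const sl).div_const ε).add_const η) hlimL hineq
  have hcon := abs_lt.1 (H₂ xl hxl tl ⟨htl.1, by linarith [htl.2]⟩ sl hsl (hts.trans hζ2))
  have e : (2 * (tl - sl) * (-1)) / (2 * ε) = -((tl - sl) / ε) := by field_simp
  rw [e] at hcrit
  linarith

end Doubling

section BallModel
open Filter Topology
variable {N : ℕ}
local notation "E" => EuclideanSpace ℝ (Fin N)

lemma nonlocal_comp_sub (p κ r : ℝ) (φ : E → ℝ) (x₀ x : E) :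
    nonlocal p κ r (fun y => φ (y - x₀)) x = nonlocal p κ r φ (x - x₀) := by
  rw [nonlocal, nonlocal,
    ← integral_sub_right_eq_self (fun y => kern p κ r (y - (x - x₀)) *
      signedPow p (φ y - φ (x - x₀))) x₀]
  simp only [sub_sub_sub_cancel_right]

lemma nonlocal_const_add (p κ r a : ℝ) (φ : E → ℝ) (x : E) :
    nonlocal p κ r (fun y => a + φ y) x = nonlocal p κ r φ x := by
  simp only [nonlocal, add_sub_add_left_eq_sub]

/-- The nonlocal operators are bounded on quadratic barriers, uniformly in the vertex and for all
small interaction ranges. -/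
lemma exists_nonlocal_quadratic_le {p κ : ℝ} (hp : 2 < p) (hκ : 0 < κ)
    (hflux : ∀ q : E, flux p q = (κ * ‖q‖ ^ (p - 2)) • q) (b : ℝ) :
    ∃ c, ∀ᶠ r in 𝓝[>] (0 : ℝ), ∀ x₀ x : E, ‖x - x₀‖ ≤ 1 →
      nonlocal p κ r (fun y => b * ‖y - x₀‖ ^ 2) x ≤ c := by
  have hcd : ContDiff ℝ 2 fun y : E => b * ‖y‖ ^ 2 := contDiff_const.mul (contDiff_norm_sq ℝ)
  have key : ∃ c, ∀ᶠ r in 𝓝[>] (0 : ℝ), ∀ z ∈ Metric.closedBall (0 : E) 1,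
      nonlocal p κ r (fun y => b * ‖y‖ ^ 2) z ≤ c := by
    refine (isCompact_closedBall (0 : E) 1).induction_on (p := fun s => ∃ c, ∀ᶠ r in 𝓝[>] (0 : ℝ),
      ∀ z ∈ s, nonlocal p κ r (fun y => b * ‖y‖ ^ 2) z ≤ c) ⟨0, by simp⟩ ?_ ?_ ?_
    · rintro s t hst ⟨c, hc⟩
      exact ⟨c, hc.mono fun r h z hz => h z (hst hz)⟩
    · rintro s t ⟨c, hc⟩ ⟨c', hc'⟩
      refine ⟨max c c', (hc.and hc').mono fun r h z hz => ?_⟩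
      rcases hz with hz | hz
      · exact (h.1 z hz).trans (le_max_left _ _)
      · exact (h.2 z hz).trans (le_max_right _ _)
    · intro z hz
      have h := (tendsto_nonlocal hp hκ hflux hcd.continuous (hcd.contDiffAt (x := z))).eventually
        (eventually_le_nhds (lt_add_one _))
      obtain ⟨pa, ha, pb, hb, hab⟩ := eventually_prod_iff.1 h
      exact ⟨{y | pb y}, mem_nhdsWithin_of_mem_nhds hb, _, ha.mono fun r hr y hy => hab hr hy⟩
  obtain ⟨c, hc⟩ := key
  refine ⟨c, hc.mono fun r hr x₀ x hx => ?_⟩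
  rw [nonlocal_comp_sub p κ r (fun y => b * ‖y‖ ^ 2)]
  exact hr _ (by simpa using hx)

variable {R : ℝ}

/-- Lebesgue measure on a closed ball. -/
noncomputable def ballMeasure (n : ℕ) (R : ℝ) :
    Measure (Metric.closedBall (0 : EuclideanSpace ℝ (Fin n)) R) :=
  Measure.comap Subtype.val volume

instance : IsFiniteMeasure (ballMeasure N R) :=
  ⟨by
    rw [ballMeasure, comap_subtype_coe_apply measurableSet_closedBall, image_univ,
      Subtype.range_coe]
    exact measure_closedBall_lt_top⟩

/-- The interaction kernel on a closed ball. -/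
noncomputable def kernelMap (p κ r : ℝ) :
    C(Metric.closedBall (0 : E) R × Metric.closedBall (0 : E) R, ℝ) where
  toFun q := kern p κ r ((q.2 : E) - (q.1 : E))
  continuous_toFun := (continuous_kern p κ r).comp (by fun_prop)

lemma kernelMap_nonneg {p κ r : ℝ} (hκ : 0 < κ) (hr : 0 < r)
    (q : Metric.closedBall (0 : E) R × Metric.closedBall (0 : E) R) : 0 ≤ kernelMap p κ r q :=
  kern_nonneg hκ hr _

lemma kernelMap_symm (p κ r : ℝ) (x y : Metric.closedBall (0 : E) R) :
    kernelMap p κ r (x, y) = kernelMap p κ r (y, x) := by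
  simp only [kernelMap, ContinuousMap.coe_mk]
  rw [← kern_neg, neg_sub]

lemma nonlocalMap_neg {X : Type*} [MetricSpace X] [CompactSpace X] [MeasurableSpace X]
    [BorelSpace X] {μ : Measure X} [IsFiniteMeasure μ] {p : ℝ} (hp : 2 < p) (k : C(X × X, ℝ))
    (v : C(X, ℝ)) : nonlocalMap μ hp k (-v) = -nonlocalMap μ hp k v := by
  ext x
  simp only [nonlocalMap, ContinuousMap.coe_mk, ContinuousMap.neg_apply]
  rw [← integral_neg]
  congr 1; ext y
  rw [← mul_neg, ← signedPow_neg]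
  congr 2; ring

/-- Comparison of the operator on the ball with the one on the whole space, at points where the
test function touches from above. -/
lemma nonlocalMap_le_nonlocal {p κ r : ℝ} (hp : 2 < p) (hκ : 0 < κ) (hr : 0 < r)
    {v : C(Metric.closedBall (0 : E) R, ℝ)} {W : E → ℝ} (hW : Continuous W)
    {x : Metric.closedBall (0 : E) R} (hx : ‖(x : E)‖ + r ≤ R)
    (h : ∀ y : Metric.closedBall (0 : E) R, ‖(y : E) - (x : E)‖ < r → v y - W y ≤ v x - W x) :
    nonlocalMap (ballMeasure N R) hp (kernelMap p κ r) v x ≤ nonlocal p κ r W x := by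
  have h1 : nonlocal p κ r W x = ∫ y : Metric.closedBall (0 : E) R,
      kern p κ r ((y : E) - (x : E)) * signedPow p (W y - W x) ∂(ballMeasure N R) := by
    rw [ballMeasure, integral_subtype_comap (μ := volume) measurableSet_closedBall
      (fun y : E => kern p κ r (y - (x : E)) * signedPow p (W y - W x)), nonlocal]
    refine (setIntegral_eq_integral_of_forall_compl_eq_zero fun y hy => ?_).symm
    rw [kern_eq_zero hr, zero_mul]
    have : R < ‖y‖ := by simpa using hy
    have := norm_sub_norm_le y (x : E)
    linarith
  rw [h1]
  refine integral_mono (Continuous.integrable_of_compactSpace ?_)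
    (Continuous.integrable_of_compactSpace ?_) fun y => ?_
  · exact ((kernelMap p κ r).continuous.comp (by fun_prop)).mul
      ((continuous_signedPow hp).comp (by fun_prop))
  · exact ((continuous_kern p κ r).comp (by fun_prop)).mul
      ((continuous_signedPow hp).comp (by fun_prop))
  · simp only [kernelMap, ContinuousMap.coe_mk]
    by_cases hy : ‖(y : E) - (x : E)‖ < r
    · exact mul_le_mul_of_nonneg_left (monotone_signedPow hp (by linarith [h y hy]))
        (kern_nonneg hκ hr _)
    · rw [kern_eq_zero hr (not_lt.1 hy), zero_mul, zero_mul]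

/-- Quadratic barriers for nonlocal subsolutions. -/
lemma le_of_quadratic_barrier {p κ r : ℝ} (hp : 2 < p) (hκ : 0 < κ) (hr : 0 < r) (hr1 : r ≤ 1)
    {V V' : ℝ → C(Metric.closedBall (0 : E) R, ℝ)} {T C ρ a b c m K : ℝ} (hK : 0 ≤ K) (hb : 0 ≤ b)
    (hρ : 0 < ρ) (hρ1 : ρ ≤ 1) (hV : ∀ t ∈ Icc 0 T, HasDerivAt V (V' t) t)
    {x₀ : Metric.closedBall (0 : E) R} (hx₀ : ‖(x₀ : E)‖ + 2 ≤ R)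
    (hc : ∀ x : E, ‖x - (x₀ : E)‖ ≤ 1 →
      nonlocal p κ r (fun y => b * ‖y - (x₀ : E)‖ ^ 2) x ≤ c)
    (hVC : ∀ t ∈ Icc 0 T, ∀ x, V t x ≤ C) (hC : C ≤ a + b * ρ ^ 2)
    (h0 : ∀ x : Metric.closedBall (0 : E) R, ‖(x : E) - (x₀ : E)‖ < ρ → V 0 x ≤ a)
    (h0C : ∀ x, V 0 x ≤ C)
    (H : ∀ t ∈ Icc 0 T, ∀ x : Metric.closedBall (0 : E) R, ‖(x : E) - (x₀ : E)‖ < ρ → a < V t x →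
      V' t x ≤ nonlocalMap (ballMeasure N R) hp (kernelMap p κ r) (V t) x + m)
    (hm : c + m < K) :
    ∀ t ∈ Icc 0 T, V t x₀ ≤ a + K * t := by
  have hfar : ∀ x : Metric.closedBall (0 : E) R, ρ ≤ ‖(x : E) - (x₀ : E)‖ →
      C ≤ a + b * ‖(x : E) - (x₀ : E)‖ ^ 2 := fun x hx =>
    hC.trans (by gcongr)
  have hmax := le_add_mul_of_forall_max (V := V) (V' := V') (K := K) (T := T)
    (β := fun x => a + b * ‖(x : E) - (x₀ : E)‖ ^ 2) (by fun_prop) hV ?_ ?_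
  · intro t ht
    simpa using hmax t ht x₀
  · intro x
    by_cases hx : ‖(x : E) - (x₀ : E)‖ < ρ
    · have : 0 ≤ b * ‖(x : E) - (x₀ : E)‖ ^ 2 := by positivity
      linarith [h0 x hx]
    · exact (h0C x).trans (hfar x (not_lt.1 hx))
  · intro t ht x hβ hmx
    have ht' : t ∈ Icc 0 T := ⟨ht.1.le, ht.2⟩
    have hKt : 0 ≤ K * t := mul_nonneg hK ht.1.le
    have hx : ‖(x : E) - (x₀ : E)‖ < ρ := by
      by_contra hx
      linarith [hfar x (not_lt.1 hx), hVC t ht' x]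
    have hsq : 0 ≤ b * ‖(x : E) - (x₀ : E)‖ ^ 2 := by positivity
    have h1 := H t ht' x hx (by linarith)
    have h2 := norm_sub_norm_le (x : E) (x₀ : E)
    have h3 : nonlocalMap (ballMeasure N R) hp (kernelMap p κ r) (V t) x ≤
        nonlocal p κ r (fun y => a + b * ‖y - (x₀ : E)‖ ^ 2) x :=
      nonlocalMap_le_nonlocal hp hκ hr (by fun_prop) (by linarith) fun y _ => hmx y
    rw [nonlocal_const_add p κ r a (fun y => b * ‖y - (x₀ : E)‖ ^ 2)] at h3
    linarith [hc x (by linarith)]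

end BallModel

section InitialEnergy
open Filter Topology
variable {N : ℕ}
local notation "E" => EuclideanSpace ℝ (Fin N)

lemma abs_sub_rpow_le_integral {p : ℝ} (hp : 2 < p) {w : E → ℝ} (hw : ContDiff ℝ 1 w) (x z : E) :
    |w (x + z) - w x| ^ p ≤ ∫ s in Ioc (0 : ℝ) 1, |inner ℝ (gradient w (x + s • z)) z| ^ p := by
  have hgc : Continuous fun s : ℝ => inner ℝ (gradient w (x + s • z)) z := by
    have : Continuous (gradient w) :=
      (InnerProductSpace.toDual ℝ E).symm.continuous.comp (hw.continuous_fderiv one_ne_zero)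
    exact (this.comp (by fun_prop)).inner continuous_const
  have hd : ∀ s : ℝ, HasDerivAt (fun s : ℝ => w (x + s • z))
      (inner ℝ (gradient w (x + s • z)) z) s := by
    intro s
    have h1 := (hw.differentiable one_ne_zero (x + s • z)).hasGradientAt.hasFDerivAt
    have h2 : HasDerivAt (fun s : ℝ => x + s • z) z s := by
      simpa using ((hasDerivAt_id s).smul_const z).const_add x
    have h3 := h1.comp_hasDerivAt s h2
    rwa [InnerProductSpace.toDual_apply_apply] at h3
  have hftc : ∫ s in Ioc (0 : ℝ) 1, inner ℝ (gradient w (x + s • z)) z = w (x + z) - w x := by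
    rw [← intervalIntegral.integral_of_le zero_le_one,
      intervalIntegral.integral_eq_sub_of_hasDerivAt (fun s _ => hd s)
        (hgc.intervalIntegrable _ _)]
    simp
  have hpr : IsProbabilityMeasure (volume.restrict (Ioc (0 : ℝ) 1)) := ⟨by simp⟩
  have hi : ∀ g : ℝ → ℝ, Continuous g → Integrable g (volume.restrict (Ioc (0 : ℝ) 1)) :=
    fun g hg => (hg.integrableOn_Icc (a := 0) (b := 1)).mono_set Ioc_subset_Icc_self
  have hJ := (convexOn_rpow (p := p) (by linarith)).map_integral_le
    (μ := volume.restrict (Ioc (0 : ℝ) 1))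
    (f := fun s => |inner ℝ (gradient w (x + s • z)) z|)
    ((Real.continuous_rpow_const (by linarith)).continuousOn) isClosed_Ici
    (ae_of_all _ fun s => mem_Ici.2 (abs_nonneg _)) (hi _ hgc.abs)
    (hi _ ((Real.continuous_rpow_const (by linarith)).comp hgc.abs))
  refine le_trans ?_ hJ
  rw [← hftc]
  exact Real.rpow_le_rpow (abs_nonneg _) (abs_integral_le_integral_abs) (by linarith)

lemma lintegral_abs_sub_rpow_le {p : ℝ} (hp : 2 < p) {w : E → ℝ} (hw : ContDiff ℝ 1 w) (z : E) :
    ∫⁻ x, ENNReal.ofReal (|w (x + z) - w x| ^ p) ≤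
      ∫⁻ x, ENNReal.ofReal (|inner ℝ (gradient w x) z| ^ p) := by
  have hgr : Continuous (gradient w) :=
    (InnerProductSpace.toDual ℝ E).symm.continuous.comp (hw.continuous_fderiv one_ne_zero)
  have hc : Continuous fun q : E × ℝ => |inner ℝ (gradient w (q.1 + q.2 • z)) z| ^ p :=
    (Real.continuous_rpow_const (by linarith)).comp
      ((hgr.comp (by fun_prop)).inner continuous_const).abs
  calc ∫⁻ x, ENNReal.ofReal (|w (x + z) - w x| ^ p)
      ≤ ∫⁻ x, ∫⁻ s in Ioc (0 : ℝ) 1,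
          ENNReal.ofReal (|inner ℝ (gradient w (x + s • z)) z| ^ p) := by
        refine lintegral_mono fun x => ?_
        have hcx : Continuous fun s : ℝ => |inner ℝ (gradient w (x + s • z)) z| ^ p :=
          hc.comp (f := fun s : ℝ => (x, s)) (by fun_prop)
        rw [← ofReal_integral_eq_lintegral_ofReal
          ((hcx.integrableOn_Icc (a := 0) (b := 1)).mono_set Ioc_subset_Icc_self)
          (ae_of_all _ fun s => by positivity)]
        exact ENNReal.ofReal_le_ofReal (abs_sub_rpow_le_integral hp hw x z)
    _ = ∫⁻ s in Ioc (0 : ℝ) 1, ∫⁻ x,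
          ENNReal.ofReal (|inner ℝ (gradient w (x + s • z)) z| ^ p) :=
        lintegral_lintegral_swap (hc.measurable.ennreal_ofReal.aemeasurable)
    _ = ∫⁻ s in Ioc (0 : ℝ) 1, ∫⁻ x, ENNReal.ofReal (|inner ℝ (gradient w x) z| ^ p) := by
        congr 1; ext s
        exact lintegral_add_right_eq_self
          (fun x => ENNReal.ofReal (|inner ℝ (gradient w x) z| ^ p)) (s • z)
    _ = _ := by simp

lemma lintegral_kern_mul_abs_inner_rpow {p κ r : ℝ} (hp : 2 < p) (hκ : 0 < κ) (hr : 0 < r)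
    (hflux : ∀ q : E, flux p q = (κ * ‖q‖ ^ (p - 2)) • q) (q : E) :
    ∫⁻ z, ENNReal.ofReal (kern p κ r z) * ENNReal.ofReal (|inner ℝ q z| ^ p) =
      ENNReal.ofReal (2 * ‖q‖ ^ p) := by
  have hc : Continuous fun z : E => kern p κ r z * |inner ℝ q z| ^ p :=
    (continuous_kern p κ r).mul ((Real.continuous_rpow_const (by linarith)).comp
      (continuous_const.inner continuous_id).abs)
  have hs : HasCompactSupport fun z : E => kern p κ r z * |inner ℝ q z| ^ p := by
    refine HasCompactSupport.intro (isCompact_closedBall (0 : E) r) fun z hz => ?_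
    rw [kern_eq_zero hr, zero_mul]
    simpa using (not_le.1 (mt mem_closedBall_zero_iff.2 hz)).le
  have h := integral_kern_mul (p := p) (κ := κ) hr 0 (fun z : E => |inner ℝ q z| ^ p)
  simp only [sub_zero, zero_add, inner_smul_right, abs_mul, abs_of_pos hr,
    Real.mul_rpow hr.le (abs_nonneg _)] at h
  have h' : ∫ z : E, tent z * (r ^ p * |inner ℝ q z| ^ p) = r ^ p * (κ * ‖q‖ ^ p) := by
    rw [← integral_tent_mul_abs_inner_rpow hp hflux q, ← integral_const_mul]
    congr 1; ext z; ring
  have hrp : r ^ (-p) * r ^ p = 1 := by rw [← Real.rpow_add hr]; simp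
  have e : ∫ z : E, kern p κ r z * |inner ℝ q z| ^ p = 2 * ‖q‖ ^ p := by
    rw [h, h']
    calc _ = 2 / κ * κ * (r ^ (-p) * r ^ p) * ‖q‖ ^ p := by ring
      _ = _ := by rw [hrp]; field_simp
  rw [← e, ofReal_integral_eq_lintegral_ofReal (hc.integrable_of_hasCompactSupport hs)
    (ae_of_all _ fun z => mul_nonneg (kern_nonneg hκ hr z) (by positivity))]
  congr 1; ext z
  rw [ENNReal.ofReal_mul (kern_nonneg hκ hr z)]

/-- The nonlocal energy is controlled by the Dirichlet energy. -/
lemma lintegral_kern_le_lintegral_gradient {p κ r : ℝ} (hp : 2 < p) (hκ : 0 < κ) (hr : 0 < r)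
    (hflux : ∀ q : E, flux p q = (κ * ‖q‖ ^ (p - 2)) • q) {w : E → ℝ} (hw : ContDiff ℝ 1 w) :
    ∫⁻ x, ∫⁻ y, ENNReal.ofReal (kern p κ r (y - x)) * ENNReal.ofReal (|w x - w y| ^ p) ≤
      ∫⁻ x, ENNReal.ofReal (2 * ‖gradient w x‖ ^ p) := by
  have hgr : Continuous (gradient w) :=
    (InnerProductSpace.toDual ℝ E).symm.continuous.comp (hw.continuous_fderiv one_ne_zero)
  have hrp : Continuous fun s : ℝ => s ^ p := Real.continuous_rpow_const (by linarith)
  have hk := (continuous_kern p κ r : Continuous (kern p κ r : E → ℝ))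
  have hwc := hw.continuous
  calc ∫⁻ x, ∫⁻ y, ENNReal.ofReal (kern p κ r (y - x)) * ENNReal.ofReal (|w x - w y| ^ p)
      = ∫⁻ x, ∫⁻ z, ENNReal.ofReal (kern p κ r z) * ENNReal.ofReal (|w (x + z) - w x| ^ p) := by
        congr 1; ext x
        rw [← lintegral_add_left_eq_self _ x]
        congr 1; ext z
        rw [add_sub_cancel_left, abs_sub_comm]
    _ = ∫⁻ z, ∫⁻ x, ENNReal.ofReal (kern p κ r z) * ENNReal.ofReal (|w (x + z) - w x| ^ p) := by
        have m1 : Measurable fun q : E × E => ENNReal.ofReal (kern p κ r q.2) :=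
          (hk.comp continuous_snd).measurable.ennreal_ofReal
        have m2 : Measurable fun q : E × E => ENNReal.ofReal (|w (q.1 + q.2) - w q.1| ^ p) :=
          (hrp.comp (Continuous.abs (by fun_prop))).measurable.ennreal_ofReal
        exact lintegral_lintegral_swap (m1.mul m2).aemeasurable
    _ ≤ ∫⁻ z, ∫⁻ x, ENNReal.ofReal (kern p κ r z) *
          ENNReal.ofReal (|inner ℝ (gradient w x) z| ^ p) := by
        refine lintegral_mono fun z => ?_
        rw [lintegral_const_mul' _ _ ENNReal.ofReal_ne_top,
          lintegral_const_mul' _ _ ENNReal.ofReal_ne_top]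
        exact mul_le_mul_right (lintegral_abs_sub_rpow_le hp hw z) _
    _ = ∫⁻ x, ∫⁻ z, ENNReal.ofReal (kern p κ r z) *
          ENNReal.ofReal (|inner ℝ (gradient w x) z| ^ p) := by
        have m1 : Measurable fun q : E × E => ENNReal.ofReal (kern p κ r q.1) :=
          (hk.comp continuous_fst).measurable.ennreal_ofReal
        have m2 : Measurable fun q : E × E =>
            ENNReal.ofReal (|inner ℝ (gradient w q.2) q.1| ^ p) :=
          (hrp.comp (((hgr.comp continuous_snd).inner
            continuous_fst).abs)).measurable.ennreal_ofReal
        exact lintegral_lintegral_swap (m1.mul m2).aemeasurable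
    _ = _ := by
        congr 1; ext x
        exact lintegral_kern_mul_abs_inner_rpow hp hκ hr hflux _

lemma half_integral_kernelMap_le {p κ r R : ℝ} (hp : 2 < p) (hκ : 0 < κ) (hr : 0 < r)
    (hflux : ∀ q : E, flux p q = (κ * ‖q‖ ^ (p - 2)) • q) {w : E → ℝ} (hw : ContDiff ℝ 1 w)
    {A : ℝ} (hA0 : 0 ≤ A)
    (hA : ∫⁻ x, ENNReal.ofReal (‖gradient w x‖ ^ p) ≤ ENNReal.ofReal A) :
    1 / 2 * ∫ q : Metric.closedBall (0 : E) R × Metric.closedBall (0 : E) R,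
      kernelMap p κ r q * |w q.1 - w q.2| ^ p ∂((ballMeasure N R).prod (ballMeasure N R)) ≤ A := by
  have hrp : Continuous fun s : ℝ => s ^ p := Real.continuous_rpow_const (by linarith)
  have hwc := hw.continuous
  have hc : Continuous fun q : Metric.closedBall (0 : E) R × Metric.closedBall (0 : E) R =>
      kernelMap p κ r q * |w q.1 - w q.2| ^ p :=
    (kernelMap p κ r).continuous.mul (hrp.comp (Continuous.abs (by fun_prop)))
  have key : ENNReal.ofReal (∫ q : Metric.closedBall (0 : E) R × Metric.closedBall (0 : E) R,
      kernelMap p κ r q * |w q.1 - w q.2| ^ p ∂((ballMeasure N R).prod (ballMeasure N R))) ≤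
      ENNReal.ofReal (2 * A) := by
    rw [ofReal_integral_eq_lintegral_ofReal (Continuous.integrable_of_compactSpace hc)
      (ae_of_all _ fun q => mul_nonneg (kernelMap_nonneg hκ hr q) (by positivity)),
      lintegral_prod _ hc.measurable.ennreal_ofReal.aemeasurable]
    have hsub : ∀ g : E → ENNReal, ∫⁻ x : Metric.closedBall (0 : E) R, g x ∂(ballMeasure N R) ≤
        ∫⁻ x, g x := fun g => by
      rw [ballMeasure, lintegral_subtype_comap measurableSet_closedBall]
      exact setLIntegral_le_lintegral _ _
    calc _ ≤ ∫⁻ x : Metric.closedBall (0 : E) R, (∫⁻ y : E,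
            ENNReal.ofReal (kern p κ r (y - (x : E))) * ENNReal.ofReal (|w x - w y| ^ p)) ∂(ballMeasure N R) := by
          refine lintegral_mono fun x => ?_
          refine le_trans (le_of_eq ?_) (hsub _)
          congr 1; ext y
          rw [ENNReal.ofReal_mul (kernelMap_nonneg hκ hr _)]
          rfl
      _ ≤ ∫⁻ x, ∫⁻ y, ENNReal.ofReal (kern p κ r (y - x)) * ENNReal.ofReal (|w x - w y| ^ p) :=
          hsub fun x => ∫⁻ y, ENNReal.ofReal (kern p κ r (y - x)) *
            ENNReal.ofReal (|w x - w y| ^ p)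
      _ ≤ ∫⁻ x, ENNReal.ofReal (2 * ‖gradient w x‖ ^ p) :=
          lintegral_kern_le_lintegral_gradient hp hκ hr hflux hw
      _ ≤ _ := by
          simp only [ENNReal.ofReal_mul zero_le_two]
          rw [lintegral_const_mul' _ _ ENNReal.ofReal_ne_top]
          gcongr
  have := (ENNReal.ofReal_le_ofReal_iff (by linarith)).1 key
  linarith

end InitialEnergy

section InitialData
open Filter Topology

/-- A `C¹` function vanishing on `(-∞, δ]` and `2δ`-close to the identity on `[0, ∞)`. -/
noncomputable def softThreshold (δ s : ℝ) : ℝ := ∫ τ in (0 : ℝ)..s, min 1 (max 0 ((τ - δ) / δ))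

lemma hasDerivAt_softThreshold (δ s : ℝ) :
    HasDerivAt (softThreshold δ) (min 1 (max 0 ((s - δ) / δ))) s := by
  have hc : Continuous fun τ : ℝ => min 1 (max 0 ((τ - δ) / δ)) := by fun_prop
  exact hc.integral_hasStrictDerivAt 0 s |>.hasDerivAt

lemma contDiff_softThreshold (δ : ℝ) : ContDiff ℝ 1 (softThreshold δ) := by
  refine contDiff_one_iff_deriv.2 ⟨fun s => (hasDerivAt_softThreshold δ s).differentiableAt, ?_⟩
  rw [funext fun s => (hasDerivAt_softThreshold δ s).deriv]
  fun_prop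

lemma softThreshold_eq_zero {δ s : ℝ} (hδ : 0 < δ) (hs : s ≤ δ) : softThreshold δ s = 0 := by
  rw [softThreshold, intervalIntegral.integral_congr (g := fun _ => 0), intervalIntegral.integral_zero]
  intro τ hτ
  have : τ ≤ δ := by
    rcases le_total 0 s with h | h
    · rw [uIcc_of_le h] at hτ; exact hτ.2.trans hs
    · rw [uIcc_of_ge h] at hτ; exact hτ.2.trans hδ.le
  have h2 : (τ - δ) / δ ≤ 0 := div_nonpos_of_nonpos_of_nonneg (by linarith) hδ.le
  simp [max_eq_left h2]

lemma softThreshold_nonneg {δ s : ℝ} (hs : 0 ≤ s) : 0 ≤ softThreshold δ s :=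
  intervalIntegral.integral_nonneg hs fun _ _ => le_min zero_le_one (le_max_left _ _)

lemma softThreshold_le {δ s : ℝ} (hs : 0 ≤ s) : softThreshold δ s ≤ s := by
  have hc : Continuous fun τ : ℝ => min 1 (max 0 ((τ - δ) / δ)) := by fun_prop
  have := intervalIntegral.integral_mono_on (μ := volume) hs (hc.intervalIntegrable 0 s)
    (continuous_const.intervalIntegrable 0 s) (fun τ _ => min_le_left 1 (max 0 ((τ - δ) / δ)))
  simpa [softThreshold] using this

lemma sub_le_softThreshold {δ s : ℝ} (hδ : 0 < δ) (hs : 0 ≤ s) : s - 2 * δ ≤ softThreshold δ s := by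
  have hc : Continuous fun τ : ℝ => min 1 (max 0 ((τ - δ) / δ)) := by fun_prop
  rcases le_total s (2 * δ) with h | h
  · linarith [softThreshold_nonneg (δ := δ) hs]
  · have h1 := intervalIntegral.integral_add_adjacent_intervals
      (hc.intervalIntegrable 0 (2 * δ)) (hc.intervalIntegrable (μ := volume) (2 * δ) s)
    have h2 : ∫ τ in (2 * δ)..s, min 1 (max 0 ((τ - δ) / δ)) = s - 2 * δ := by
      rw [intervalIntegral.integral_congr (g := fun _ => (1 : ℝ))]
      · simp
      · intro τ hτ
        rw [uIcc_of_le h] at hτ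
        have : 1 ≤ (τ - δ) / δ := by rw [le_div_iff₀ hδ]; linarith [hτ.1]
        simp only
        rw [max_eq_right (by linarith), min_eq_left this]
    have h3 := softThreshold_nonneg (δ := δ) (s := 2 * δ) (by linarith)
    rw [softThreshold] at h3 ⊢
    linarith

variable {N : ℕ}
local notation "E" => EuclideanSpace ℝ (Fin N)

lemma norm_gradient (w : E → ℝ) (x : E) : ‖gradient w x‖ = ‖fderiv ℝ w x‖ :=
  (InnerProductSpace.toDual ℝ E).symm.norm_map _

lemma exists_norm_gradient_le {Ω : Set E} (hΩ : IsOpen Ω) (hb : Bornology.IsBounded Ω)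
    {u₀ : E → ℝ} (hu : ContDiffOn ℝ 1 u₀ (closure Ω)) : ∃ C, ∀ x ∈ Ω, ‖gradient u₀ x‖ ≤ C := by
  have key : ∃ C, ∀ x ∈ closure Ω ∩ Ω, ‖gradient u₀ x‖ ≤ C := by
    refine hb.isCompact_closure.induction_on
      (p := fun s => ∃ C, ∀ x ∈ s ∩ Ω, ‖gradient u₀ x‖ ≤ C) ⟨0, by simp⟩ ?_ ?_ ?_
    · rintro s t hst ⟨C, hC⟩
      exact ⟨C, fun x hx => hC x ⟨hst hx.1, hx.2⟩⟩
    · rintro s t ⟨C, hC⟩ ⟨C', hC'⟩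
      refine ⟨max C C', ?_⟩
      rintro x ⟨hx | hx, hxΩ⟩
      · exact (hC x ⟨hx, hxΩ⟩).trans (le_max_left _ _)
      · exact (hC' x ⟨hx, hxΩ⟩).trans (le_max_right _ _)
    · intro x hx
      have h0 : ContDiffWithinAt ℝ (0 + 1) u₀ (closure Ω) x := by simpa using hu x hx
      obtain ⟨v, hv, hvs, -, f', hf', hcf⟩ :=
        (contDiffWithinAt_succ_iff_hasFDerivWithinAt' (by simp)).1 h0
      rw [insert_eq_of_mem hx] at hv hvs
      have hct : ContinuousWithinAt f' (closure Ω) x :=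
        hcf.continuousWithinAt
      refine ⟨v ∩ {y | ‖f' y‖ ≤ ‖f' x‖ + 1}, Filter.inter_mem hv
        (hct.norm.eventually (eventually_le_nhds (lt_add_one _))), ‖f' x‖ + 1, ?_⟩
      rintro y ⟨⟨hyv, hy⟩, hyΩ⟩
      have h1 : HasFDerivAt u₀ (f' y) y := (hf' y hyv).hasFDerivAt
        (mem_of_superset (hΩ.mem_nhds hyΩ) subset_closure)
      rw [norm_gradient, h1.fderiv]
      exact hy
  obtain ⟨C, hC⟩ := key
  exact ⟨C, fun x hx => hC x ⟨subset_closure hx, hx⟩⟩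

lemma integrableOn_norm_gradient_rpow {p : ℝ} (hp : 2 < p) {Ω : Set E} (hΩ : IsOpen Ω)
    (hb : Bornology.IsBounded Ω) {u₀ : E → ℝ} (hu : ContDiffOn ℝ 1 u₀ (closure Ω)) :
    IntegrableOn (fun x => ‖gradient u₀ x‖ ^ p) Ω := by
  obtain ⟨C, hC⟩ := exists_norm_gradient_le hΩ hb hu
  have hcont : ContinuousOn (fun x => ‖gradient u₀ x‖ ^ p) Ω := by
    simp only [norm_gradient]
    exact (Real.continuous_rpow_const (by linarith)).comp_continuousOn
      ((hu.mono subset_closure).continuousOn_fderiv_of_isOpen hΩ le_rfl).norm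
  have : IsFiniteMeasure (volume.restrict Ω) :=
    isFiniteMeasure_restrict.2 hb.measure_lt_top.ne
  refine Integrable.of_bound (hcont.aestronglyMeasurable hΩ.measurableSet) (C ^ p) ?_
  refine (ae_restrict_iff' hΩ.measurableSet).2 (ae_of_all _ fun x hx => ?_)
  rw [Real.norm_of_nonneg (by positivity)]
  exact Real.rpow_le_rpow (norm_nonneg _) (hC x hx) (by linarith)

lemma contDiff_softThreshold_comp {δ : ℝ} (hδ : 0 < δ) {Ω : Set E} (hΩ : IsOpen Ω)
    {w : E → ℝ} (hw : Continuous w) (hw0 : ∀ x ∉ Ω, w x = 0) (hw1 : ContDiffOn ℝ 1 w Ω) :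
    ContDiff ℝ 1 fun x => softThreshold δ (w x) := by
  refine contDiff_iff_contDiffAt.2 fun x => ?_
  by_cases hx : x ∈ Ω
  · exact (contDiff_softThreshold δ).contDiffAt.comp x (hw1.contDiffAt (hΩ.mem_nhds hx))
  · have : (fun x => softThreshold δ (w x)) =ᶠ[𝓝 x] fun _ => 0 := by
      have h1 : ∀ᶠ y in 𝓝 x, w y < δ := hw.continuousAt.eventually_lt continuousAt_const
        (by rw [hw0 x hx]; exact hδ)
      exact h1.mono fun y hy => softThreshold_eq_zero hδ hy.le
    exact contDiffAt_const.congr_of_eventuallyEq this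

lemma norm_gradient_softThreshold_comp_le {δ : ℝ} (hδ : 0 < δ) {Ω : Set E} (hΩ : IsOpen Ω)
    {w : E → ℝ} (hw : Continuous w) (hw0 : ∀ x ∉ Ω, w x = 0) (hw1 : ContDiffOn ℝ 1 w Ω) (x : E) :
    ‖gradient (fun x => softThreshold δ (w x)) x‖ ≤ Ω.indicator (fun x => ‖gradient w x‖) x := by
  simp only [norm_gradient]
  by_cases hx : x ∈ Ω
  · rw [indicator_of_mem hx]
    have h1 : HasFDerivAt w (fderiv ℝ w x) x :=
      ((hw1.contDiffAt (hΩ.mem_nhds hx)).differentiableAt one_ne_zero).hasFDerivAt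
    have h2 := (hasDerivAt_softThreshold δ (w x)).comp_hasFDerivAt x h1
    have h3 : fderiv ℝ (fun x => softThreshold δ (w x)) x =
      (min 1 (max 0 ((w x - δ) / δ))) • fderiv ℝ w x := h2.fderiv
    rw [h3, norm_smul, Real.norm_of_nonneg (le_min zero_le_one (le_max_left _ _))]
    exact mul_le_of_le_one_left (norm_nonneg _) (min_le_left _ _)
  · rw [indicator_of_notMem hx]
    have : (fun x => softThreshold δ (w x)) =ᶠ[𝓝 x] fun _ => 0 := by
      have h1 : ∀ᶠ y in 𝓝 x, w y < δ := hw.continuousAt.eventually_lt continuousAt_const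
        (by rw [hw0 x hx]; exact hδ)
      exact h1.mono fun y hy => softThreshold_eq_zero hδ hy.le
    rw [this.fderiv_eq]
    simp

lemma lintegral_gradient_softThreshold_comp_le {p δ : ℝ} (hp : 2 < p) (hδ : 0 < δ) {Ω : Set E}
    (hΩ : IsOpen Ω) (hb : Bornology.IsBounded Ω) {u₀ w : E → ℝ}
    (hu : ContDiffOn ℝ 1 u₀ (closure Ω)) (hw : Continuous w) (hw0 : ∀ x ∉ Ω, w x = 0)
    (hwu : ∀ x ∈ Ω, w x = u₀ x) :
    ∫⁻ x, ENNReal.ofReal (‖gradient (fun x => softThreshold δ (w x)) x‖ ^ p) ≤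
      ENNReal.ofReal (∫ x in Ω, ‖gradient u₀ x‖ ^ p) := by
  have hw1 : ContDiffOn ℝ 1 w Ω := (hu.mono subset_closure).congr hwu
  rw [ofReal_integral_eq_lintegral_ofReal (integrableOn_norm_gradient_rpow hp hΩ hb hu)
    (ae_of_all _ fun x => by positivity), ← lintegral_indicator hΩ.measurableSet]
  refine lintegral_mono fun x => ?_
  have h := norm_gradient_softThreshold_comp_le hδ hΩ hw hw0 hw1 x
  by_cases hx : x ∈ Ω
  · rw [indicator_of_mem hx] at h ⊢
    have e : gradient w x = gradient u₀ x := by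
      have : w =ᶠ[𝓝 x] u₀ := mem_of_superset (hΩ.mem_nhds hx) hwu
      rw [gradient, gradient, this.fderiv_eq]
    rw [e] at h
    exact ENNReal.ofReal_le_ofReal (Real.rpow_le_rpow (norm_nonneg _) h (by linarith))
  · rw [indicator_of_notMem hx] at h ⊢
    rw [le_antisymm h (norm_nonneg _), Real.zero_rpow (by linarith)]
    simp

end InitialData

section Approximation
open Filter Topology
variable {N : ℕ}
local notation "E" => EuclideanSpace ℝ (Fin N)

lemma exists_boundary_layer {Ω : Set E} (hΩ : IsOpen Ω) (hb : Bornology.IsBounded Ω)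
    (hc : Ωᶜ.Nonempty) {U : E → ℝ → ℝ} (hU : Continuous fun q : E × ℝ => U q.1 q.2)
    (hUΩ : ∀ x ∉ Ω, ∀ t, U x t = 0) {T₁ : ℝ}
    (hcl : ∀ x t, ∃ s ∈ Icc 0 T₁, U x t = U x s) {δ : ℝ} (hδ : 0 < δ) :
    ∃ ρ > 0, ∀ x t, Metric.infDist x Ωᶜ ≤ ρ → U x t ≤ δ := by
  set K : Set E := Prod.fst '' ((closure Ω ×ˢ Icc 0 T₁) ∩ {q : E × ℝ | δ ≤ U q.1 q.2}) with hK
  have hKc : IsCompact K :=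
    ((hb.isCompact_closure.prod isCompact_Icc).inter_right
      (isClosed_le continuous_const hU)).image continuous_fst
  have hKΩ : K ⊆ Ω := by
    rintro _ ⟨⟨x, t⟩, ⟨-, hxt⟩, rfl⟩
    by_contra hx
    have : δ ≤ U x t := hxt
    rw [hUΩ x hx t] at this
    linarith
  obtain ⟨e, he, hsub⟩ := hKc.exists_thickening_subset_open hΩ hKΩ
  refine ⟨e / 2, half_pos he, fun x t hx => ?_⟩
  by_contra! hxt
  have hxΩ : x ∈ Ω := by
    by_contra h
    rw [hUΩ x h t] at hxt
    linarith
  obtain ⟨s, hs, hts⟩ := hcl x t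
  have hxK : x ∈ K := ⟨(x, s), ⟨⟨subset_closure hxΩ, hs⟩, by
    show δ ≤ U x s
    linarith⟩, rfl⟩
  have : e ≤ Metric.infDist x Ωᶜ := by
    refine (Metric.le_infDist hc).2 fun {y} hy => ?_
    by_contra! hlt
    refine hy (hsub (Metric.mem_thickening_iff.2 ⟨x, hxK, ?_⟩))
    rwa [dist_comm]
  linarith

lemma exists_modulus_of_support {Ω : Set E} (hb : Bornology.IsBounded Ω) {w : E → ℝ}
    (hw : Continuous w) (hw0 : ∀ x ∉ Ω, w x = 0) {δ : ℝ} (hδ : 0 < δ) :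
    ∃ ρ > 0, ∀ x y : E, ‖y - x‖ < ρ → |w y - w x| ≤ δ := by
  have hs : HasCompactSupport w := HasCompactSupport.intro hb.isCompact_closure fun x hx =>
    hw0 x fun h => hx (subset_closure h)
  obtain ⟨ρ, hρ, H⟩ := Metric.uniformContinuous_iff.1 (hs.uniformContinuous_of_continuous hw) δ hδ
  refine ⟨ρ, hρ, fun x y hxy => ?_⟩
  have := H (a := y) (b := x) (by rwa [dist_eq_norm])
  rw [Real.dist_eq] at this
  exact this.le

/-- A cut-off equal to `c` where the distance to `Ωᶜ` is at most `2ρ` and to `0` where it is at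
least `3ρ`. -/
noncomputable def layerDamping (Ω : Set E) (c ρ R : ℝ) : C(Metric.closedBall (0 : E) R, ℝ) where
  toFun x := c * max 0 (min 1 (3 - Metric.infDist (x : E) Ωᶜ / ρ))
  continuous_toFun := by
    have : Continuous fun x : Metric.closedBall (0 : E) R => Metric.infDist (x : E) Ωᶜ :=
      (Metric.continuous_infDist_pt _).comp continuous_subtype_val
    fun_prop

variable {R : ℝ}

lemma layerDamping_nonneg {Ω : Set E} {c ρ : ℝ} (hc : 0 ≤ c) (x : Metric.closedBall (0 : E) R) :
    0 ≤ layerDamping Ω c ρ R x :=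
  mul_nonneg hc (le_max_left _ _)

lemma layerDamping_le {Ω : Set E} {c ρ : ℝ} (hc : 0 ≤ c) (x : Metric.closedBall (0 : E) R) :
    layerDamping Ω c ρ R x ≤ c :=
  mul_le_of_le_one_right hc (max_le zero_le_one (min_le_left _ _))

lemma layerDamping_eq {Ω : Set E} {c ρ : ℝ} (hρ : 0 < ρ) {x : Metric.closedBall (0 : E) R}
    (hx : Metric.infDist (x : E) Ωᶜ ≤ 2 * ρ) : layerDamping Ω c ρ R x = c := by
  have h : Metric.infDist (x : E) Ωᶜ / ρ ≤ 2 := by rwa [div_le_iff₀ hρ]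
  simp only [layerDamping, ContinuousMap.coe_mk]
  rw [min_eq_left (by linarith), max_eq_right zero_le_one, mul_one]

lemma layerDamping_eq_zero {Ω : Set E} {c ρ : ℝ} (hρ : 0 < ρ) {x : Metric.closedBall (0 : E) R}
    (hx : 3 * ρ ≤ Metric.infDist (x : E) Ωᶜ) : layerDamping Ω c ρ R x = 0 := by
  have h : 3 ≤ Metric.infDist (x : E) Ωᶜ / ρ := by rwa [le_div_iff₀ hρ]
  simp only [layerDamping, ContinuousMap.coe_mk]
  rw [max_eq_left (min_le_iff.2 (Or.inr (by linarith))), mul_zero]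

/-- The solutions of the nonlocal evolutions satisfy barrier estimates at the boundary and at the
initial time. -/
lemma layer_estimates {p κ r : ℝ} (hp : 2 < p) (hκ : 0 < κ) (hr : 0 < r) (hr1 : r ≤ 1)
    {Ω : Set E} {T C G c ρ δ lam K : ℝ} (hC : 0 < C) (hρ : 0 < ρ) (hρ1 : ρ ≤ 1) (hδ : 0 < δ)
    (hlam : 0 ≤ lam) (hclam : c + (G - lam * δ) < 0) (hK0 : 0 ≤ K) (hKc : c + G + lam * C < K)
    (hG0 : 0 ≤ G)
    (hc : ∀ x₀ x : E, ‖x - x₀‖ ≤ 1 → nonlocal p κ r (fun y => C / ρ ^ 2 * ‖y - x₀‖ ^ 2) x ≤ c)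
    {w : E → ℝ} (hw : ∀ x y : E, ‖y - x‖ < ρ → |w y - w x| ≤ δ)
    (hw0 : ∀ x, Metric.infDist x Ωᶜ ≤ 2 * ρ → w x = 0)
    (hwC : ∀ x, w x ∈ Icc 0 C)
    {v g : ℝ → C(Metric.closedBall (0 : E) R, ℝ)} (hv0 : ∀ x, v 0 x = w x)
    (hg : ∀ t x, g t x ∈ Icc 0 G)
    (hv : ∀ t ∈ Icc 0 T, HasDerivAt v (nonlocalMap (ballMeasure N R) hp (kernelMap p κ r) (v t) -
      layerDamping Ω lam ρ R * v t + g t) t)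
    (hvC : ∀ t ∈ Icc 0 T, ∀ x, v t x ∈ Icc 0 C)
    {x₀ : Metric.closedBall (0 : E) R} (hx₀ : ‖(x₀ : E)‖ + 2 ≤ R) :
    ∀ t ∈ Icc 0 T, (Metric.infDist (x₀ : E) Ωᶜ ≤ ρ → v t x₀ ≤ δ) ∧
      |v t x₀ - w x₀| ≤ δ + K * t := by
  have hb : 0 ≤ C / ρ ^ 2 := by positivity
  have hbρ : C / ρ ^ 2 * ρ ^ 2 = C := by field_simp
  have hw₀ := hwC (x₀ : E)
  intro t ht
  have m0 : (0 : ℝ) ∈ Icc 0 T := ⟨le_rfl, ht.1.trans ht.2⟩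
  refine ⟨fun hd => ?_, abs_sub_le_iff.2 ⟨?_, ?_⟩⟩
  · have hd2 : ∀ x : Metric.closedBall (0 : E) R, ‖(x : E) - (x₀ : E)‖ < ρ →
        Metric.infDist (x : E) Ωᶜ ≤ 2 * ρ := fun x hx => by
      have := Metric.infDist_le_infDist_add_dist (s := Ωᶜ) (x := (x : E)) (y := (x₀ : E))
      rw [dist_eq_norm] at this
      linarith
    have := le_of_quadratic_barrier hp hκ hr hr1 (a := δ) (m := G - lam * δ) le_rfl hb hρ hρ1 hv
      hx₀ (hc x₀) (fun t ht x => (hvC t ht x).2) (by linarith)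
      (fun x hx => by rw [hv0, hw0 _ (hd2 x hx)]; exact hδ.le) (fun x => (hvC 0 m0 x).2) ?_
      hclam t ht
    · linarith
    · intro s hs x hx hx1
      have h1 := (hg s x).2
      have h2 : lam * δ ≤ lam * v s x := mul_le_mul_of_nonneg_left hx1.le hlam
      simp only [ContinuousMap.add_apply, ContinuousMap.sub_apply, ContinuousMap.mul_apply,
        layerDamping_eq hρ (hd2 x hx)]
      linarith
  · have := le_of_quadratic_barrier hp hκ hr hr1 (a := w x₀ + δ) (m := G) hK0 hb hρ hρ1 hv
      hx₀ (hc x₀) (fun t ht x => (hvC t ht x).2) (by linarith [hw₀.1])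
      (fun x hx => by rw [hv0]; linarith [(abs_le.1 (hw _ _ hx)).2])
      (fun x => (hvC 0 m0 x).2) ?_ (by nlinarith) t ht
    · linarith
    · intro s hs x hx hx1
      have h1 := (hg s x).2
      have h2 := mul_nonneg (layerDamping_nonneg (Ω := Ω) (ρ := ρ) hlam x) (hvC s hs x).1
      simp only [ContinuousMap.add_apply, ContinuousMap.sub_apply, ContinuousMap.mul_apply]
      linarith
  · have := le_of_quadratic_barrier hp hκ hr hr1 (V := fun t => -v t) (a := -w x₀ + δ)
      (m := lam * C) (C := 0) hK0 hb hρ hρ1 (fun s hs => (hv s hs).neg)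
      hx₀ (hc x₀) (fun t ht x => by simpa using (hvC t ht x).1) (by linarith [hw₀.2])
      (fun x hx => by
        simp only [ContinuousMap.neg_apply]
        rw [hv0]; linarith [(abs_le.1 (hw _ _ hx)).1])
      (fun x => by simpa using (hvC 0 m0 x).1) ?_ (by linarith) t ht
    · simp only [ContinuousMap.neg_apply] at this
      linarith
    · intro s hs x hx hx1
      have h1 := (hg s x).1
      have h2 : layerDamping Ω lam ρ R x * v s x ≤ lam * C :=
        mul_le_mul (layerDamping_le hlam x) (hvC s hs x).2 (hvC s hs x).1 hlam
      simp only [nonlocalMap_neg, ContinuousMap.add_apply, ContinuousMap.sub_apply,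
        ContinuousMap.mul_apply, ContinuousMap.neg_apply]
      linarith

end Approximation

section ApproximationTheorem
open Filter Topology
variable {N : ℕ} {R : ℝ}
local notation "E" => EuclideanSpace ℝ (Fin N)

/-- A retraction onto the closed ball (continuous on the ball only). -/
noncomputable def toBall (hR : 0 ≤ R) (x : E) : Metric.closedBall (0 : E) R :=
  open Classical in
  if h : x ∈ Metric.closedBall (0 : E) R then ⟨x, h⟩ else ⟨0, Metric.mem_closedBall_self hR⟩

lemma toBall_coe (hR : 0 ≤ R) (x : Metric.closedBall (0 : E) R) : toBall hR (x : E) = x := by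
  rw [toBall, dif_pos x.2]

lemma continuousOn_toBall (hR : 0 ≤ R) : ContinuousOn (toBall hR) (Metric.closedBall (0 : E) R) := by
  rw [Topology.IsInducing.subtypeVal.continuousOn_iff]
  refine continuousOn_id.congr fun x hx => ?_
  simp only [Function.comp_apply, toBall, dif_pos hx, id]

lemma pLaplacian_neg (p : ℝ) (w : E → ℝ) (x : E) :
    pLaplacian p (fun y => -w y) x = -pLaplacian p w x := by
  have h (y : E) : gradient (fun y => -w y) y = -gradient w y := by
    simp only [gradient]
    rw [fderiv_fun_neg, map_neg]
  simp only [pLaplacian, h, norm_neg, smul_neg, fderiv_fun_neg, neg_apply, map_neg,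
    Finset.sum_neg_distrib]

/-- A classical solution vanishing outside `Ω` is uniformly approximated by solutions of damped
nonlocal evolutions. -/
lemma exists_nonlocal_approximation {p κ : ℝ} (hp : 2 < p) (hκ : 0 < κ)
    (hflux : ∀ q : E, flux p q = (κ * ‖q‖ ^ (p - 2)) • q) {Ω : Set E} (hΩ : IsOpen Ω)
    (hb : Bornology.IsBounded Ω) (hne : Ωᶜ.Nonempty) {f : ℝ → ℝ} (hf : Continuous f)
    {U : E → ℝ → ℝ} (hU : Continuous fun q : E × ℝ => U q.1 q.2)
    (hUΩ : ∀ x ∉ Ω, ∀ t, U x t = 0) {T T₁ C₀ G : ℝ} (hT : 0 < T) (hT₁ : T < T₁)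
    (hcl : ∀ x t, ∃ s ∈ Icc 0 T₁, U x t = U x s) (hC₀ : 0 ≤ C₀) (hUC : ∀ x t, U x t ∈ Icc 0 C₀)
    (hG0 : 0 ≤ G) (hfG : ∀ s ∈ Icc 0 C₀, f s ∈ Icc 0 G)
    (hU2 : ∀ x ∈ Ω, ∀ s ∈ Ioo 0 T₁, ContDiffAt ℝ 2 (fun y => U y s) x)
    (hUt : ∀ x ∈ Ω, ∀ s ∈ Ioo 0 T₁,
      HasDerivAt (U x) (pLaplacian p (fun y => U y s) x + f (U x s)) s)
    (hR : 2 ≤ R) (hRΩ : ∀ x ∈ closure Ω, ‖x‖ + 2 ≤ R)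
    {g : ℝ → C(Metric.closedBall (0 : E) R, ℝ)} (hg : Continuous g)
    (hgU : ∀ t x, g t x = f (U x t)) {δ : ℝ} (hδ : 0 < δ) :
    ∃ r > 0, ∃ (χ : C(Metric.closedBall (0 : E) R, ℝ)) (v : ℝ → C(Metric.closedBall (0 : E) R, ℝ)),
      (∀ x, 0 ≤ χ x) ∧ (∀ x, v 0 x = softThreshold δ (U x 0)) ∧ (∀ x, χ x * v 0 x ^ 2 = 0) ∧
      (∀ t ∈ Icc 0 T, HasDerivAt v (nonlocalMap (ballMeasure N R) hp (kernelMap p κ r) (v t) -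
        χ * v t + g t) t) ∧
      (∀ t ∈ Icc 0 T, ∀ x, v t x ∈ Icc 0 (C₀ + (G + 1) * T)) ∧
      ∀ t ∈ Icc 0 T, ∀ x : Metric.closedBall (0 : E) R, (x : E) ∈ Ω → |U x t - v t x| ≤ 10 * δ := by
  have hR0 : 0 ≤ R := by linarith
  set C := C₀ + (G + 1) * T with hCdef
  have hC : 0 < C := by positivity
  have hC₀C : C₀ ≤ C := by
    have : 0 ≤ (G + 1) * T := by positivity
    linarith
  have hgG : ∀ t x, g t x ∈ Icc 0 G := fun t x => by rw [hgU]; exact hfG _ (hUC _ _)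
  -- the initial datum
  set w : E → ℝ := fun x => softThreshold δ (U x 0) with hwdef
  have hU0c : Continuous fun x => U x 0 := hU.comp (f := fun x : E => (x, (0 : ℝ))) (by fun_prop)
  have hwc : Continuous w := (contDiff_softThreshold δ).continuous.comp hU0c
  have hwsmall : ∀ x, U x 0 ≤ δ → w x = 0 := fun x hx => softThreshold_eq_zero hδ hx
  have hwC : ∀ x, w x ∈ Icc 0 C₀ := fun x =>
    ⟨softThreshold_nonneg (hUC x 0).1, (softThreshold_le (hUC x 0).1).trans (hUC x 0).2⟩
  have hwU : ∀ x, w x ≤ U x 0 ∧ U x 0 - 2 * δ ≤ w x := fun x =>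
    ⟨softThreshold_le (hUC x 0).1, sub_le_softThreshold hδ (hUC x 0).1⟩
  -- the length scales
  obtain ⟨ρ₁, hρ₁, hlayer⟩ := exists_boundary_layer hΩ hb hne hU hUΩ hcl hδ
  obtain ⟨ρ₂, hρ₂, hmod⟩ := exists_modulus_of_support hb hwc
    (fun x hx => hwsmall x (by rw [hUΩ x hx]; exact hδ.le)) hδ
  obtain ⟨ρ, hρ, hρ1, h3ρ, hρ2⟩ : ∃ ρ > 0, ρ ≤ 1 ∧ 3 * ρ ≤ ρ₁ ∧ ρ ≤ ρ₂ :=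
    ⟨min 1 (min (ρ₁ / 3) ρ₂), by positivity, min_le_left _ _, by
      have : min 1 (min (ρ₁ / 3) ρ₂) ≤ ρ₁ / 3 := (min_le_right _ _).trans (min_le_left _ _)
      linarith, (min_le_right _ _).trans (min_le_right _ _)⟩
  obtain ⟨c, hc⟩ := exists_nonlocal_quadratic_le hp hκ hflux (C / ρ ^ 2)
  set lam := (|c| + G + 1) / δ with hlamdef
  have hlam : 0 ≤ lam := by positivity
  have hlamδ : lam * δ = |c| + G + 1 := by rw [hlamdef]; field_simp
  set K := |c| + G + lam * C + 1 with hKdef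
  have hK : 0 < K := by positivity
  obtain ⟨τ₁, hτ₁, htime⟩ := exists_modulus_snd hU hb.isCompact_closure T hδ
  obtain ⟨τ, hτ, hττ, hKτ⟩ : ∃ τ > 0, τ ≤ τ₁ ∧ K * τ ≤ δ :=
    ⟨min τ₁ (δ / K), by positivity, min_le_left _ _,
      (mul_le_mul_of_nonneg_left (min_le_right _ _) hK.le).trans (by field_simp; rfl)⟩
  obtain ⟨r₁, hr₁, hcr⟩ := mem_nhdsGT_iff_exists_Ioo_subset.1 hc
  set r₀ := min r₁ 1 with hr₀def
  have hr₀ : 0 < r₀ := lt_min hr₁ one_pos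
  have hIoo : ∀ r ∈ Ioo 0 r₀, 0 < r ∧ r ≤ 1 ∧ r ∈ Ioo 0 r₁ := fun r hr =>
    ⟨hr.1, hr.2.le.trans (min_le_right _ _), hr.1, hr.2.trans_le (min_le_left _ _)⟩
  set χ := layerDamping Ω lam ρ R with hχdef
  have hχ : ∀ x, 0 ≤ χ x := layerDamping_nonneg hlam
  -- the evolutions
  have hex : ∀ r ∈ Ioo 0 r₀, ∃ v : ℝ → C(Metric.closedBall (0 : E) R, ℝ),
      (∀ x, v 0 x = w x) ∧
      (∀ t ∈ Icc 0 T, HasDerivAt v (nonlocalMap (ballMeasure N R) hp (kernelMap p κ r) (v t) -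
        χ * v t + g t) t) ∧
      ∀ t ∈ Icc 0 T, ∀ x, v t x ∈ Icc 0 C := by
    intro r hr
    obtain ⟨v, hv0, hv, hvn, hvc⟩ := exists_nonlocal_evolution (μ := ballMeasure N R) hp
      (k := kernelMap p κ r) (kernelMap_nonneg hκ hr.1) hχ hg (fun t x => (hgG t x).1)
      (fun t x => (hgG t x).2) hG0 (v₀ := ⟨fun x => w x, hwc.comp continuous_subtype_val⟩)
      (fun x => (hwC x).1) hC₀ (fun x => (hwC x).2) hT
    exact ⟨v, fun x => by rw [hv0]; rfl, hv, fun t ht x => ⟨hvn t ht x, hvc t ht x⟩⟩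
  choose! v hv0 hv hvC using hex
  have hest : ∀ r ∈ Ioo 0 r₀, ∀ x₀ : Metric.closedBall (0 : E) R, (x₀ : E) ∈ closure Ω →
      ∀ t ∈ Icc 0 T, (Metric.infDist (x₀ : E) Ωᶜ ≤ ρ → v r t x₀ ≤ δ) ∧
      |v r t x₀ - w x₀| ≤ δ + K * t := by
    intro r hr x₀ hx₀
    obtain ⟨h0, h1, h2⟩ := hIoo r hr
    refine layer_estimates hp hκ h0 h1 (c := c) (G := G) hC hρ hρ1 hδ hlam ?_ hK.le ?_ hG0
      (hcr h2) (fun x y hxy => hmod x y (hxy.trans_le hρ2))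
      (fun x hx => hwsmall x (hlayer x 0 (by linarith))) (fun x => ⟨(hwC x).1, (hwC x).2.trans hC₀C⟩)
      (hv0 r hr) hgG (hv r hr) (hvC r hr) (hRΩ _ hx₀)
    · rw [hlamδ]; linarith [le_abs_self c]
    · linarith [le_abs_self c]
  have hmem : ∀ x ∈ closure Ω, ∃ y : Metric.closedBall (0 : E) R, (y : E) = x := fun x hx =>
    ⟨⟨x, by have := hRΩ x hx; simp; linarith⟩, rfl⟩
  have hVc : ∀ r ∈ Ioo 0 r₀, ContinuousOn (fun q : E × ℝ => v r q.2 (toBall hR0 q.1))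
      (closure Ω ×ˢ Icc 0 T) := by
    intro r hr
    have h1 : ContinuousOn (fun q : E × ℝ => v r q.2) (closure Ω ×ˢ Icc 0 T) :=
      ContinuousOn.comp (fun t ht => (hv r hr t ht).continuousAt.continuousWithinAt)
        continuousOn_snd fun q hq => hq.2
    have h2 : ContinuousOn (fun q : E × ℝ => toBall hR0 q.1) (closure Ω ×ˢ Icc 0 T) :=
      (continuousOn_toBall hR0).comp continuousOn_fst fun q hq => by
        have := hRΩ _ hq.1; simp; linarith
    exact (ContinuousEval.continuous_eval (F := C(Metric.closedBall (0 : E) R, ℝ))).comp_continuousOn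
      (h1.prodMk h2)
  have hinit : ∀ r ∈ Ioo 0 r₀, ∀ x : Metric.closedBall (0 : E) R, (x : E) ∈ closure Ω →
      ∀ t ∈ Icc 0 T, t ≤ τ → |v r t x - U x t| ≤ 6 * δ := by
    intro r hr x hx t ht htτ
    have h1 := abs_le.1 ((hest r hr x hx t ht).2)
    have h2 := abs_lt.1 (htime x hx t ht 0 ⟨le_rfl, hT.le⟩ (by
      rw [sub_zero, abs_of_nonneg ht.1]; exact htτ.trans hττ))
    have h3 := hwU x
    have h4 : K * t ≤ δ := (mul_le_mul_of_nonneg_left htτ hK.le).trans hKτ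
    exact abs_le.2 ⟨by linarith, by linarith⟩
  have hfU : Continuous fun q : E × ℝ => f (U q.1 q.2) := hf.comp hU
  have hvd : ∀ r ∈ Ioo 0 r₀, ∀ x : Metric.closedBall (0 : E) R, ∀ t ∈ Icc 0 T,
      HasDerivAt (fun s => v r s x) (nonlocalMap (ballMeasure N R) hp (kernelMap p κ r) (v r t) x -
        χ x * v r t x + f (U x t)) t := by
    intro r hr x t ht
    have := ContinuousMap.hasDerivAt_apply (hv r hr t ht) x
    simpa only [ContinuousMap.add_apply, ContinuousMap.sub_apply, ContinuousMap.mul_apply, hgU]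
      using this
  have hvabs : ∀ r ∈ Ioo 0 r₀, ∀ x : Metric.closedBall (0 : E) R, ∀ t ∈ Icc 0 T,
      |v r t x| ≤ C := fun r hr x t ht => by
    rw [abs_of_nonneg (hvC r hr t ht x).1]
    exact (hvC r hr t ht x).2
  have hUabs : ∀ x t, |U x t| ≤ C := fun x t => by
    rw [abs_of_nonneg (hUC x t).1]
    exact (hUC x t).2.trans hC₀C
  have hup := eventually_le_of_subsolution hp hκ hflux hb (Ψ := U) (h := fun x t => f (U x t))
    hU hfU hT hT₁ hC hδ hρ hτ hr₀ hU2 hUt (V := fun r x t => v r t (toBall hR0 x))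
    (V' := fun r x t => nonlocalMap (ballMeasure N R) hp (kernelMap p κ r) (v r t) (toBall hR0 x) -
        χ (toBall hR0 x) * v r t (toBall hR0 x) + f (U x t)) hVc ?_ ?_ ?_ ?_ ?_ ?_
  have hlo := eventually_le_of_subsolution hp hκ hflux hb (Ψ := fun x t => -U x t)
    (h := fun x t => -f (U x t)) hU.neg hfU.neg hT hT₁ hC hδ hρ hτ hr₀
    (fun x hx s hs => (hU2 x hx s hs).neg) ?_ (V := fun r x t => -v r t (toBall hR0 x))
    (V' := fun r x t => -(nonlocalMap (ballMeasure N R) hp (kernelMap p κ r) (v r t)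
      (toBall hR0 x) - χ (toBall hR0 x) * v r t (toBall hR0 x) + f (U x t)))
    (fun r hr => (hVc r hr).neg) ?_ ?_ ?_ ?_ ?_ ?_
  · obtain ⟨r, ⟨hrup, hrlo⟩, hr⟩ := ((hup.and hlo).and (Ioo_mem_nhdsGT hr₀)).exists
    refine ⟨r, hr.1, χ, v r, hχ, hv0 r hr, fun x => ?_, hv r hr, hvC r hr, fun t ht x hx => ?_⟩
    · rw [hv0 r hr]
      by_cases hx : 3 * ρ ≤ Metric.infDist (x : E) Ωᶜ
      · rw [hχdef, layerDamping_eq_zero hρ hx, zero_mul]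
      · rw [hwsmall x (hlayer x 0 (by linarith))]; simp
    · have h1 := hrup x (subset_closure hx) t ht
      have h2 := hrlo x (subset_closure hx) t ht
      rw [toBall_coe] at h1 h2
      exact abs_le.2 ⟨by linarith, by linarith⟩
  · intro x hx s hs
    rw [pLaplacian_neg, ← neg_add]
    exact (hUt x hx s hs).neg
  · intro r hr x hx t ht
    obtain ⟨x, rfl⟩ := hmem x (subset_closure hx)
    simp only [toBall_coe]
    exact (hvd r hr x t ht).neg
  · intro r hr x hx t ht
    rw [abs_neg]
    exact hvabs r hr _ t ht
  · intro x hx s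
    rw [abs_neg]
    exact hUabs x s
  · intro r hr x hx t ht s hs w hw hmax
    obtain ⟨h0, h1, -⟩ := hIoo r hr
    obtain ⟨x, rfl⟩ := hmem x (subset_closure hx)
    simp only [toBall_coe] at hs hmax ⊢
    have hUs : δ < U x s := by linarith [(hvC r hr t ht x).1]
    have hfar : 3 * ρ ≤ Metric.infDist (x : E) Ωᶜ := by
      by_contra hlt
      linarith [hlayer x s (by linarith)]
    have hχ0 : χ x = 0 := layerDamping_eq_zero hρ hfar
    have hle := nonlocalMap_le_nonlocal hp hκ h0 (v := -v r t) hw (x := x)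
      (by linarith [hRΩ x (subset_closure hx)]) fun y hy => by
        have := hmax y (by rwa [Metric.mem_ball, dist_eq_norm])
        simpa only [toBall_coe, ContinuousMap.neg_apply] using this
    rw [nonlocalMap_neg, ContinuousMap.neg_apply] at hle
    rw [hχ0, zero_mul]
    linarith
  · intro r hr x hx hxρ t ht s
    linarith [hlayer x s (by linarith), (hvC r hr t ht (toBall hR0 x)).1]
  · intro r hr x hx t ht htτ
    obtain ⟨x, rfl⟩ := hmem x hx
    have := (abs_le.1 (hinit r hr x hx t ht htτ)).1
    simp only [toBall_coe]
    linarith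
  · intro r hr x hx t ht
    obtain ⟨x, rfl⟩ := hmem x (subset_closure hx)
    simp only [toBall_coe]
    exact hvd r hr x t ht
  · exact fun r hr x hx t ht => hvabs r hr _ t ht
  · exact fun x hx s => hUabs x s
  · intro r hr x hx t ht s hs w hw hmax
    obtain ⟨h0, h1, -⟩ := hIoo r hr
    obtain ⟨x, rfl⟩ := hmem x (subset_closure hx)
    simp only [toBall_coe] at hs hmax ⊢
    have hle := nonlocalMap_le_nonlocal hp hκ h0 (v := v r t) hw (x := x)
      (by linarith [hRΩ x (subset_closure hx)]) fun y hy => by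
        have := hmax y (by rwa [Metric.mem_ball, dist_eq_norm])
        simpa only [toBall_coe] using this
    have := mul_nonneg (hχ x) (hvC r hr t ht x).1
    linarith
  · intro r hr x hx hxρ t ht s
    obtain ⟨x, rfl⟩ := hmem x hx
    simp only [toBall_coe]
    linarith [(hest r hr x hx t ht).1 hxρ, (hUC x s).1]
  · intro r hr x hx t ht htτ
    obtain ⟨x, rfl⟩ := hmem x hx
    have := (abs_le.1 (hinit r hr x hx t ht htτ)).2
    simpa only [toBall_coe] using this

end ApproximationTheorem

section TimeBound
open Filter Topology
variable {N : ℕ} {R : ℝ}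
local notation "E" => EuclideanSpace ℝ (Fin N)

lemma setIntegral_ballMeasure {Ω : Set E} (hΩ : MeasurableSet Ω)
    (hR : Ω ⊆ Metric.closedBall 0 R) (g : E → ℝ) :
    ∫ x in (Subtype.val ⁻¹' Ω : Set (Metric.closedBall (0 : E) R)), g x ∂(ballMeasure N R) =
      ∫ x in Ω, g x := by
  rw [ballMeasure, ← (MeasurableEmbedding.subtype_coe measurableSet_closedBall).setIntegral_map,
    map_comap_subtype_coe measurableSet_closedBall, Measure.restrict_restrict hΩ,
    inter_eq_self_of_subset_left hR]

lemma measureReal_ballMeasure {Ω : Set E} (hΩ : MeasurableSet Ω)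
    (hR : Ω ⊆ Metric.closedBall 0 R) :
    (ballMeasure N R).real (Subtype.val ⁻¹' Ω) = volume.real Ω := by
  simpa using setIntegral_ballMeasure hΩ hR fun _ => 1

lemma eventually_mul_le (a : ℝ) {b : ℝ} (hb : 0 < b) : ∀ᶠ δ in 𝓝[>] (0 : ℝ), a * δ ≤ b := by
  have h : Tendsto (fun δ : ℝ => a * δ) (𝓝 0) (𝓝 0) :=
    (continuous_const.mul continuous_id).tendsto' _ _ (mul_zero a)
  exact ((h.mono_left nhdsWithin_le_nhds).eventually_lt_const hb).mono fun _ h => h.le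

/-- The concavity estimate for a classical solution vanishing outside `Ω`. -/
lemma time_le_of_classical_solution {p : ℝ} (hp : 2 < p) (hN : 1 ≤ N) {Ω : Set E} (hΩ : IsOpen Ω)
    (hb : Bornology.IsBounded Ω) {f F : ℝ → ℝ} (hf : Continuous f) (hf0 : f 0 = 0)
    (hfnn : ∀ s, 0 ≤ s → 0 ≤ f s) (hF : ∀ s, HasDerivAt F (f s) s) (hF0 : F 0 = 0) {γ : ℝ}
    (hγ : 0 < γ) (hCp : ∀ s, 0 ≤ s → p * F s ≤ s * f s + γ) {u₀ : E → ℝ}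
    (hu₀ : ContDiffOn ℝ 1 u₀ (closure Ω)) {J : ℝ}
    (hJ : J = -(1 / p) * (∫ x in Ω, ‖gradient u₀ x‖ ^ p) + ∫ x in Ω, (F (u₀ x) - γ))
    (hJ0 : 0 < J) {U : E → ℝ → ℝ} (hU : Continuous fun q : E × ℝ => U q.1 q.2)
    (hUΩ : ∀ x ∉ Ω, ∀ t, U x t = 0) {T T₁ C₀ : ℝ} (hT : 0 < T) (hT₁ : T < T₁)
    (hcl : ∀ x t, ∃ s ∈ Icc 0 T₁, U x t = U x s) (hC₀ : 0 ≤ C₀) (hUC : ∀ x t, U x t ∈ Icc 0 C₀)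
    (hU0 : ∀ x ∈ Ω, U x 0 = u₀ x)
    (hU2 : ∀ x ∈ Ω, ∀ s ∈ Ioo 0 T₁, ContDiffAt ℝ 2 (fun y => U y s) x)
    (hUt : ∀ x ∈ Ω, ∀ s ∈ Ioo 0 T₁,
      HasDerivAt (U x) (pLaplacian p (fun y => U y s) x + f (U x s)) s) :
    p * (p - 2) * (J / 2) * T ≤ ∫ x in Ω, u₀ x ^ 2 := by
  obtain ⟨κ, hκ, hflux⟩ := exists_flux_eq (N := N) hp hN
  have hΩm := hΩ.measurableSet
  have hne : Ωᶜ.Nonempty := by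
    rw [nonempty_compl]
    rintro rfl
    have : Nonempty (Fin N) := ⟨⟨0, hN⟩⟩
    exact NormedSpace.unbounded_univ ℝ E hb
  obtain ⟨R₁, hR₁⟩ := hb.closure.exists_norm_le
  set R := max 2 (R₁ + 2) with hRdef
  have hR : 2 ≤ R := le_max_left _ _
  have hRΩ : ∀ x ∈ closure Ω, ‖x‖ + 2 ≤ R := fun x hx =>
    (by linarith [hR₁ x hx] : ‖x‖ + 2 ≤ R₁ + 2).trans (le_max_right _ _)
  have hΩR : Ω ⊆ Metric.closedBall 0 R := fun x hx => by
    have := hRΩ x (subset_closure hx)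
    simp only [Metric.mem_closedBall, dist_zero_right]
    linarith
  set m := volume.real Ω with hm
  have hm0 : 0 ≤ m := measureReal_nonneg
  -- bounds on the nonlinearity
  obtain ⟨G, hG0, hfG⟩ : ∃ G, 0 ≤ G ∧ ∀ s ∈ Icc 0 C₀, f s ∈ Icc 0 G := by
    obtain ⟨G, hG⟩ := (isCompact_Icc (a := (0 : ℝ)) (b := C₀)).exists_bound_of_continuousOn
      hf.continuousOn
    exact ⟨G, (norm_nonneg _).trans (hG 0 ⟨le_rfl, hC₀⟩), fun s hs =>
      ⟨hfnn s hs.1, (le_abs_self _).trans (hG s hs)⟩⟩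
  set C := C₀ + (G + 1) * T with hCdef
  have hC₀C : C₀ ≤ C := by
    have : 0 ≤ (G + 1) * T := by positivity
    linarith
  have hC : 0 ≤ C := hC₀.trans hC₀C
  obtain ⟨L, hL⟩ := (isCompact_Icc (a := (0 : ℝ)) (b := C)).exists_bound_of_continuousOn
    hf.continuousOn
  have hL0 : 0 ≤ L := (norm_nonneg _).trans (hL 0 ⟨le_rfl, hC⟩)
  have hFlip : ∀ a ∈ Icc 0 C, ∀ b ∈ Icc 0 C, |F b - F a| ≤ L * |b - a| := fun a ha b hb =>
    (convex_Icc 0 C).norm_image_sub_le_of_norm_hasDerivWithin_le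
      (fun s _ => (hF s).hasDerivWithinAt) hL ha hb
  -- the small parameters
  have hb1 : 0 < (p - 1) * γ / 2 := by
    have : 0 < p - 1 := by linarith
    positivity
  obtain ⟨ω, ⟨hω1, hω2⟩, hω⟩ := (((eventually_mul_le 1 (b := 1 / 2) (by norm_num)).and
    (eventually_mul_le (2 * p * (T + L * C)) hb1)).and self_mem_nhdsWithin).exists
  have huc := (isCompact_Icc (a := (0 : ℝ)) (b := C)).uniformContinuousOn_of_continuous
    hf.continuousOn
  obtain ⟨δ₁, hδ₁, hmod⟩ := Metric.uniformContinuousOn_iff_le.1 huc ω hω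
  obtain ⟨δ, ⟨⟨hδ1, hδ2⟩, hδ3⟩, hδ⟩ := ((((eventually_mul_le 10 hδ₁).and
    (eventually_mul_le ((p * L + L) * 10) hb1)).and
    (eventually_mul_le (2 * L * m) (half_pos hJ0))).and self_mem_nhdsWithin).exists
  -- the approximation
  let fU : C(ℝ × Metric.closedBall (0 : E) R, ℝ) :=
    ⟨fun q => f (U q.2 q.1), hf.comp (hU.comp (f := fun q : ℝ × Metric.closedBall (0 : E) R =>
      ((q.2 : E), q.1)) (by fun_prop))⟩
  have hg : Continuous fU.curry := fU.curry.continuous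
  obtain ⟨r, hr, χ, v, hχ, hv0, hχ0, hv, hvC, hUv⟩ := exists_nonlocal_approximation hp hκ hflux hΩ hb
    hne hf hU hUΩ hT hT₁ hcl hC₀ hUC hG0 hfG hU2 hUt hR hRΩ hg (fun t x => rfl) hδ
  set w : E → ℝ := fun x => softThreshold δ (U x 0) with hw
  have hU0c : Continuous fun x => U x 0 := hU.comp (f := fun x : E => (x, (0 : ℝ))) (by fun_prop)
  have hw1 : ContDiff ℝ 1 w := contDiff_softThreshold_comp hδ hΩ hU0c (fun x hx => hUΩ x hx 0)
    ((hu₀.mono subset_closure).congr hU0)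
  have hwC : ∀ x, w x ∈ Icc 0 C := fun x =>
    ⟨softThreshold_nonneg (hUC x 0).1,
      (softThreshold_le (hUC x 0).1).trans ((hUC x 0).2.trans hC₀C)⟩
  have hwU : ∀ x, |w x - U x 0| ≤ 2 * δ := fun x => by
    have h1 := softThreshold_le (δ := δ) (hUC x 0).1
    have h2 := sub_le_softThreshold hδ (hUC x 0).1
    exact abs_le.2 ⟨by linarith, by linarith⟩
  have hw0 : ∀ x ∉ Ω, w x = 0 := fun x hx => softThreshold_eq_zero hδ (by rw [hUΩ x hx]; exact hδ.le)
  have hFc : Continuous F := continuous_iff_continuousAt.2 fun s => (hF s).continuousAt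
  have hint : ∀ {h : E → ℝ}, Continuous h → IntegrableOn h Ω := fun hh =>
    (hh.continuousOn.integrableOn_compact hb.isCompact_closure).mono_set subset_closure
  have hA0 : 0 ≤ ∫ x in Ω, ‖gradient u₀ x‖ ^ p := integral_nonneg fun x => by positivity
  have hgrad := half_integral_kernelMap_le (R := R) hp hκ hr hflux hw1 hA0
    (lintegral_gradient_softThreshold_comp_le hp hδ hΩ hb hu₀ hU0c (fun x hx => hUΩ x hx 0) hU0)
  have hχint : ∫ x, χ x * v 0 x ^ 2 ∂(ballMeasure N R) = 0 := by simp only [hχ0, integral_zero]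
  have hFw : ∫ x in Ω, F (u₀ x) ≤ (∫ x in Ω, F (w x)) + 2 * L * m * δ := by
    have h1 : ∫ x in Ω, F (u₀ x) = ∫ x in Ω, F (U x 0) :=
      setIntegral_congr_fun hΩm fun x hx => by simp only [hU0 x hx]
    have h2 : ∫ x in Ω, F (U x 0) ≤ ∫ x in Ω, (F (w x) + 2 * L * δ) := by
      refine setIntegral_mono (hint (hFc.comp hU0c))
        (hint ((hFc.comp hw1.continuous).add continuous_const)) fun x => ?_
      have h3 := hFlip _ (hwC x) _ ⟨(hUC x 0).1, (hUC x 0).2.trans hC₀C⟩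
      have h4 := mul_le_mul_of_nonneg_left (hwU x) hL0
      rw [abs_sub_comm] at h4
      have := (abs_le.1 (h3.trans h4)).2
      show F (U x 0) ≤ F (w x) + 2 * L * δ
      linarith
    have h5 : IntegrableOn (fun x => F (w x)) Ω := hint (hFc.comp hw1.continuous)
    rw [integral_add h5 (hint continuous_const),
      setIntegral_const, smul_eq_mul, ← hm] at h2
    linarith
  have hJ' : J = -(1 / p) * (∫ x in Ω, ‖gradient u₀ x‖ ^ p) + (∫ x in Ω, F (u₀ x)) - γ * m := by
    have h1 : IntegrableOn (fun x => F (u₀ x)) Ω :=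
      (hint (hFc.comp hU0c)).congr_fun (fun x hx => by simp only [Function.comp_apply, hU0 x hx]) hΩm
    rw [hJ, integral_sub h1 (hint continuous_const), setIntegral_const, smul_eq_mul, ← hm]
    ring
  have hv0w : ∀ x : Metric.closedBall (0 : E) R, v 0 x = w x := hv0
  have hmain := time_le_of_evolution (μ := ballMeasure N R) hp (k := kernelMap p κ r)
    (kernelMap_symm p κ r) (kernelMap_nonneg hκ hr) hχ
    (S := (Subtype.val ⁻¹' Ω : Set (Metric.closedBall (0 : E) R)))
    (hΩm.preimage measurable_subtype_coe) hf hF hF0 hCp hC hL0 hL (U := fun t x => U x t) hT hg hv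
    (fun _ _ _ _ => rfl)
    (fun t _ x hx => by
      show f (U x t) = 0
      rw [hUΩ x hx, hf0])
    hvC (fun t _ x _ => ⟨(hUC x t).1, (hUC x t).2.trans hC₀C⟩) hUv
    (fun a ha b hb hab => hmod a ha b hb (hab.trans hδ1)) hω.le (by linarith)
    (by
      rw [measureReal_ballMeasure hΩm hΩR, ← hm]
      have h1 := mul_le_mul_of_nonneg_right hω2 hm0
      have h2 := mul_le_mul_of_nonneg_right hδ2 hm0
      linarith)
    (half_pos hJ0)
    (by
      rw [measureReal_ballMeasure hΩm hΩR, ← hm, hχint]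
      simp only [hv0w]
      rw [setIntegral_ballMeasure hΩm hΩR fun x => F (w x)]
      have h1 := mul_le_mul_of_nonneg_left hgrad (by positivity : 0 ≤ 1 / p)
      linarith)
  refine hmain.trans ?_
  simp only [hv0w]
  rw [← setIntegral_eq_integral_of_forall_compl_eq_zero
    (s := (Subtype.val ⁻¹' Ω : Set (Metric.closedBall (0 : E) R)))
    (fun x hx => by rw [hw0 x hx]; norm_num), setIntegral_ballMeasure hΩm hΩR fun x => w x ^ 2]
  have hAU : ∫ x in Ω, u₀ x ^ 2 = ∫ x in Ω, U x 0 ^ 2 :=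
    setIntegral_congr_fun hΩm fun x hx => by simp only [hU0 x hx]
  rw [hAU]
  refine setIntegral_mono (hint (hw1.continuous.pow 2)) (hint (hU0c.pow 2)) fun x => ?_
  exact pow_le_pow_left₀ (hwC x).1 (softThreshold_le (hUC x 0).1) 2

/-- Cut-off in time and extension by zero of a function vanishing on the lateral boundary. -/
lemma exists_extension {Ω : Set E} (hb : Bornology.IsBounded Ω) {u : E → ℝ → ℝ} {T T₁ : ℝ}
    (hT₁ : 0 < T₁) (hT : T₁ < T)
    (hu : ContinuousOn (fun q : E × ℝ => u q.1 q.2) (closure Ω ×ˢ Ico 0 T))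
    (hnn : ∀ x ∈ closure Ω, ∀ t ∈ Ico 0 T, 0 ≤ u x t)
    (hbd : ∀ x ∈ frontier Ω, ∀ t ∈ Ico 0 T, u x t = 0) :
    ∃ U : E → ℝ → ℝ, (Continuous fun q : E × ℝ => U q.1 q.2) ∧ (∀ x ∉ Ω, ∀ t, U x t = 0) ∧
      (∀ x t, ∃ s ∈ Icc 0 T₁, U x t = U x s) ∧ (∃ C, 0 ≤ C ∧ ∀ x t, U x t ∈ Icc 0 C) ∧
      ∀ x ∈ Ω, ∀ t ∈ Icc 0 T₁, U x t = u x t := by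
  classical
  set P : ℝ → ℝ := fun t => max 0 (min t T₁) with hP
  have hPc : Continuous P := by fun_prop
  have hPm : ∀ t, P t ∈ Icc 0 T₁ := fun t => ⟨le_max_left _ _, max_le hT₁.le (min_le_right _ _)⟩
  have hPT : ∀ t, P t ∈ Ico 0 T := fun t => ⟨(hPm t).1, (hPm t).2.trans_lt hT⟩
  have hPid : ∀ t ∈ Icc 0 T₁, P t = t := fun t ht => by
    rw [hP]; simp only [min_eq_left ht.2, max_eq_right ht.1]
  obtain ⟨C, hC⟩ := (hb.isCompact_closure.prod (isCompact_Icc (a := (0 : ℝ)) (b := T₁))).exists_bound_of_continuousOn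
    (hu.mono (prod_mono_right fun t ht => ⟨ht.1, ht.2.trans_lt hT⟩))
  refine ⟨fun x t => Ω.indicator (fun x => u x (P t)) x, ?_, fun x hx t => indicator_of_notMem hx _,
    fun x t => ⟨P t, hPm t, by simp only [hPid _ (hPm t)]⟩, ⟨max C 0, le_max_right _ _, fun x t => ?_⟩,
    fun x hx t ht => by simp only [indicator_of_mem hx, hPid t ht]⟩
  · have : (fun q : E × ℝ => Ω.indicator (fun x => u x (P q.2)) q.1) =
        (Ω ×ˢ univ).indicator fun q : E × ℝ => u q.1 (P q.2) := by
      ext q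
      by_cases hq : q.1 ∈ Ω <;> simp [hq, indicator]
    rw [this]
    refine continuous_indicator ?_ ?_
    · rintro ⟨x, t⟩ hx
      rw [frontier_prod_univ_eq] at hx
      exact hbd x hx.1 _ (hPT t)
    · rw [closure_prod_eq]
      exact hu.comp (f := fun q : E × ℝ => (q.1, P q.2)) (by fun_prop) fun q hq => ⟨hq.1, hPT q.2⟩
  · by_cases hx : x ∈ Ω
    · simp only [indicator_of_mem hx]
      exact ⟨hnn x (subset_closure hx) _ (hPT t),
        ((le_abs_self _).trans (hC (x, P t) ⟨subset_closure hx, hPm t⟩)).trans (le_max_left _ _)⟩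
    · simp only [indicator_of_notMem hx]
      exact ⟨le_rfl, le_max_right _ _⟩

end TimeBound

/-- Blow-up (with explicit bound on the blow-up time) for nonnegative solutions of
`u_t = Δ_p u + f(u)` (`p > 2`) with Dirichlet boundary conditions under the condition `(C_p)'`:
`p F(u) ≤ u f(u) + γ`, and initial energy `J_p(0) > 0`; no eigenvalue hypothesis is needed. -/
theorem blowup_pLaplacian_condition_Cp'
    {N : ℕ} (hN : 1 ≤ N) (p : ℝ) (hp : 2 < p)
    (Ω : Set (EuclideanSpace ℝ (Fin N)))
    (hΩopen : IsOpen Ω) (hΩbdd : Bornology.IsBounded Ω) (hΩne : Ω.Nonempty)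
    (f : ℝ → ℝ) (hfcont : Continuous f) (hf0 : f 0 = 0)
    (hfpos : ∀ u : ℝ, 0 < u → 0 < f u)
    (F : ℝ → ℝ) (hF : ∀ u : ℝ, F u = ∫ s in (0:ℝ)..u, f s)
    (γ : ℝ) (hγ : 0 < γ)
    (hCp' : ∀ u : ℝ, 0 < u → p * F u ≤ u * f u + γ)
    (u₀ : EuclideanSpace ℝ (Fin N) → ℝ)
    (hu₀C1 : ContDiffOn ℝ 1 u₀ (closure Ω))
    (hu₀nonneg : ∀ x ∈ closure Ω, 0 ≤ u₀ x)
    (hu₀netriv : ∃ x ∈ closure Ω, u₀ x ≠ 0)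
    (hu₀bdry : ∀ x ∈ frontier Ω, u₀ x = 0)
    (J0 : ℝ)
    (hJ0def : J0 = -(1/p) * (∫ x in Ω, ‖gradient u₀ x‖ ^ p)
      + ∫ x in Ω, (F (u₀ x) - γ))
    (hJ0pos : 0 < J0)
    (σ M : ℝ)
    (hσdef : σ = Real.sqrt (p / 2) - 1)
    (hMdef : M = (p / (p - 2)) * (1 + Real.sqrt (p / 2))
      * (∫ x in Ω, (u₀ x) ^ 2) ^ 2 / (2 * p * J0)) :
    ∀ T : ℝ, 0 < T →
    ∀ u : EuclideanSpace ℝ (Fin N) → ℝ → ℝ,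
      -- continuity on cl(Ω) × [0,T)
      ContinuousOn (fun q : EuclideanSpace ℝ (Fin N) × ℝ => u q.1 q.2)
        (closure Ω ×ˢ Set.Ico 0 T) →
      -- sufficiently smooth in space on Ω × (0,T)
      (∀ t ∈ Set.Ioo (0:ℝ) T, ContDiffOn ℝ 2 (fun x => u x t) Ω) →
      -- sufficiently smooth in time on Ω × (0,T)
      (∀ x ∈ Ω, ContDiffOn ℝ 1 (u x) (Set.Ioo (0:ℝ) T)) →
      -- nonnegativity
      (∀ x ∈ closure Ω, ∀ t ∈ Set.Ico (0:ℝ) T, 0 ≤ u x t) →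
      -- the PDE on Ω × (0,T)
      (∀ x ∈ Ω, ∀ t ∈ Set.Ioo (0:ℝ) T,
        deriv (u x) t = pLaplacian p (fun y => u y t) x + f (u x t)) →
      -- Dirichlet boundary condition
      (∀ x ∈ frontier Ω, ∀ t ∈ Set.Ico (0:ℝ) T, u x t = 0) →
      -- initial condition
      (∀ x ∈ closure Ω, u x 0 = u₀ x) →
      T ≤ M / (σ * ∫ x in Ω, (u₀ x) ^ 2) := by
  intro T hT u hu hux hut hunn hpde hbd hu0
  have hΩm := hΩopen.measurableSet
  have hFd : ∀ s, HasDerivAt F (f s) s := by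
    rw [funext hF]
    exact fun s => (hfcont.integral_hasStrictDerivAt 0 s).hasDerivAt
  have hF0 : F 0 = 0 := by rw [hF, intervalIntegral.integral_same]
  have hCp : ∀ s, 0 ≤ s → p * F s ≤ s * f s + γ := by
    intro s hs
    rcases hs.eq_or_lt with rfl | hs
    · rw [hF0]; linarith
    · exact hCp' s hs
  have hfnn : ∀ s, 0 ≤ s → 0 ≤ f s := by
    intro s hs
    rcases hs.eq_or_lt with rfl | hs
    · rw [hf0]
    · exact (hfpos s hs).le
  have hpos : 0 < ∫ x in Ω, u₀ x ^ 2 := by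
    obtain ⟨x, hx, hx0⟩ := hu₀netriv
    have hxΩ : x ∈ Ω := by
      by_contra h
      exact hx0 (hu₀bdry x ⟨hx, fun h' => h (interior_subset h')⟩)
    have hint : IntegrableOn (fun x => u₀ x ^ 2) Ω :=
      ((hu₀C1.continuousOn.pow 2).integrableOn_compact hΩbdd.isCompact_closure).mono_set
        subset_closure
    rw [setIntegral_pos_iff_support_of_nonneg_ae (Filter.Eventually.of_forall fun x => sq_nonneg _)
      hint]
    have hopen : IsOpen ((Function.support fun x => u₀ x ^ 2) ∩ Ω) := by
      have := ((hu₀C1.mono subset_closure).continuousOn.pow 2).isOpen_inter_preimage hΩopen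
        (isOpen_compl_singleton (x := (0 : ℝ)))
      rwa [inter_comm] at this
    exact hopen.measure_pos volume ⟨x, pow_ne_zero 2 hx0, hxΩ⟩
  have hbound : ∀ T' ∈ Ioo 0 T, p * (p - 2) * (J0 / 2) * T' ≤ ∫ x in Ω, u₀ x ^ 2 := by
    rintro T' ⟨hT'0, hT'⟩
    obtain ⟨T₁, hT'₁, hT₁⟩ := exists_between hT'
    have hT₁0 := hT'0.trans hT'₁
    obtain ⟨U, hU, hUΩ, hcl, ⟨C, hC, hUC⟩, hUu⟩ := exists_extension hΩbdd hT₁0 hT₁ hu hunn hbd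
    have hnear : ∀ x ∈ Ω, ∀ s ∈ Ioo 0 T₁, (fun y => U y s) =ᶠ[nhds x] fun y => u y s :=
      fun x hx s hs => by
        filter_upwards [hΩopen.mem_nhds hx] with y hy using hUu y hy s (Ioo_subset_Icc_self hs)
    refine time_le_of_classical_solution hp hN hΩopen hΩbdd hfcont hf0 hfnn hFd hF0 hγ hCp hu₀C1
      hJ0def hJ0pos hU hUΩ hT'0 hT'₁ hcl hC hUC
      (fun x hx => (hUu x hx 0 ⟨le_rfl, hT₁0.le⟩).trans (hu0 x (subset_closure hx))) ?_ ?_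
    · intro x hx s hs
      exact ((hux s ⟨hs.1, hs.2.trans hT₁⟩).contDiffAt (hΩopen.mem_nhds hx)).congr_of_eventuallyEq
        (hnear x hx s hs)
    · intro x hx s hs
      have hsT : s ∈ Ioo 0 T := ⟨hs.1, hs.2.trans hT₁⟩
      rw [pLaplacian_congr (hnear x hx s hs), hUu x hx s (Ioo_subset_Icc_self hs),
        ← hpde x hx s hsT]
      refine HasDerivAt.congr_of_eventuallyEq ?_ (f := u x) ?_
      · exact (((hut x hx).contDiffAt (isOpen_Ioo.mem_nhds hsT)).differentiableAt
          one_ne_zero).hasDerivAt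
      · filter_upwards [isOpen_Ioo.mem_nhds hs] with t ht using hUu x hx t (Ioo_subset_Icc_self ht)
  set A := ∫ x in Ω, u₀ x ^ 2 with hA
  have hp2 : 0 < p - 2 := by linarith
  set q := √(p / 2) with hq
  have hq1 : 1 < q := by
    rw [hq, Real.lt_sqrt zero_le_one]; linarith
  have hqq : q ^ 2 = p / 2 := Real.sq_sqrt (by linarith)
  have hσ : 0 < σ := by rw [hσdef]; linarith
  set D := p * (p - 2) * (J0 / 2) with hD
  have hD0 : 0 < D := by positivity
  have hTD : T * D ≤ A := by
    rw [← le_div_iff₀ hD0]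
    refine le_of_forall_lt_imp_le_of_dense fun T' hT' => ?_
    rcases le_or_gt T' 0 with h | h
    · exact h.trans (by positivity)
    · rw [le_div_iff₀ hD0, mul_comm]
      exact hbound T' ⟨h, hT'⟩
  have hM : M = (1 + q) * A ^ 2 / (2 * (p - 2) * J0) := by
    rw [hMdef]
    field_simp
  have hq2 : 4 * σ ≤ p * (1 + q) := by
    have : p = 2 * q ^ 2 := by rw [hqq]; ring
    rw [hσdef, this]
    nlinarith [mul_pos (show 0 < q by linarith) (show 0 < q - 1 by linarith)]
  rw [le_div_iff₀ (mul_pos hσ hpos), hM, le_div_iff₀ (by positivity)]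
  have h1 : p * (T * (σ * A) * (2 * (p - 2) * J0)) = 4 * σ * (T * D) * A := by
    rw [hD]; ring
  have h2 : 4 * σ * (T * D) * A ≤ p * (1 + q) * A * A := by gcongr
  refine le_of_mul_le_mul_left ?_ (show 0 < p by linarith)
  linarith
end

section
/- Let p ≥ 2, λ₁ > 0, and let f : [0,∞) → ℝ be continuous with F(u) := ∫₀^u f(s) ds. Then the following are equivalent: (i) there exist ε > 0, β > 0, γ > 0 with β ≤ ε λ₁ / p such that (p+ε) F(u) ≤ u f(u) + β u^p + γ for all u > 0 (condition (C_p)); (ii) there exist ε > 0, a ∈ (0, λ₁/p], b > 0 and a nondecreasing function h : (0,∞) → ℝ such that F(u) = u^{p+ε} h(u) + a u^p + b for all u > 0. Moreover one can take a = β/ε and b = γ/(p+ε) in (ii), and β = εa, γ = (p+ε)b in (i). -/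
open Real Set

/-- The primitive of a function continuous on `[0, ∞)` is differentiable on `(0, ∞)`. -/
theorem hasDerivAt_integral_of_continuousOn_Ici {f : ℝ → ℝ}
    (hf : ContinuousOn f (Set.Ici 0)) {u : ℝ} (hu : 0 < u) :
    HasDerivAt (fun x : ℝ => ∫ s in (0:ℝ)..x, f s) (f u) u := by
  refine intervalIntegral.integral_hasDerivAt_right ?_ ?_ ?_
  · refine ContinuousOn.intervalIntegrable (hf.mono ?_)
    rw [Set.uIcc_of_le hu.le]
    exact Set.Icc_subset_Ici_self
  · exact (hf.mono Set.Ioi_subset_Ici_self).stronglyMeasurableAtFilter isOpen_Ioi u hu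
  · exact hf.continuousAt (Ici_mem_nhds hu)

theorem hasDerivAt_sub_mul_rpow_neg {F : ℝ → ℝ} {u F' : ℝ} (hu : 0 < u)
    (hF : HasDerivAt F F' u) (p q a b : ℝ) :
    HasDerivAt (fun x : ℝ => (F x - a * x ^ p - b) * x ^ (-q))
      (u ^ (-q - 1) * (u * F' - q * F u + (q - p) * a * u ^ p + q * b)) u := by
  have hp := (Real.hasDerivAt_rpow_const (x := u) (p := p) (Or.inl hu.ne')).const_mul a
  have hq := Real.hasDerivAt_rpow_const (x := u) (p := -q) (Or.inl hu.ne')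
  have h := ((hF.sub hp).sub_const b).mul hq
  refine h.congr_deriv ?_
  have e1 : u ^ (-q) = u ^ (-q - 1) * u := by
    rw [Real.rpow_sub_one hu.ne', div_mul_cancel₀ _ hu.ne']
  have e2 : u ^ p = u ^ (p - 1) * u := by
    rw [Real.rpow_sub_one hu.ne', div_mul_cancel₀ _ hu.ne']
  simp only [Pi.sub_apply]
  rw [e1, e2]
  ring

/-- For `F` differentiable on `(0, ∞)`, the quotient `(F(u) - a u^p - b) / u^q` is nondecreasing
iff `q F(u) ≤ u F'(u) + (q - p) a u^p + q b`. -/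
theorem monotoneOn_sub_mul_rpow_neg_iff {F f : ℝ → ℝ}
    (hF : ∀ u, 0 < u → HasDerivAt F (f u) u) (p q a b : ℝ) :
    MonotoneOn (fun x : ℝ => (F x - a * x ^ p - b) * x ^ (-q)) (Set.Ioi 0) ↔
      ∀ u, 0 < u → q * F u ≤ u * f u + (q - p) * a * u ^ p + q * b := by
  have hd : ∀ u, 0 < u → HasDerivAt (fun x : ℝ => (F x - a * x ^ p - b) * x ^ (-q))
      (u ^ (-q - 1) * (u * f u - q * F u + (q - p) * a * u ^ p + q * b)) u :=
    fun u hu => hasDerivAt_sub_mul_rpow_neg hu (hF u hu) p q a b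
  constructor
  · intro hm u hu
    have h0 := hm.derivWithin_nonneg (x := u)
    rw [derivWithin_of_mem_nhds (Ioi_mem_nhds hu), (hd u hu).deriv] at h0
    have := nonneg_of_mul_nonneg_right h0 (Real.rpow_pos_of_pos hu _)
    linarith
  · intro h
    refine monotoneOn_of_deriv_nonneg (convex_Ioi 0)
      (fun u hu => (hd u hu).continuousAt.continuousWithinAt) ?_ ?_ <;>
      rw [interior_Ioi]
    · exact fun u hu => (hd u hu).differentiableAt.differentiableWithinAt
    · intro u hu
      rw [(hd u hu).deriv]
      have := h u hu
      exact mul_nonneg (Real.rpow_nonneg (le_of_lt hu) _) (by linarith)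

/-- Characterization of condition `(C_p)`: `f` satisfies
`(p+ε)F(u) ≤ u f(u) + β u^p + γ` for some `ε, β, γ > 0` with `β ≤ ε λ₁/p` iff
`F(u) = u^{p+ε} h(u) + a u^p + b` for some `ε > 0`, `a ∈ (0, λ₁/p]`, `b > 0` and a
nondecreasing `h` on `(0,∞)`; moreover one can take `a = β/ε`, `b = γ/(p+ε)` and
conversely `β = ε a`, `γ = (p+ε) b`. -/
theorem condition_Cp_characterization
    (p lam1 : ℝ) (hp : 2 ≤ p) (hlam1 : 0 < lam1)
    (f : ℝ → ℝ) (hf : ContinuousOn f (Set.Ici 0))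
    (F : ℝ → ℝ) (hF : ∀ u : ℝ, F u = ∫ s in (0:ℝ)..u, f s) :
    ((∃ ε > (0:ℝ), ∃ β > (0:ℝ), ∃ γ > (0:ℝ), β ≤ ε * lam1 / p ∧
        ∀ u : ℝ, 0 < u → (p + ε) * F u ≤ u * f u + β * u ^ p + γ) ↔
      (∃ ε > (0:ℝ), ∃ a : ℝ, (0 < a ∧ a ≤ lam1 / p) ∧ ∃ b > (0:ℝ), ∃ h : ℝ → ℝ,
        MonotoneOn h (Set.Ioi 0) ∧
        ∀ u : ℝ, 0 < u → F u = u ^ (p + ε) * h u + a * u ^ p + b)) ∧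
    (∀ ε β γ : ℝ, 0 < ε → 0 < β → 0 < γ → β ≤ ε * lam1 / p →
      (∀ u : ℝ, 0 < u → (p + ε) * F u ≤ u * f u + β * u ^ p + γ) →
      ∃ h : ℝ → ℝ, MonotoneOn h (Set.Ioi 0) ∧
        ∀ u : ℝ, 0 < u → F u = u ^ (p + ε) * h u + (β / ε) * u ^ p + γ / (p + ε)) ∧
    (∀ ε a b : ℝ, 0 < ε → 0 < a → a ≤ lam1 / p → 0 < b → ∀ h : ℝ → ℝ,
      MonotoneOn h (Set.Ioi 0) →
      (∀ u : ℝ, 0 < u → F u = u ^ (p + ε) * h u + a * u ^ p + b) →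
      (ε * a ≤ ε * lam1 / p ∧
        ∀ u : ℝ, 0 < u → (p + ε) * F u ≤ u * f u + (ε * a) * u ^ p + (p + ε) * b)) := by
  have hFd : ∀ u, 0 < u → HasDerivAt F (f u) u := by
    intro u hu
    rw [show F = fun x : ℝ => ∫ s in (0:ℝ)..x, f s from funext hF]
    exact hasDerivAt_integral_of_continuousOn_Ici hf hu
  have hp0 : 0 < p := by linarith
  have key : ∀ ε β γ : ℝ, 0 < ε → 0 < β → 0 < γ → β ≤ ε * lam1 / p →
      (∀ u : ℝ, 0 < u → (p + ε) * F u ≤ u * f u + β * u ^ p + γ) →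
      ∃ h : ℝ → ℝ, MonotoneOn h (Set.Ioi 0) ∧
        ∀ u : ℝ, 0 < u → F u = u ^ (p + ε) * h u + (β / ε) * u ^ p + γ / (p + ε) := by
    intro ε β γ hε _ _ _ h
    refine ⟨_, (monotoneOn_sub_mul_rpow_neg_iff hFd p (p + ε) (β / ε) (γ / (p + ε))).2 ?_, ?_⟩
    · intro u hu
      rw [add_sub_cancel_left, mul_div_cancel₀ _ hε.ne',
        mul_div_cancel₀ _ (by positivity : p + ε ≠ 0)]
      exact h u hu
    · intro u hu
      have hpow : u ^ (p + ε) * u ^ (-(p + ε)) = 1 := by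
        rw [← Real.rpow_add hu, add_neg_cancel, Real.rpow_zero]
      linear_combination -(F u - β / ε * u ^ p - γ / (p + ε)) * hpow
  have key' : ∀ ε a b : ℝ, 0 < ε → 0 < a → a ≤ lam1 / p → 0 < b → ∀ h : ℝ → ℝ,
      MonotoneOn h (Set.Ioi 0) →
      (∀ u : ℝ, 0 < u → F u = u ^ (p + ε) * h u + a * u ^ p + b) →
      (ε * a ≤ ε * lam1 / p ∧
        ∀ u : ℝ, 0 < u → (p + ε) * F u ≤ u * f u + (ε * a) * u ^ p + (p + ε) * b) := by
    intro ε a b hε _ hal _ h hm h_eq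
    refine ⟨by rw [mul_div_assoc]; gcongr, ?_⟩
    have h_iff := monotoneOn_sub_mul_rpow_neg_iff hFd p (p + ε) a b
    rw [add_sub_cancel_left] at h_iff
    refine h_iff.1 (hm.congr fun u hu => ?_)
    have hpow : u ^ (p + ε) * u ^ (-(p + ε)) = 1 := by
      rw [← Real.rpow_add hu, add_neg_cancel, Real.rpow_zero]
    simp only [h_eq u hu]
    linear_combination -h u * hpow
  refine ⟨⟨?_, ?_⟩, key, key'⟩
  · rintro ⟨ε, hε, β, hβ, γ, hγ, hle, h⟩
    refine ⟨ε, hε, β / ε, ⟨by positivity, ?_⟩, γ / (p + ε), by positivity,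
      key ε β γ hε hβ hγ hle h⟩
    rw [div_le_iff₀ hε]
    exact hle.trans_eq (by ring)
  · rintro ⟨ε, hε, a, ⟨ha, hal⟩, b, hb, h, hm, h_eq⟩
    exact ⟨ε, hε, ε * a, by positivity, (p + ε) * b, by positivity,
      key' ε a b hε ha hal hb h hm h_eq⟩
end
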